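/- Let n and m be integers with n > 1 and m > 4n. Then every non-homotopic drawing in the plane with n vertices and m edges has crossing number at least m²/(24n). -/

import Mathlib

open unitInterval ENNReal

/-- A drawing in the plane with `n` vertices and `m` edges: a finite set `V ⊆ ℂ` of
`n` vertices together with continuous curves `f e : [0,1] → ℂ` whose endpoints are
vertices and whose interiors avoid the vertices. -/
structure PlaneDrawing (n m : ℕ) where
  V : Set ℂ
  finV : V.Finite
  cardV : V.ncard = n
  f : Fin m → I → ℂ
  cont : ∀ e, Continuous (f e)
  source_mem : ∀ e, f e 0 ∈ V
  target_mem : ∀ e, f e 1 ∈ V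
  interior_not_mem : ∀ e, ∀ t : I, t ≠ 0 → t ≠ 1 → f e t ∉ V

/-- Homotopy between two curves, fixing the endpoints of the first, with interior
avoiding the vertex set `V`. -/
def HomotopicIn (V : Set ℂ) (a b : I → ℂ) : Prop :=
  ∃ g : I × I → ℂ, Continuous g ∧
    (∀ t, g (0, t) = a t) ∧ (∀ t, g (1, t) = b t) ∧
    (∀ s, g (s, 0) = a 0) ∧ (∀ s, g (s, 1) = a 1) ∧
    (∀ s t : I, s ≠ 0 → s ≠ 1 → t ≠ 0 → t ≠ 1 → g (s, t) ∉ V)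

/-- Two edges are homotopic if one is homotopic to the other or to its reversal. -/
def EdgeHomotopic (V : Set ℂ) (a b : I → ℂ) : Prop :=
  HomotopicIn V a b ∨ HomotopicIn V (fun t => a (σ t)) b

/-- An edge is a trivial loop if it is homotopic to the constant map at its endpoint. -/
def IsTrivialLoop (V : Set ℂ) (a : I → ℂ) : Prop :=
  EdgeHomotopic V a fun _ => a 0

/-- A drawing is non-homotopic if no two distinct edges are homotopic and
no edge is a trivial loop. -/
def PlaneDrawing.NonHomotopic {n m : ℕ} (D : PlaneDrawing n m) : Prop :=
  (∀ e e' : Fin m, e ≠ e' → ¬ EdgeHomotopic D.V (D.f e) (D.f e')) ∧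
  (∀ e : Fin m, ¬ IsTrivialLoop D.V (D.f e))

/-- The crossing number: half the cardinality of the set of ordered crossings. -/
noncomputable def PlaneDrawing.crossingNumber {n m : ℕ} (D : PlaneDrawing n m) : ℝ≥0∞ :=
  (({p : (Fin m × I) × (Fin m × I) |
      p.1 ≠ p.2 ∧ p.1.2 ≠ 0 ∧ p.1.2 ≠ 1 ∧ p.2.2 ≠ 0 ∧ p.2.2 ≠ 1 ∧
      D.f p.1.1 p.1.2 = D.f p.2.1 p.2.2}).encard : ℝ≥0∞) / 2

namespace SlabPath

/-- A part of the `i`-th vertical line: upper ray, vertex, or lower ray. -/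
abbrev Side := ℕ × SignType

/-- A point of the `i`-th vertical line, given by its height relative to the vertex. -/
abbrev Station := ℕ × ℝ

noncomputable def side (p : Station) : Side := (p.1, SignType.sign p.2)

/-- The slab on the other side of the line `i`, seen from the slab `k`. -/
def opp (i k : ℕ) : ℕ := 2 * i + 1 - k

/-- The line `i` bounds the slab `k`. -/
def Adj (k i : ℕ) : Prop := i = k ∨ i + 1 = k

def toggle (r : Side) : List Side → List Side
  | [] => [r]
  | h :: t => if h = r then t else r :: h :: t

def Reduced (s : List Side) : Prop := s.IsChain (· ≠ ·)

lemma opp_opp {i k : ℕ} (h : Adj k i) : opp i (opp i k) = k := by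
  unfold opp Adj at *; omega

lemma adj_opp {i k : ℕ} (h : Adj k i) : Adj (opp i k) i := by
  unfold opp Adj at *; omega

lemma opp_ne {i k : ℕ} (_ : Adj k i) : opp i k ≠ k := by
  unfold opp Adj at *; omega

lemma reduced_nil : Reduced [] := List.isChain_nil

lemma fst_of_side {p q : Station} (h : side p = side q) : p.1 = q.1 := congrArg (fun r : Side => r.1) h

lemma sign_of_side {p q : Station} (h : side p = side q) :
    SignType.sign p.2 = SignType.sign q.2 := congrArg (fun r : Side => r.2) h

lemma Reduced.toggle {s : List Side} (h : Reduced s) (r : Side) : Reduced (toggle r s) := by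
  unfold Reduced at *
  rcases s with _ | ⟨a, t⟩
  · simp [SlabPath.toggle]
  · by_cases har : a = r
    · simpa [SlabPath.toggle, har] using h.tail
    · simp [SlabPath.toggle, har, h, Ne.symm har]

lemma toggle_toggle {s : List Side} (h : Reduced s) (r : Side) : toggle r (toggle r s) = s := by
  unfold Reduced at *
  rcases s with _ | ⟨a, t⟩
  · simp [SlabPath.toggle]
  · by_cases har : a = r
    · subst har
      rcases t with _ | ⟨b, t⟩
      · simp [toggle]
      · have : b ≠ a := by
          have := List.isChain_cons_cons.1 h
          exact this.1.symm
        simp [toggle, this]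
    · simp [toggle, har]

/-- A slab of the universal cover: a slab of the plane and a reduced word. -/
abbrev Node := ℕ × List Side

noncomputable def step (p : Station) (N : Node) : Node := (opp p.1 N.1, toggle (side p) N.2)

structure Ok (N : Node) (p : Station) : Prop where
  adj : Adj N.1 p.1
  red : Reduced N.2

lemma step_step {N : Node} {p : Station} (h : Ok N p) : step p (step p N) = N := by
  ext1
  · exact opp_opp h.adj
  · exact toggle_toggle h.red _

lemma step_congr {p q : Station} (h : side p = side q) (N : Node) : step p N = step q N := by
  have h1 : p.1 = q.1 := fst_of_side h
  simp [step, h, h1]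

lemma step_ne {N : Node} {p : Station} (h : Ok N p) : step p N ≠ N := fun e =>
  opp_ne h.adj (congrArg Prod.fst e)

/-- An incidence of a lifted curve: a slab of the cover and a boundary point of it. -/
abbrev Inc := Node × Station

/-- The incidences of a half path that starts in the slab `N`. -/
noncomputable def half (N : Node) : List Station → Multiset Inc
  | [] => 0
  | [q] => {(N, q)}
  | q :: r :: t => (N, q) ::ₘ (step q N, q) ::ₘ half (step q N) (r :: t)

/-- The list of stations of a half path starting in slab `k` and ending at a vertex. -/
def HalfOk (k : ℕ) : List Station → Prop
  | [] => False
  | [q] => Adj k q.1 ∧ q.2 = 0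
  | q :: r :: t => Adj k q.1 ∧ q.2 ≠ 0 ∧ HalfOk (opp q.1 k) (r :: t)

lemma HalfOk.ne_nil {k : ℕ} {L : List Station} (h : HalfOk k L) : L ≠ [] := by
  rintro rfl; exact h

/-- The order of the boundary points of the slab `k`: the left line upwards, then the right
line downwards. -/
noncomputable def beta (k : ℕ) (a c : Station) : ZMod 2 :=
  if (a.1 = c.1 ∧ a.1 = k ∧ c.2 < a.2) ∨ (a.1 = c.1 ∧ a.1 ≠ k ∧ a.2 < c.2) ∨ a.1 < c.1
  then 1 else 0

noncomputable def pair (x y : Inc) : ZMod 2 := if x.1 = y.1 then beta x.1.1 x.2 y.2 else 0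

/-- Number mod 2 of crossings of two lifted paths, in terms of incidences. -/
noncomputable def inter (P Q : Multiset Inc) : ZMod 2 :=
  (P.map fun x => (Q.map fun y => pair x y).sum).sum

@[simp] lemma inter_add_left (P P' Q : Multiset Inc) :
    inter (P + P') Q = inter P Q + inter P' Q := by simp [inter]

@[simp] lemma inter_add_right (P Q Q' : Multiset Inc) :
    inter P (Q + Q') = inter P Q + inter P Q' := by simp [inter]

lemma inter_eq_zero {P Q : Multiset Inc} (h : ∀ x ∈ P, ∀ y ∈ Q, x.1 ≠ y.1) :
    inter P Q = 0 := by
  unfold inter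
  apply Multiset.sum_eq_zero
  intro z hz
  obtain ⟨x, hx, rfl⟩ := Multiset.mem_map.1 hz
  apply Multiset.sum_eq_zero
  intro z hz
  obtain ⟨y, hy, rfl⟩ := Multiset.mem_map.1 hz
  simp [pair, h x hx y hy]

/-- Incidences with a vertex are identified when they come from the same boundary point of the
universal cover. -/
noncomputable def label (x : Inc) : Inc :=
  if x.2.2 = 0 then ((0, x.1.2.dropWhile (fun r => r.1 = x.2.1)), x.2) else x

def Apart (P Q : Multiset Inc) : Prop := ∀ x ∈ P, ∀ y ∈ Q, label x ≠ label y

lemma dropWhile_toggle (r : Side) (s : List Side) :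
    (toggle r s).dropWhile (fun r' => r'.1 = r.1) = s.dropWhile (fun r' => r'.1 = r.1) := by
  rcases s with _ | ⟨a, t⟩
  · simp [toggle]
  · by_cases har : a = r
    · simp [toggle, har]
    · simp [toggle, har, List.dropWhile_cons]

lemma label_step {N : Node} {p v : Station} (h : p.1 = v.1) (hv : v.2 = 0) :
    label (step p N, v) = label (N, v) := by
  have := dropWhile_toggle (side p) N.2
  simp only [side, h] at this
  simp [label, hv, step, side, h, this]

lemma beta_comm {k : ℕ} {a c : Station} (h : a ≠ c) : beta k a c + beta k c a = 1 := by
  have : a.1 = c.1 → a.2 ≠ c.2 := fun h1 h2 => h (Prod.ext h1 h2)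
  unfold beta
  rcases lt_trichotomy a.1 c.1 with h1 | h1 | h1
  · have h2 : ¬ c.1 < a.1 := by omega
    have h3 : c.1 ≠ a.1 := by omega
    simp [h1, h2, h3, h1.ne]
  · have h2 := this h1
    rcases lt_or_gt_of_ne h2 with h3 | h3 <;> by_cases h4 : c.1 = k <;>
      simp [h1, h3, h4, not_lt.2 h3.le]
  · have h2 : ¬ a.1 < c.1 := by omega
    have h3 : a.1 ≠ c.1 := by omega
    simp [h1, h2, h3, h1.ne]

lemma beta_opp {i k : ℕ} {a c : Station} (h : Adj k i) (ha : a.1 = i) (hc : c.1 = i) (hne : a ≠ c) :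
    beta k a c + beta (opp i k) a c = 1 := by
  have h2 : a.2 ≠ c.2 := fun h2 => hne (Prod.ext (ha.trans hc.symm) h2)
  unfold beta
  rcases h with rfl | rfl
  · have h4 : i ≠ opp i i := by unfold opp; omega
    rcases lt_or_gt_of_ne h2 with h3 | h3 <;>
      simp [ha, hc, h3, h4, not_lt.2 h3.le]
  · have h4 : i = opp i (i+1) := by unfold opp; omega
    rcases lt_or_gt_of_ne h2 with h3 | h3 <;>
      simp [ha, hc, h3, ← h4, not_lt.2 h3.le]

lemma beta_congr_left {k : ℕ} {p p' q : Station} (h1 : p.1 = p'.1)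
    (h : p.1 = q.1 → ((p.2 < q.2 ↔ p'.2 < q.2) ∧ (q.2 < p.2 ↔ q.2 < p'.2))) :
    beta k p q = beta k p' q := by
  unfold beta
  rw [← h1]
  by_cases h2 : p.1 = q.1
  · simp only [(h h2).1, (h h2).2]
  · simp [h2]

lemma pair_symm {x y : Inc} (h : label x ≠ label y) (hn : x.1 = y.1) :
    pair x y + pair y x = 1 := by
  have : x.2 ≠ y.2 := fun h2 => h (by rw [Prod.ext hn h2])
  simp only [pair, hn, if_true]
  exact beta_comm this

lemma lt_iff_of_sign {a b c : ℝ} (ha : a ≠ 0) (h : SignType.sign a = SignType.sign b ∨ b = 0)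
    (hc : SignType.sign c ≠ SignType.sign a) (hbc : b = 0 → c ≠ 0) :
    (a < c ↔ b < c) ∧ (c < a ↔ c < b) := by
  rcases lt_or_gt_of_ne ha with h1 | h1 <;> rcases lt_trichotomy b 0 with h2 | h2 | h2 <;>
    rcases lt_trichotomy c 0 with h3 | h3 | h3 <;> simp [h1, h2, h3, h1.ne, h1.ne'] at h hc hbc <;>
    refine ⟨⟨fun _ => ?_, fun _ => ?_⟩, fun _ => ?_, fun _ => ?_⟩ <;> linarith

lemma inter_quad {N : Node} {p p' : Station} (hN : Ok N p) (hp : p.2 ≠ 0) (h1 : p.1 = p'.1)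
    (hs : side p = side p' ∨ p'.2 = 0) :
    ∀ {L : List Station} {M : Node}, HalfOk M.1 L → Reduced M.2 →
    Apart {(N, p), (step p N, p), (step p N, p'), (N, p')} (half M L) →
    inter {(N, p), (step p N, p), (step p N, p'), (N, p')} (half M L) = 0 := by
  set N' := step p N with hN'
  let g : Inc → ZMod 2 := fun y => pair (N, p) y + pair (N', p) y + pair (N', p') y + pair (N, p') y
  have hg : ∀ Q, inter {(N, p), (N', p), (N', p'), (N, p')} Q = (Q.map g).sum := by
    intro Q
    simp [inter, g, Multiset.sum_map_add, add_assoc]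
  have two : ∀ z : ZMod 2, z + z = 0 := fun z => CharTwo.add_self_eq_zero z
  have hNN : N ≠ N' := (step_ne hN).symm
  have hg0 : ∀ M : Node, ∀ q : Station, (p.1 = q.1 → ((p.2 < q.2 ↔ p'.2 < q.2) ∧
      (q.2 < p.2 ↔ q.2 < p'.2))) → g (M, q) = 0 := by
    intro M q h
    have e : ∀ k, beta k p q = beta k p' q := fun k => beta_congr_left h1 h
    simp only [g, pair, e]
    generalize (if N = M then beta N.1 p' q else 0) = a
    generalize (if N' = M then beta N'.1 p' q else 0) = b
    linear_combination two a + two b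
  have hlab : ∀ z : Station, z.1 = p.1 → z.2 = 0 → label (N', z) = label (N, z) :=
    fun z hz1 hz2 => label_step hz1.symm hz2
  have hsp : side p = side p' → ∀ q : Station, side q ≠ side p → p.1 = q.1 →
      ((p.2 < q.2 ↔ p'.2 < q.2) ∧ (q.2 < p.2 ↔ q.2 < p'.2)) := by
    intro hpp q hq hpq
    refine lt_iff_of_sign hp (Or.inl (sign_of_side hpp)) (fun e => hq (Prod.ext hpq.symm e)) ?_
    intro h
    have := sign_of_side hpp
    rw [h, sign_zero, sign_eq_zero_iff] at this
    exact absurd this hp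
  have hv : ∀ q : Station, p'.2 = 0 → q.2 ≠ 0 → side q ≠ side p → p.1 = q.1 →
      ((p.2 < q.2 ↔ p'.2 < q.2) ∧ (q.2 < p.2 ↔ q.2 < p'.2)) := by
    intro q hp' hq hqs hpq
    exact lt_iff_of_sign hp (Or.inr hp') (fun e => hqs (Prod.ext hpq.symm e)) fun _ => hq
  have hlast : ∀ M : Node, ∀ q : Station, q.2 = 0 →
      Apart {(N, p), (N', p), (N', p'), (N, p')} {(M, q)} → g (M, q) = 0 := by
    intro M q hq hap
    by_cases hpq : p.1 = q.1
    · by_cases hp' : p'.2 = 0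
      · have hqp : q = p' := Prod.ext (by rw [← hpq, h1]) (by rw [hq, hp'])
        subst hqp
        have n1 : N ≠ M := by
          rintro rfl
          exact hap (N, q) (by simp) (N, q) (by simp) rfl
        have n2 : N' ≠ M := by
          rintro rfl
          exact hap (N', q) (by simp) (N', q) (by simp) rfl
        simp [g, pair, n1, n2]
      · refine hg0 M q (hsp (hs.resolve_right hp') q ?_)
        intro h
        have := congrArg Prod.snd h
        simp [side, hq] at this
        exact hp (sign_eq_zero_iff.1 this.symm)
    · exact hg0 M q fun h => absurd h hpq
  have hmid : ∀ M : Node, ∀ q : Station, Ok M q → q.2 ≠ 0 →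
      Apart {(N, p), (N', p), (N', p'), (N, p')} {(M, q), (step q M, q)} →
      g (M, q) + g (step q M, q) = 0 := by
    intro M q hM hq hap
    by_cases hqs : side q = side p
    · have hpq : p.1 = q.1 := (fst_of_side hqs).symm
      have key : ∀ {A : Node}, (A = N ∨ A = N') → (A = M ∨ A = step q M) → 
          p ≠ q ∧ (p'.2 ≠ 0 → p' ≠ q) := by
        intro A hA hA2
        constructor
        · rintro rfl
          refine hap (A, p) ?_ (A, p) ?_ rfl
          · rcases hA with rfl | rfl <;> simp
          · rcases hA2 with rfl | rfl <;> simp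
        · rintro - rfl
          refine hap (A, p') ?_ (A, p') ?_ rfl
          · rcases hA with rfl | rfl <;> simp
          · rcases hA2 with rfl | rfl <;> simp
      have key2 : ∀ {A : Node}, (A = N ∨ A = N') → (A = M ∨ A = step q M) → p ≠ q ∧ p' ≠ q := by
        intro A hA hA2
        refine ⟨(key hA hA2).1, ?_⟩
        by_cases h : p'.2 = 0
        · rintro rfl; exact hq h
        · exact (key hA hA2).2 h
      have hNopp : N'.1 = opp p.1 N.1 := rfl
      have fin : p ≠ q → p' ≠ q → beta N.1 p q + beta N'.1 p q + beta N'.1 p' q + beta N.1 p' q = 0 := by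
        intro n1 n2
        have a1 := beta_opp (a := p) (c := q) hN.adj rfl hpq.symm n1
        have a2 := beta_opp (a := p') (c := q) hN.adj h1.symm hpq.symm n2
        rw [hNopp]
        linear_combination a1 + a2 + two 1
      by_cases e1 : N = M
      · have e2 : step q M = N' := by rw [← e1, hN', step_congr hqs]
        obtain ⟨n1, n2⟩ := key2 (A := N) (Or.inl rfl) (Or.inl e1)
        rw [e2, ← e1]
        simp only [g, pair, hNN, hNN.symm, if_true, if_false]
        linear_combination fin n1 n2
      · by_cases e2 : N' = M
        · have e3 : step q M = N := by rw [← e2, hN', step_congr hqs, step_step hN]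
          obtain ⟨n1, n2⟩ := key2 (A := N') (Or.inr rfl) (Or.inl e2)
          rw [e3, ← e2]
          simp only [g, pair, hNN, hNN.symm, if_true, if_false]
          linear_combination fin n1 n2
        · have e3 : N ≠ step q M := by
            intro h
            apply e2
            rw [hN', h, ← step_congr hqs, step_step hM]
          have e4 : N' ≠ step q M := by
            intro h
            apply e1
            have := step_step hN
            rw [← hN', h, ← step_congr hqs, step_step hM] at this
            exact this.symm
          simp [g, pair, e1, e2, e3, e4]
    · have : ∀ A, g (A, q) = 0 := by
        intro A
        apply hg0
        by_cases hp' : p'.2 = 0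
        · exact hv q hp' hq hqs
        · exact hsp (hs.resolve_right hp') q hqs
      rw [this, this, add_zero]
  intro L
  induction L with
  | nil => intro M h; exact absurd h (by simp [HalfOk])
  | cons q t ih =>
    intro M hL hM hap
    rcases t with _ | ⟨r, t⟩
    · rw [hg]
      simp only [half, Multiset.map_singleton, Multiset.sum_singleton]
      exact hlast M q hL.2 hap
    · have h3 := ih (M := step q M) hL.2.2 (hM.toggle _) (fun x hx y hy => hap x hx y (by
        simp only [half, Multiset.mem_cons]; exact Or.inr (Or.inr hy)))
      rw [hg] at h3 ⊢
      simp only [half, Multiset.map_cons, Multiset.sum_cons]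
      rw [h3, add_zero]
      refine hmid M q ⟨hL.1, hM⟩ hL.2.1 (fun x hx y hy => hap x hx y ?_)
      simp only [half, Multiset.mem_cons]
      simp at hy
      tauto

end SlabPath

namespace SlabPath

lemma half_cons {N : Node} {q : Station} {L : List Station} (h : L ≠ []) :
    half N (q :: L) = (N, q) ::ₘ (step q N, q) ::ₘ half (step q N) L := by
  rcases L with _ | ⟨r, t⟩
  · exact absurd rfl h
  · rfl

lemma halfOk_cons {k : ℕ} {q : Station} {L : List Station} (h : L ≠ []) :
    HalfOk k (q :: L) ↔ Adj k q.1 ∧ q.2 ≠ 0 ∧ HalfOk (opp q.1 k) L := by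
  rcases L with _ | ⟨r, t⟩
  · exact absurd rfl h
  · rfl

/-- The incidences of the lift of a path; the path is given by its two halves, which start in
the slab `N`. -/
noncomputable def incs (N : Node) (L R : List Station) : Multiset Inc := half N L + half N R

lemma incs_comm (N : Node) (L R : List Station) : incs N L R = incs N R L := add_comm _ _

lemma incs_shift {N : Node} {q : Station} {L R : List Station} (hN : Ok N q) (hL : L ≠ [])
    (hR : R ≠ []) : incs (step q N) (q :: L) R = incs N L (q :: R) := by
  simp only [incs, half_cons hL, half_cons hR, step_step hN, ← Multiset.singleton_add]
  abel

/-- Moving the base slab along a path. -/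
inductive Link (k₀ : ℕ) (L₀ R₀ : List Station) : ℕ → List Station → List Station → Prop
  | base : Link k₀ L₀ R₀ k₀ L₀ R₀
  | fwd {k q L R} : Link k₀ L₀ R₀ k L (q :: R) → R ≠ [] → Link k₀ L₀ R₀ (opp q.1 k) (q :: L) R
  | symm {k L R} : Link k₀ L₀ R₀ k L R → Link k₀ L₀ R₀ k R L

lemma Link.halfOk {k₀ : ℕ} {L₀ R₀ : List Station} (hL : HalfOk k₀ L₀) (hR : HalfOk k₀ R₀)
    {k : ℕ} {L R : List Station} (h : Link k₀ L₀ R₀ k L R) : HalfOk k L ∧ HalfOk k R := by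
  induction h with
  | base => exact ⟨hL, hR⟩
  | fwd _ hne ih =>
    obtain ⟨h1, h2⟩ := ih
    rw [halfOk_cons hne] at h2
    rw [halfOk_cons h1.ne_nil, opp_opp h2.1]
    exact ⟨⟨adj_opp h2.1, h2.2.1, h1⟩, h2.2.2⟩
  | symm _ ih => exact ih.symm

/-- The lifts of the second path have the same intersection numbers as suitable lifts of the
first one. -/
def Simulates (k : ℕ) (L R : List Station) (k' : ℕ) (L' R' : List Station) : Prop :=
  ∀ s', Reduced s' → ∃ s, Reduced s ∧
    (∀ x ∈ incs (k', s') L' R', ∃ y ∈ incs (k, s) L R, label y = label x) ∧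
    (∀ x ∈ incs (k, s) L R, x.2.2 = 0 → ∃ y ∈ incs (k', s') L' R', label y = label x) ∧
    ∀ (M : Node) (S : List Station), HalfOk M.1 S → Reduced M.2 →
      Apart (incs (k, s) L R) (half M S) →
      inter (incs (k, s) L R) (half M S) = inter (incs (k', s') L' R') (half M S)

lemma Simulates.trans {k k' k'' : ℕ} {L L' L'' R R' R'' : List Station}
    (h : Simulates k L R k' L' R') (h' : Simulates k' L' R' k'' L'' R'') :
    Simulates k L R k'' L'' R'' := by
  intro s'' hs''
  obtain ⟨s', hs', a1, a2, a3⟩ := h' s'' hs''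
  obtain ⟨s, hs, b1, b2, b3⟩ := h s' hs'
  refine ⟨s, hs, ?_, ?_, ?_⟩
  · intro x hx
    obtain ⟨y, hy, e⟩ := a1 x hx
    obtain ⟨z, hz, e'⟩ := b1 y hy
    exact ⟨z, hz, e'.trans e⟩
  · intro x hx h0
    obtain ⟨y, hy, e⟩ := b2 x hx h0
    have : y.2.2 = 0 := by
      simp only [label, h0, if_true] at e
      by_contra h
      rw [if_neg h] at e
      rw [e] at h
      exact h h0
    obtain ⟨z, hz, e'⟩ := a2 y hy this
    exact ⟨z, hz, e'.trans e⟩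
  · intro M S hS hM hap
    rw [b3 M S hS hM hap]
    apply a3 M S hS hM
    intro x hx y hy e
    obtain ⟨z, hz, e'⟩ := b1 x hx
    exact hap z hz y hy (e'.trans e)

lemma simulates_of_incs_eq {k k' : ℕ} {L L' R R' : List Station}
    (h : ∀ s', Reduced s' → ∃ s, Reduced s ∧ incs (k, s) L R = incs (k', s') L' R') :
    Simulates k L R k' L' R' := by
  intro s' hs'
  obtain ⟨s, hs, e⟩ := h s' hs'
  refine ⟨s, hs, ?_, ?_, ?_⟩ <;> rw [e]
  · exact fun x hx => ⟨x, hx, rfl⟩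
  · exact fun x hx _ => ⟨x, hx, rfl⟩
  · exact fun _ _ _ _ _ => rfl

lemma Simulates.refl (k : ℕ) (L R : List Station) : Simulates k L R k L R :=
  simulates_of_incs_eq fun s hs => ⟨s, hs, rfl⟩

lemma Simulates.symm (k : ℕ) (L R : List Station) : Simulates k L R k R L :=
  simulates_of_incs_eq fun s hs => ⟨s, hs, incs_comm _ _ _⟩

lemma Simulates.shift {k : ℕ} {q : Station} {L R : List Station} (hq : Adj k q.1) (hL : L ≠ [])
    (hR : R ≠ []) : Simulates k L (q :: R) (opp q.1 k) (q :: L) R := by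
  apply simulates_of_incs_eq
  intro s' hs'
  refine ⟨toggle (side q) s', hs'.toggle _, ?_⟩
  rw [← incs_shift ⟨hq, hs'.toggle _⟩ hL hR]
  simp [step, toggle_toggle hs']

lemma Link.simulates {k₀ : ℕ} {L₀ R₀ : List Station} (hL : HalfOk k₀ L₀) (hR : HalfOk k₀ R₀)
    {k : ℕ} {L R : List Station} (h : Link k₀ L₀ R₀ k L R) : Simulates k₀ L₀ R₀ k L R := by
  induction h with
  | base => exact .refl _ _ _
  | fwd h hne ih =>
    have h1 := h.halfOk hL hR
    exact ih.trans (.shift ((halfOk_cons hne).1 h1.2).1 h1.1.ne_nil hne)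
  | symm _ ih => exact ih.trans (.symm _ _ _)

lemma Simulates.of_quad {k : ℕ} {p p' : Station} {L R R' : List Station} (hp : Adj k p.1)
    (hp0 : p.2 ≠ 0) (h1 : p.1 = p'.1) (hs : side p = side p' ∨ p'.2 = 0)
    (h : ∀ s, Reduced s → half (k, s) R + (if p'.2 = 0 then {((k, s), p'), ((k, s), p')} else 0) =
      half (k, s) R' + {((k, s), p), (step p (k, s), p), (step p (k, s), p'), ((k, s), p')})
    (h' : ∀ s, p'.2 = 0 → ((k, s), p') ∈ half (k, s) R') :
    Simulates k L R k L R' := by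
  intro s hs'
  have hOk : Ok (k, s) p := ⟨hp, hs'⟩
  have hl : p'.2 = 0 → label (step p (k, s), p') = label ((k, s), p') := fun h0 => label_step h1 h0
  have e := h s hs'
  have two : ∀ z : ZMod 2, z + z = 0 := fun z => CharTwo.add_self_eq_zero z
  have two' : ∀ x : Inc, ∀ Q, inter {x, x} Q = 0 := by
    intro x Q
    have : ({x, x} : Multiset Inc) = {x} + {x} := rfl
    rw [this, inter_add_left, two]
  have hsub : ∀ x ∈ half (k, s) R' + {((k, s), p), (step p (k, s), p), (step p (k, s), p'), ((k, s), p')},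
      ∃ y ∈ half (k, s) R, label y = label x := by
    intro x hx
    by_cases h0 : p'.2 = 0
    · have hx' := hx
      rw [← e, if_pos h0] at hx
      have : (step p (k, s), p') ∈ half (k, s) R + {((k, s), p'), ((k, s), p')} := by
        rw [if_pos h0] at e
        rw [e]; simp
      have hmem : (step p (k, s), p') ∈ half (k, s) R := by
        rcases Multiset.mem_add.1 this with h | h
        · exact h
        · have : step p (k, s) = (k, s) := by simpa using h
          exact absurd this (step_ne hOk)
      rcases Multiset.mem_add.1 hx with h | h
      · exact ⟨x, h, rfl⟩
      · have : x = ((k, s), p') := by simpa using h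
        subst this
        exact ⟨_, hmem, hl h0⟩
    · rw [← e, if_neg h0] at hx
      exact ⟨x, by simpa using hx, rfl⟩
  refine ⟨s, hs', ?_, ?_, ?_⟩
  · intro x hx
    rcases Multiset.mem_add.1 hx with h | h
    · exact ⟨x, Multiset.mem_add.2 (Or.inl h), rfl⟩
    · obtain ⟨y, hy, e⟩ := hsub x (Multiset.mem_add.2 (Or.inl h))
      exact ⟨y, Multiset.mem_add.2 (Or.inr hy), e⟩
  · intro x hx hx0
    rcases Multiset.mem_add.1 hx with h | h
    · exact ⟨x, Multiset.mem_add.2 (Or.inl h), rfl⟩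
    · have : x ∈ half (k, s) R' + {((k, s), p), (step p (k, s), p), (step p (k, s), p'), ((k, s), p')} := by
        rw [← e]; exact Multiset.mem_add.2 (Or.inl h)
      rcases Multiset.mem_add.1 this with h2 | h2
      · exact ⟨x, Multiset.mem_add.2 (Or.inr h2), rfl⟩
      · simp only [Multiset.insert_eq_cons, Multiset.mem_cons, Multiset.mem_singleton] at h2
        rcases h2 with rfl | rfl | rfl | rfl
        · exact absurd hx0 hp0
        · exact absurd hx0 hp0
        · exact ⟨_, Multiset.mem_add.2 (Or.inr (h' s hx0)), (hl hx0).symm⟩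
        · exact ⟨_, Multiset.mem_add.2 (Or.inr (h' s hx0)), rfl⟩
  · intro M S hS hM hap
    have hq := inter_quad hOk hp0 h1 hs hS hM (fun x hx y hy he => by
      obtain ⟨z, hz, ez⟩ := hsub x (Multiset.mem_add.2 (Or.inr hx))
      exact hap z (Multiset.mem_add.2 (Or.inr hz)) y hy (ez.trans he))
    have e2 := congrArg (fun P => inter P (half M S)) e
    simp only [inter_add_left] at e2
    rw [hq, add_zero] at e2
    have e3 : inter (if p'.2 = 0 then {((k, s), p'), ((k, s), p')} else 0) (half M S) = 0 := by
      split_ifs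
      · exact two' _ _
      · simp [inter]
    rw [e3, add_zero] at e2
    simp [incs, e2]

lemma Simulates.mid {k : ℕ} {p p' : Station} {L R : List Station} (hp : HalfOk k (p :: p' :: R))
    (hR : R ≠ []) (hs : side p = side p') : Simulates k L (p :: p' :: R) k L R := by
  have h1 := fst_of_side hs
  rw [halfOk_cons (by simp), halfOk_cons hR] at hp
  have h0 : p'.2 ≠ 0 := hp.2.2.2.1
  refine .of_quad hp.1 hp.2.1 h1 (Or.inl hs) ?_ fun _ h => absurd h h0
  intro s hs'
  rw [if_neg h0, half_cons (by simp), half_cons hR, ← step_congr hs (step p _),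
    step_step ⟨hp.1, hs'⟩]
  simp only [← Multiset.singleton_add, Multiset.insert_eq_cons]
  abel

lemma Simulates.last {k : ℕ} {p v : Station} {L : List Station} (hp : HalfOk k [p, v])
    (hs : p.1 = v.1) : Simulates k L [p, v] k L [v] := by
  refine .of_quad hp.1 hp.2.1 hs (Or.inr hp.2.2.2) ?_ fun _ _ => by simp [half]
  intro s hs'
  rw [if_pos hp.2.2.2]
  simp only [half, ← Multiset.singleton_add, Multiset.insert_eq_cons]
  abel

lemma sum_half {M : Type*} [AddCommMonoid M] (φ : Node → M) (hφ : ∀ N, φ N + φ N = 0)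
    (L : List Station) : ∀ N : Node, L ≠ [] → ((half N L).map fun x => φ x.1).sum = φ N := by
  induction L with
  | nil => intro N h; exact absurd rfl h
  | cons q t ih =>
    intro N _
    by_cases ht : t = []
    · simp [ht, half]
    · rw [half_cons ht]
      simp only [Multiset.map_cons, Multiset.sum_cons, ih _ ht]
      rw [hφ, add_zero]

lemma sum_incs {M : Type*} [AddCommMonoid M] (φ : Node → M) (hφ : ∀ N, φ N + φ N = 0)
    {L R : List Station} (N : Node) (hL : L ≠ []) (hR : R ≠ []) :
    ((incs N L R).map fun x => φ x.1).sum = 0 := by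
  simp [incs, sum_half φ hφ _ N hL, sum_half φ hφ _ N hR, hφ]

lemma inter_comm {P : Multiset Inc} {N : Node} {L R : List Station} (hL : L ≠ []) (hR : R ≠ [])
    (h : Apart P (incs N L R)) : inter P (incs N L R) = inter (incs N L R) P := by
  have two : ∀ z : ZMod 2, z + z = 0 := fun z => CharTwo.add_self_eq_zero z
  have hsw : inter (incs N L R) P = (P.map fun x => ((incs N L R).map fun y => pair y x).sum).sum :=
    Multiset.sum_map_sum_map _ _
  have : inter P (incs N L R) + inter (incs N L R) P = 0 := by
    rw [hsw, inter, ← Multiset.sum_map_add]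
    apply Multiset.sum_eq_zero
    intro z hz
    obtain ⟨x, hx, rfl⟩ := Multiset.mem_map.1 hz
    rw [← Multiset.sum_map_add,
      Multiset.map_congr (g := fun y => if y.1 = x.1 then (1 : ZMod 2) else 0) rfl]
    · exact sum_incs (fun M => if M = x.1 then (1 : ZMod 2) else 0) (fun _ => two _) N hL hR
    · intro y hy
      by_cases e : y.1 = x.1
      · rw [if_pos e, add_comm]
        exact pair_symm (fun e' => h x hx y hy e'.symm) e
      · simp [pair, e, Ne.symm e]
  have e := two (inter (incs N L R) P)
  linear_combination this - e

end SlabPath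

namespace SlabPath

/-- Two stations are the end points of a chord that cannot be pushed across a vertical line. -/
def TightRel (a b : Side) : Prop := a.1 = b.1 → a.2 * b.2 < 0

instance : DecidableRel TightRel := fun a b => by unfold TightRel; infer_instance

lemma TightRel.symm {a b : Side} (h : TightRel a b) : TightRel b a := fun e => by
  rw [mul_comm]; exact h e.symm

lemma TightRel.ne {a b : Side} (h : TightRel a b) : a ≠ b := by
  rintro rfl
  have := h rfl
  revert this
  generalize a.2 = z
  cases z <;> decide

lemma TightRel.fst_ne {a b : Side} (h : TightRel a b) (hb : b.2 = 0) : a.1 ≠ b.1 := by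
  intro e
  have := h e
  simp [hb] at this

def Tight (w : List Side) : Prop := w.IsChain TightRel

/-- The position of a side on the boundary of the slab `k`. -/
def posn (k : ℕ) (r : Side) : ℕ :=
  if r.1 = k then (match r.2 with | .neg => 5 | .zero => 4 | .pos => 3)
  else (match r.2 with | .neg => 0 | .zero => 1 | .pos => 2)

lemma posn_lt (k : ℕ) (r : Side) : posn k r < 6 := by
  rcases r with ⟨i, s⟩
  unfold posn; cases s <;> split_ifs <;> simp

lemma posn_inj {k : ℕ} {r r' : Side} (h : Adj k r.1) (h' : Adj k r'.1) (e : posn k r = posn k r') :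
    r = r' := by
  rcases r with ⟨i, s⟩
  rcases r' with ⟨i', s'⟩
  simp only [Adj] at h h'
  unfold posn at e
  cases s <;> cases s' <;> split_ifs at e <;> simp at * <;> omega

def rel (e p : ℕ) : ℕ := (p + 6 - e) % 6

def code (k e : ℕ) : List Side → List ℕ
  | [] => []
  | r :: t => rel e (posn k r) :: code (opp r.1 k) (posn (opp r.1 k) r) t

def ind (p : Prop) [Decidable p] : ZMod 2 := if p then 1 else 0

lemma rel_lt {e p q : ℕ} (he : e < 6) (hp : p < 6) (hq : q < 6) (hne : p ≠ q) :
    ind (rel e p < rel e q) = ind (p < q) + ind (p < e) + ind (q < e) := by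
  unfold rel ind
  interval_cases e <;> interval_cases p <;> interval_cases q <;> rfl

lemma rel_inj {e p q : ℕ} (he : e < 6) (hp : p < 6) (hq : q < 6) (h : rel e p = rel e q) : p = q := by
  unfold rel at h; omega

lemma ind_congr {p q : Prop} [Decidable p] [Decidable q] (h : p ↔ q) : ind p = ind q := by
  simp [ind, h]

lemma code_cons_lt {k e : ℕ} {a b : Side} {A B : List Side} (he : e < 6)
    (hne : posn k a ≠ posn k b) :
    ind (code k e (a :: A) < code k e (b :: B)) =
      ind (posn k a < posn k b) + ind (posn k a < e) + ind (posn k b < e) := by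
  rw [← rel_lt he (posn_lt _ _) (posn_lt _ _) hne]
  apply ind_congr
  simp only [code, List.cons_lt_cons_iff]
  have : rel e (posn k a) ≠ rel e (posn k b) := fun h =>
    hne (rel_inj he (posn_lt _ _) (posn_lt _ _) h)
  simp [this]

lemma code_cons_lt_self {k e : ℕ} {a : Side} {A B : List Side} :
    code k e (a :: A) < code k e (a :: B) ↔
      code (opp a.1 k) (posn (opp a.1 k) a) A < code (opp a.1 k) (posn (opp a.1 k) a) B := by
  simp [code]

lemma two_zmod (z : ZMod 2) : z + z = 0 := CharTwo.add_self_eq_zero z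

lemma code_rotate {k e : ℕ} {a b : Side} {A B : List Side} (he : e < 6) (ha : Adj k a.1)
    (hb : Adj k b.1) :
    ind (code k e (a :: A) < code k e (b :: B)) =
      ind (code k 0 (a :: A) < code k 0 (b :: B)) + ind (posn k a < e) + ind (posn k b < e) := by
  by_cases h : posn k a = posn k b
  · obtain rfl := posn_inj ha hb h
    rw [ind_congr code_cons_lt_self, ind_congr (code_cons_lt_self (e := 0)), add_assoc, two_zmod,
      add_zero]
  · rw [code_cons_lt he h, code_cons_lt (by norm_num) h]
    simp [ind]

noncomputable def wd (L : List Station) : List Side := L.map side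

lemma posn_lt_iff {k : ℕ} {a c : Station} (ha : Adj k a.1) (hc : Adj k c.1) (hne : side a ≠ side c) :
    beta k a c = ind (posn k (side a) < posn k (side c)) := by
  have hpos : ∀ x : ℝ, 0 < x → SignType.sign x = SignType.pos := fun x hx => sign_pos hx
  have hneg : ∀ x : ℝ, x < 0 → SignType.sign x = SignType.neg := fun x hx => sign_neg hx
  have hzero : SignType.sign (0:ℝ) = SignType.zero := sign_zero
  have e : (a.1 = c.1 → SignType.sign a.2 ≠ SignType.sign c.2) := fun h1 h2 =>
    hne (Prod.ext h1 h2)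
  unfold beta ind posn side Adj at *
  rcases lt_trichotomy a.2 0 with h1 | h1 | h1 <;> rcases lt_trichotomy c.2 0 with h2 | h2 | h2 <;>
    simp only [h1, h2, hpos, hneg, hzero] at e ⊢ <;>
    rcases ha with ha | ha <;> rcases hc with hc | hc <;>
    first
    | exact absurd rfl (e (by omega))
    | skip
  all_goals
    first
    | (have i1 : a.1 = k := ha
       have i2 : c.1 = k := hc
       simp only [i1, i2, if_true]
       congr 1
       have := h1; have := h2
       simp <;> linarith)
    | (have i1 : a.1 = k := ha
       have i2 : c.1 ≠ k := by omega
       have i3 : a.1 ≠ c.1 := by omega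
       have i4 : ¬ a.1 < c.1 := by omega
       simp [i1, i2, i3, i4]
       try omega)
    | (have i1 : a.1 ≠ k := by omega
       have i2 : c.1 = k := by omega
       have i3 : a.1 ≠ c.1 := by omega
       have i4 : a.1 < c.1 := by omega
       simp [i1, i2, i3, i4]
       try omega)
    | (have i1 : a.1 ≠ k := by omega
       have i2 : c.1 ≠ k := by omega
       have i3 : a.1 = c.1 := by omega
       have := h1; have := h2
       simp [i1, i2, i3] <;> linarith)

/-- The word `s` of a slab of the cover is compatible with leaving through `r`. -/
def Compat (s : List Side) (r : Side) : Prop := ∀ h ∈ s.head?, TightRel h r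

lemma Compat.toggle {s : List Side} {r : Side} (h : Compat s r) : toggle r s = r :: s := by
  rcases s with _ | ⟨a, t⟩
  · rfl
  · have : a ≠ r := (h a (by simp)).ne
    simp [SlabPath.toggle, this]

lemma compat_cons {a r : Side} {s : List Side} (h : TightRel a r) : Compat (a :: s) r := by
  intro b hb; simp at hb; rwa [← hb]

structure Good (N : Node) (q : Station) (L : List Station) : Prop where
  ok : HalfOk N.1 (q :: L)
  tight : Tight (wd (q :: L))
  compat : Compat N.2 (side q)

lemma Good.tail {N : Node} {q r : Station} {L : List Station} (h : Good N q (r :: L)) :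
    Good (step q N) r L := by
  have h2 := List.isChain_cons_cons.1 h.tight
  refine ⟨h.ok.2.2, h2.2, ?_⟩
  simp only [step, h.compat.toggle]
  exact compat_cons h2.1

lemma Good.step_snd {N : Node} {q : Station} {L : List Station} (h : Good N q L) :
    (step q N).2 = side q :: N.2 := h.compat.toggle

lemma Good.adj {N : Node} {q : Station} {L : List Station} (h : Good N q L) : Adj N.1 q.1 := by
  have := h.ok
  rcases L with _ | ⟨r, t⟩ <;> exact this.1

lemma Good.suffix {L : List Station} : ∀ {N : Node} {q : Station}, Good N q L →
    ∀ x ∈ half N (q :: L), N.2 <:+ x.1.2 := by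
  induction L with
  | nil => intro N q _ x hx; simp [half] at hx; simp [hx]
  | cons r t ih =>
    intro N q h x hx
    simp only [half, Multiset.mem_cons] at hx
    have hs : N.2 <:+ (step q N).2 := by rw [h.step_snd]; exact List.suffix_cons _ _
    rcases hx with rfl | rfl | hx
    · exact List.suffix_refl _
    · exact hs
    · exact hs.trans (ih h.tail x hx)

/-- The incidences of a half path that do not lie in the first slab. -/
noncomputable def rest (N : Node) (q : Station) : List Station → Multiset Inc
  | [] => 0
  | r :: t => (step q N, q) ::ₘ half (step q N) (r :: t)

lemma half_eq_rest (N : Node) (q : Station) (L : List Station) :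
    half N (q :: L) = {(N, q)} + rest N q L := by
  rcases L with _ | ⟨r, t⟩
  · simp [half, rest]
  · simp only [half, rest, Multiset.singleton_add]

lemma Good.suffix_rest {L : List Station} {N : Node} {q : Station} (h : Good N q L) :
    ∀ x ∈ rest N q L, (side q :: N.2) <:+ x.1.2 := by
  rcases L with _ | ⟨r, t⟩
  · simp [rest]
  · intro x hx
    simp only [rest, Multiset.mem_cons] at hx
    rcases hx with rfl | hx
    · rw [h.step_snd]
    · rw [← h.step_snd]; exact h.tail.suffix x hx

lemma Good.rest_ne {L : List Station} {N : Node} {q : Station} (h : Good N q L) :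
    ∀ x ∈ rest N q L, x.1 ≠ N := by
  intro x hx e
  have := (h.suffix_rest x hx).length_le
  rw [e] at this
  simp at this

lemma inter_single (x y : Inc) : inter {x} {y} = pair x y := by simp [inter]

lemma Good.inter_left {L : List Station} {N : Node} {q a : Station} (h : Good N q L) :
    inter {(N, a)} (half N (q :: L)) = beta N.1 a q := by
  rw [half_eq_rest, inter_add_right, inter_single, inter_eq_zero (Q := rest N q L)]
  · simp [pair]
  · intro x hx y hy e
    simp at hx
    exact h.rest_ne y hy (by rw [← e, hx])

lemma Good.inter_right {L : List Station} {N : Node} {q a : Station} (h : Good N q L) :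
    inter (half N (q :: L)) {(N, a)} = beta N.1 q a := by
  rw [half_eq_rest, inter_add_left, inter_single, inter_eq_zero (P := rest N q L)]
  · simp [pair]
  · intro x hx y hy e
    simp at hy
    exact h.rest_ne x hx (by rw [e, hy])

lemma ind_not_lt {a e : ℕ} (h : a ≠ e) : ind (e < a) = 1 + ind (a < e) := by
  unfold ind
  rcases lt_or_gt_of_ne h with h1 | h1
  · simp [h1, not_lt.2 h1.le, two_zmod]
  · simp [h1, not_lt.2 h1.le]

/-- The intersection number of two half paths is determined by the order of their codes. -/
lemma inter_half {A : List Station} : ∀ {B : List Station} {N : Node} {a b : Station},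
    Good N a A → Good N b B →
    (∀ x ∈ half N (a :: A), x ∈ half N (b :: B) → x.2.2 = 0) →
    wd (a :: A) ≠ wd (b :: B) →
    inter (half N (a :: A)) (half N (b :: B)) =
      ind (code N.1 0 (wd (a :: A)) < code N.1 0 (wd (b :: B))) := by
  induction A with
  | nil =>
    intro B N a b hA hB hap hne
    by_cases hs : side a = side b
    · exfalso
      have ha : a.2 = 0 := hA.ok.2
      have hb : b.2 = 0 := by
        have := sign_of_side hs
        rw [ha, sign_zero] at this
        exact sign_eq_zero_iff.1 this.symm
      rcases B with _ | ⟨b', B⟩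
      · exact hne (by simp [wd, hs])
      · exact hB.ok.2.1 hb
    · have hp : posn N.1 (side a) ≠ posn N.1 (side b) := fun h =>
        hs (posn_inj hA.adj hB.adj h)
      have e1 : inter (rest N a []) (rest N b B) = 0 := by simp [rest, inter]
      have e2 := hB.inter_left (a := a)
      have e3 : half N [a] = {(N, a)} := rfl
      rw [e3, e2, posn_lt_iff hA.adj hB.adj hs]
      simp only [wd, List.map_cons]
      rw [code_cons_lt (by norm_num) hp]
      simp [ind]
  | cons a' A ih =>
    intro B N a b hA hB hap hne
    by_cases hs : side a = side b
    · have ha : a.2 ≠ 0 := hA.ok.2.1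
      rcases B with _ | ⟨b', B⟩
      · exfalso
        have hb : b.2 = 0 := hB.ok.2
        have := sign_of_side hs
        rw [hb, sign_zero, sign_eq_zero_iff] at this
        exact ha this
      have hab : a ≠ b := by
        rintro rfl
        exact ha (hap (N, a) (by simp [half]) (by simp [half]))
      have hst : step b N = step a N := (step_congr hs N).symm
      have hA' := hA.tail
      have hB' := hB.tail
      rw [hst] at hB'
      set N' := step a N with hN'
      have hne' : wd (a' :: A) ≠ wd (b' :: B) := by
        intro h; apply hne
        simp only [wd, List.map_cons] at h ⊢
        rw [h, hs]
      have key := ih hA' hB' (fun x hx hx' => hap x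
        (by rw [half_cons (by simp)]; exact Multiset.mem_cons_of_mem (Multiset.mem_cons_of_mem hx))
        (by rw [half_cons (by simp), hst]
            exact Multiset.mem_cons_of_mem (Multiset.mem_cons_of_mem hx'))) hne'
      have i1 : beta N.1 a b + beta N'.1 a b = 1 := beta_opp hA.adj rfl (fst_of_side hs).symm hab
      have ta : TightRel (side a) (side a') := (List.isChain_cons_cons.1 hA.tight).1
      have tb : TightRel (side b) (side b') := (List.isChain_cons_cons.1 hB.tight).1
      have oa : Adj N'.1 a.1 := adj_opp hA.adj
      have ob : Adj N'.1 b.1 := by rw [← fst_of_side hs]; exact oa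
      have j1 : beta N'.1 a b' = ind (posn N'.1 (side a) < posn N'.1 (side b')) :=
        posn_lt_iff oa hB'.adj (by rw [hs]; exact tb.ne)
      have j2 : beta N'.1 a' b = ind (posn N'.1 (side a') < posn N'.1 (side a)) := by
        rw [hs]
        exact posn_lt_iff hA'.adj ob (by rw [← hs]; exact ta.symm.ne)
      have hp : posn N'.1 (side b') ≠ posn N'.1 (side a) := fun h =>
        tb.ne (by rw [← hs, posn_inj hB'.adj oa h])
      rw [ind_not_lt hp] at j1
      have hcode : ind (code N.1 0 (wd (a :: a' :: A)) < code N.1 0 (wd (b :: b' :: B))) =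
          ind (code N'.1 0 (wd (a' :: A)) < code N'.1 0 (wd (b' :: B))) +
            ind (posn N'.1 (side a') < posn N'.1 (side a)) +
            ind (posn N'.1 (side b') < posn N'.1 (side a)) := by
        simp only [wd, List.map_cons]
        rw [← hs, ind_congr code_cons_lt_self]
        exact code_rotate (posn_lt _ _) hA'.adj hB'.adj
      rw [hcode, half_eq_rest N a, half_eq_rest N b]
      simp only [inter_add_left, inter_add_right]
      rw [inter_single, inter_eq_zero (P := {(N, a)}) (Q := rest N b (b' :: B)),
        inter_eq_zero (P := rest N a (a' :: A)) (Q := {(N, b)})]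
      · simp only [rest, ← Multiset.singleton_add, hst, ← hN', inter_add_left, inter_add_right]
        rw [key, inter_single, hB'.inter_left, hA'.inter_right, j1, j2]
        simp only [pair, if_true]
        linear_combination i1 + two_zmod 1
      · intro x hx y hy e
        simp at hy
        exact hA.rest_ne x hx (by rw [e, hy])
      · intro x hx y hy e
        simp at hx
        exact hB.rest_ne y hy (by rw [← e, hx])
    · have hp : posn N.1 (side a) ≠ posn N.1 (side b) := fun h =>
        hs (posn_inj hA.adj hB.adj h)
      rw [half_eq_rest, half_eq_rest]
      simp only [inter_add_left, inter_add_right]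
      rw [inter_single, inter_eq_zero (P := {(N, a)}) (Q := rest N b B),
        inter_eq_zero (P := rest N a (a' :: A)) (Q := {(N, b)}),
        inter_eq_zero (P := rest N a (a' :: A)) (Q := rest N b B)]
      · simp only [wd, List.map_cons]
        rw [code_cons_lt (by norm_num) hp]
        simp [ind, pair, posn_lt_iff hA.adj hB.adj hs]
      · intro x hx y hy e
        have s1 := hA.suffix_rest x hx
        have s2 := hB.suffix_rest y hy
        rw [← e] at s2
        have := List.suffix_of_suffix_length_le s1 s2 (by simp)
        have := this.eq_of_length (by simp)
        simp at this
        exact hs this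
      · intro x hx y hy e
        simp at hy
        exact hA.rest_ne x hx (by rw [e, hy])
      · intro x hx y hy e
        simp at hx
        exact hB.rest_ne y hy (by rw [← e, hx])

lemma Good.zero_label {L : List Station} : ∀ {N : Node} {q : Station}, Good N q L →
    ∀ x ∈ half N (q :: L), x.2.2 = 0 → ∃ v, x.2 = v ∧
      label x = ((0, (wd (q :: L)).dropLast.reverse ++ N.2), v) ∧
      (wd (q :: L)).getLast? = some (side v) := by
  induction L with
  | nil =>
    intro N q h x hx hx0
    simp [half] at hx
    subst hx
    refine ⟨q, rfl, ?_, by simp [wd]⟩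
    have hx0' : q.2 = 0 := hx0
    have : N.2.dropWhile (fun r => decide (r.1 = q.1)) = N.2 := by
      have hc := h.compat
      generalize N.2 = s at *
      rcases s with _ | ⟨a, t⟩
      · rfl
      · have : a.1 ≠ q.1 := (hc a (by simp)).fst_ne (by simp [side, hx0'])
        simp [this]
    simp [label, hx0', wd, this]
  | cons r t ih =>
    intro N q h x hx hx0
    simp only [half, Multiset.mem_cons] at hx
    rcases hx with rfl | rfl | hx
    · exact absurd hx0 h.ok.2.1
    · exact absurd hx0 h.ok.2.1
    · obtain ⟨v, h1, h2, h3⟩ := ih h.tail x hx hx0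
      refine ⟨v, h1, ?_, ?_⟩
      · rw [h2, h.step_snd]
        simp [wd]
      · simp [wd] at h3 ⊢
        exact h3

lemma label_ne_of_wd_ne {N : Node} {A B : List Station} {a b : Station} (hA : Good N a A)
    (hB : Good N b B) (hne : wd (a :: A) ≠ wd (b :: B)) :
    ∀ x ∈ half N (a :: A), ∀ y ∈ half N (b :: B), x.2.2 = 0 → label x ≠ label y := by
  intro x hx y hy hx0 e
  have hy0 : y.2.2 = 0 := by
    have : (label x).2.2 = 0 := by simp [label, hx0]
    rw [e] at this
    unfold label at this
    split_ifs at this with h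
    · exact h
    · exact this
  obtain ⟨v, h1, h2, h3⟩ := hA.zero_label x hx hx0
  obtain ⟨v', h1', h2', h3'⟩ := hB.zero_label y hy hy0
  rw [h2, h2'] at e
  simp only [Prod.mk.injEq, true_and, List.append_left_inj, List.reverse_inj] at e
  obtain ⟨e1, rfl⟩ := e
  apply hne
  rw [← List.dropLast_append_getLast? _ h3, ← List.dropLast_append_getLast? _ h3', e1]

end SlabPath

namespace SlabPath

lemma Apart.mono {P P' Q Q' : Multiset Inc} (h : Apart P Q)
    (hP : ∀ x ∈ P', ∃ y ∈ P, label y = label x) (hQ : ∀ x ∈ Q', ∃ y ∈ Q, label y = label x) :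
    Apart P' Q' := by
  intro x hx y hy e
  obtain ⟨x', hx', e1⟩ := hP x hx
  obtain ⟨y', hy', e2⟩ := hQ y hy
  exact h x' hx' y' hy' (by rw [e1, e2, e])

lemma Apart.symm {P Q : Multiset Inc} (h : Apart P Q) : Apart Q P :=
  fun x hx y hy e => h y hy x hx e.symm

lemma Apart.left {P Q Q' : Multiset Inc} (h : Apart P (Q + Q')) : Apart P Q :=
  fun x hx y hy => h x hx y (Multiset.mem_add.2 (Or.inl hy))

lemma Apart.right {P Q Q' : Multiset Inc} (h : Apart P (Q + Q')) : Apart P Q' :=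
  fun x hx y hy => h x hx y (Multiset.mem_add.2 (Or.inr hy))

lemma good_of_tight {k : ℕ} {q : Station} {L : List Station} (h : HalfOk k (q :: L))
    (ht : Tight (wd (q :: L))) : Good (k, []) q L :=
  ⟨h, ht, fun a ha => by simp at ha⟩

lemma half_label_ne {k : ℕ} {A B : List Station} (hA : HalfOk k A) (hB : HalfOk k B)
    (tA : Tight (wd A)) (tB : Tight (wd B)) (hne : wd A ≠ wd B) :
    ∀ x ∈ half (k, []) A, ∀ y ∈ half (k, []) B, x.2.2 = 0 → label x ≠ label y := by
  rcases A with _ | ⟨a, A⟩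
  · exact absurd rfl hA.ne_nil
  rcases B with _ | ⟨b, B⟩
  · exact absurd rfl hB.ne_nil
  exact label_ne_of_wd_ne (good_of_tight hA tA) (good_of_tight hB tB) hne

lemma inter_half_code {k e : ℕ} {A B : List Station} (hA : HalfOk k A) (hB : HalfOk k B)
    (tA : Tight (wd A)) (tB : Tight (wd B)) (hne : wd A ≠ wd B) (he : e < 6)
    (hap : Apart (half (k, []) A) (half (k, []) B)) :
    inter (half (k, []) A) (half (k, []) B) =
      ind (code k e (wd A) < code k e (wd B)) +
        ind (∀ r ∈ (wd A).head?, posn k r < e) + ind (∀ r ∈ (wd B).head?, posn k r < e) := by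
  rcases A with _ | ⟨a, A⟩
  · exact absurd rfl hA.ne_nil
  rcases B with _ | ⟨b, B⟩
  · exact absurd rfl hB.ne_nil
  have gA := good_of_tight hA tA
  have gB := good_of_tight hB tB
  rw [inter_half gA gB (fun x hx hx' => absurd rfl (hap x hx x hx')) hne]
  simp only [wd, List.map_cons]
  rw [code_rotate (e := e) he gA.adj gB.adj]
  simp only [List.head?_cons, Option.mem_some_iff, forall_eq']
  linear_combination - two_zmod (ind (posn k (side a) < e)) - two_zmod (ind (posn k (side b) < e))

/-- If the codes of two tight paths through the same slab are linked, then the original paths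
cross in the universal cover. -/
theorem exists_crossing {k₀ k₀' k e : ℕ} {L₀ R₀ L₀' R₀' L R L' R' : List Station}
    (hL₀ : HalfOk k₀ L₀) (hR₀ : HalfOk k₀ R₀) (hL₀' : HalfOk k₀' L₀') (hR₀' : HalfOk k₀' R₀')
    (h : Simulates k₀ L₀ R₀ k L R) (h' : Simulates k₀' L₀' R₀' k L' R')
    (hL : HalfOk k L) (hR : HalfOk k R) (hL' : HalfOk k L') (hR' : HalfOk k R')
    (tL : Tight (wd L)) (tR : Tight (wd R)) (tL' : Tight (wd L')) (tR' : Tight (wd R'))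
    (n1 : wd L ≠ wd L') (n2 : wd L ≠ wd R') (n3 : wd R ≠ wd L') (n4 : wd R ≠ wd R')
    (he : e < 6)
    (hsum : ind (code k e (wd L) < code k e (wd L')) + ind (code k e (wd L) < code k e (wd R')) +
      ind (code k e (wd R) < code k e (wd L')) + ind (code k e (wd R) < code k e (wd R')) = 1) :
    ∃ s s', Reduced s ∧ Reduced s' ∧
      (∀ x ∈ incs (k₀, s) L₀ R₀, ∀ y ∈ incs (k₀', s') L₀' R₀', x.2.2 = 0 → label x ≠ label y) ∧
      ((∃ x ∈ incs (k₀, s) L₀ R₀, x ∈ incs (k₀', s') L₀' R₀' ∧ x.2.2 ≠ 0) ∨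
        inter (incs (k₀, s) L₀ R₀) (incs (k₀', s') L₀' R₀') = 1) := by
  obtain ⟨s, hs, a1, a2, a3⟩ := h [] reduced_nil
  obtain ⟨s', hs', b1, b2, b3⟩ := h' [] reduced_nil
  have hzero : ∀ x ∈ incs (k, []) L R, ∀ y ∈ incs (k, []) L' R', x.2.2 = 0 → label x ≠ label y := by
    intro x hx y hy
    rcases Multiset.mem_add.1 hx with hx | hx <;> rcases Multiset.mem_add.1 hy with hy | hy
    · exact half_label_ne hL hL' tL tL' n1 x hx y hy
    · exact half_label_ne hL hR' tL tR' n2 x hx y hy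
    · exact half_label_ne hR hL' tR tL' n3 x hx y hy
    · exact half_label_ne hR hR' tR tR' n4 x hx y hy
  have lab0 : ∀ x y : Inc, label x = label y → (x.2.2 = 0 ↔ y.2.2 = 0) := by
    have : ∀ x, x.2.2 = 0 ↔ (label x).2.2 = 0 := by
      intro x; unfold label; split_ifs <;> simp [*]
    intro x y e; rw [this x, this y, e]
  have hzero' : ∀ x ∈ incs (k₀, s) L₀ R₀, ∀ y ∈ incs (k₀', s') L₀' R₀', x.2.2 = 0 →
      label x ≠ label y := by
    intro x hx y hy hx0 e
    have hy0 := (lab0 x y e).1 hx0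
    obtain ⟨x', hx', ex⟩ := a2 x hx hx0
    obtain ⟨y', hy', ey⟩ := b2 y hy hy0
    exact hzero x' hx' y' hy' ((lab0 _ _ ex).2 hx0) (by rw [ex, ey, e])
  refine ⟨s, s', hs, hs', hzero', ?_⟩
  by_cases hap : Apart (incs (k₀, s) L₀ R₀) (incs (k₀', s') L₀' R₀')
  · right
    have apPQ' : Apart (incs (k₀, s) L₀ R₀) (incs (k, []) L' R') :=
      hap.mono (fun x hx => ⟨x, hx, rfl⟩) b1
    have apP'Q' : Apart (incs (k, []) L R) (incs (k, []) L' R') :=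
      apPQ'.mono a1 fun x hx => ⟨x, hx, rfl⟩
    have e1 : inter (incs (k₀, s) L₀ R₀) (incs (k, []) L' R') =
        inter (incs (k, []) L R) (incs (k, []) L' R') := by
      rw [incs, incs, inter_add_right _ (half _ L') _, ← incs, a3 _ _ hL' reduced_nil apPQ'.left,
        a3 _ _ hR' reduced_nil apPQ'.right, ← inter_add_right]
    have e2 : inter (incs (k₀', s') L₀' R₀') (incs (k₀, s) L₀ R₀) =
        inter (incs (k, []) L' R') (incs (k₀, s) L₀ R₀) := by
      have := hap.symm
      rw [incs.eq_def (k₀, s), inter_add_right _ (half _ L₀) _, b3 _ _ hL₀ hs this.left,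
        b3 _ _ hR₀ hs this.right, ← inter_add_right]
    rw [inter_comm hL₀'.ne_nil hR₀'.ne_nil hap, e2, ← inter_comm hL'.ne_nil hR'.ne_nil apPQ', e1]
    simp only [incs] at apP'Q' ⊢
    have p1 := apP'Q'.left.symm.left.symm
    have p2 := apP'Q'.right.symm.left.symm
    have p3 := apP'Q'.left.symm.right.symm
    have p4 := apP'Q'.right.symm.right.symm
    simp only [inter_add_left, inter_add_right]
    rw [inter_half_code hL hL' tL tL' n1 he p1, inter_half_code hL hR' tL tR' n2 he p2,
      inter_half_code hR hL' tR tL' n3 he p3, inter_half_code hR hR' tR tR' n4 he p4]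
    linear_combination hsum + two_zmod (ind (∀ r ∈ (wd L).head?, posn k r < e)) +
      two_zmod (ind (∀ r ∈ (wd R).head?, posn k r < e)) +
      two_zmod (ind (∀ r ∈ (wd L').head?, posn k r < e)) +
      two_zmod (ind (∀ r ∈ (wd R').head?, posn k r < e))
  · left
    simp only [Apart, not_forall] at hap
    obtain ⟨x, hx, y, hy, e⟩ := hap
    have e : label x = label y := not_not.1 e
    have hx0 : x.2.2 ≠ 0 := fun h0 => hzero' x hx y hy h0 e
    have hy0 : y.2.2 ≠ 0 := fun h0 => hx0 ((lab0 x y e).2 h0)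
    simp only [label, if_neg hx0, if_neg hy0] at e
    subst e
    exact ⟨x, hx, hy, hx0⟩

end SlabPath

namespace SlabPath

def WOk (k : ℕ) : List Side → Prop
  | [] => False
  | [q] => Adj k q.1 ∧ q.2 = 0
  | q :: r :: t => Adj k q.1 ∧ q.2 ≠ 0 ∧ WOk (opp q.1 k) (r :: t)

lemma WOk.ne_nil {k : ℕ} {L : List Side} (h : WOk k L) : L ≠ [] := by
  rintro rfl; exact h

lemma wOk_cons {k : ℕ} {q : Side} {L : List Side} (h : L ≠ []) :
    WOk k (q :: L) ↔ Adj k q.1 ∧ q.2 ≠ 0 ∧ WOk (opp q.1 k) L := by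
  rcases L with _ | ⟨r, t⟩
  · exact absurd rfl h
  · rfl

lemma WOk.adj {k : ℕ} {q : Side} {L : List Side} (h : WOk k (q :: L)) : Adj k q.1 := by
  rcases L with _ | ⟨r, t⟩ <;> exact h.1

/-- The combinatorial data of a family of tight paths: `LW e k A B` means that the path `e`
traverses the slab `k`, and the sides met afterwards and before are those of `B` and `A`. -/
structure WordSys (E : Type) (n : ℕ) where
  LW : E → ℕ → List Side → List Side → Prop
  start : E → ℕ × Side × List Side
  base : ∀ e, LW e (start e).1 [(start e).2.1] (start e).2.2
  symm : ∀ {e k A B}, LW e k A B → LW e k B A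
  fwd : ∀ {e k A q B}, LW e k A (q :: B) → B ≠ [] → LW e (opp q.1 k) (q :: A) B
  ok : ∀ {e k A B}, LW e k A B → WOk k B
  tight : ∀ {e k a A b B}, LW e k (a :: A) (b :: B) → TightRel a b
  lt : ∀ {e k A B}, LW e k A B → ∀ a ∈ B, a.1 < n
  inj : ∀ {e₁ e₂ k v w}, LW e₁ k [v] w → LW e₂ k [v] w → e₁ = e₂

/-- The final half edge seen when following a path to its end. -/
def rev (k : ℕ) (A : List Side) : List Side → ℕ × Side × List Side
  | [] => (k, (0, 0), A)
  | [b] => (k, b, A)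
  | b :: b' :: B => rev (opp b.1 k) (b :: A) (b' :: B)

lemma rev_cons {k : ℕ} {A : List Side} {b : Side} {B : List Side} (h : B ≠ []) :
    rev k A (b :: B) = rev (opp b.1 k) (b :: A) B := by
  rcases B with _ | ⟨r, t⟩
  · exact absurd rfl h
  · rfl

lemma rev_word {B : List Side} : ∀ {k : ℕ} {A : List Side}, B ≠ [] →
    (rev k A B).2.2 = B.dropLast.reverse ++ A := by
  induction B with
  | nil => intro k A h; exact absurd rfl h
  | cons b B ih =>
    intro k A _
    by_cases h : B = []
    · subst h; rfl
    · rw [rev_cons h, ih h, List.dropLast_cons_of_ne_nil h]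
      simp

lemma rev_parity {B : List Side} : ∀ {k : ℕ} {A : List Side}, WOk k B →
    ((rev k A B).1 + k + B.length) % 2 = 1 := by
  induction B with
  | nil => intro k A h; exact absurd rfl h.ne_nil
  | cons b B ih =>
    intro k A h
    by_cases hB : B = []
    · subst hB; simp [rev]; omega
    · have h' := (wOk_cons hB).1 h
      rw [rev_cons hB]
      have := ih (A := b :: A) h'.2.2
      have h2 := h'.1
      simp only [List.length_cons]
      unfold opp Adj at *
      omega

lemma rev_rev {A : List Side} : ∀ {k : ℕ} {B : List Side}, WOk k A → B ≠ [] →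
    rev (rev k B A).1 [(rev k B A).2.1] (rev k B A).2.2 = rev k A B := by
  induction A with
  | nil => intro k B h; exact absurd rfl h.ne_nil
  | cons a A ih =>
    intro k B h hB
    by_cases hA : A = []
    · subst hA; rfl
    · have h' := (wOk_cons hA).1 h
      rw [rev_cons hA, ih h'.2.2 (by simp), rev_cons hB, opp_opp h'.1]

namespace WordSys

variable {E : Type} {n : ℕ} (S : WordSys E n)

lemma rev_ok {e : E} {B : List Side} : ∀ {k : ℕ} {A : List Side}, S.LW e k A B → 
    S.LW e (rev k A B).1 [(rev k A B).2.1] (rev k A B).2.2 := by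
  induction B with
  | nil => intro k A h; exact absurd rfl (S.ok h).ne_nil
  | cons b B ih =>
    intro k A h
    by_cases hB : B = []
    · subst hB; exact S.symm h
    · rw [rev_cons hB]; exact ih (S.fwd h hB)

lemma of_rev {e : E} {A : List Side} : ∀ {k : ℕ} {B : List Side}, WOk k A → B ≠ [] →
    S.LW e (rev k B A).1 [(rev k B A).2.1] (rev k B A).2.2 → S.LW e k A B := by
  induction A with
  | nil => intro k A h; exact absurd rfl h.ne_nil
  | cons b A ih =>
    intro k B h hB hl
    by_cases hA : A = []
    · subst hA; exact hl
    · have h' := (wOk_cons hA).1 h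
      rw [rev_cons hA] at hl
      have := S.fwd (ih h'.2.2 (by simp) hl) hB
      rwa [opp_opp h'.1] at this

lemma rev_ne {e : E} : ∀ (m k : ℕ) {A B : List Side}, B.length ≤ m → A.length ≤ B.length →
    S.LW e k A B → rev k A B ≠ rev k B A := by
  intro m
  induction m with
  | zero =>
    intro k A B h1 _ h
    exact absurd (List.length_eq_zero_iff.1 (by omega)) (S.ok h).ne_nil
  | succ m ih =>
    intro k A B h1 h2 h e
    have hA := (S.ok (S.symm h)).ne_nil
    have hB := (S.ok h).ne_nil
    have hw := congrArg (fun z => z.2.2) e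
    simp only [rev_word hA, rev_word hB] at hw
    rcases B with _ | ⟨b, B⟩
    · exact hB rfl
    have hlen := congrArg List.length hw
    by_cases c1 : A.length = (b :: B).length
    · have := List.append_inj_right hw (by simp at c1 ⊢; omega)
      rw [this] at h
      exact (S.tight h).ne rfl
    · simp only [List.length_cons] at c1 h2
      have hB' : B ≠ [] := by
        rintro rfl
        have : A.length = 0 := by simp at c1 h2; omega
        exact hA (List.length_eq_zero_iff.1 this)
      have hok := (wOk_cons hB').1 (S.ok h)
      rw [rev_cons hB'] at e
      by_cases c2 : A.length = B.length
      · have : A = B := by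
          have hw' : (b :: B).dropLast.reverse ++ A = (A.dropLast.reverse ++ [b]) ++ B := by
            rw [hw]; simp
          exact List.append_inj_right' hw' c2
        subst this
        have p1 := rev_parity (A := b :: A) hok.2.2
        have p2 := rev_parity (A := b :: A) (S.ok (S.symm h))
        rw [e] at p1
        have := hok.1
        unfold opp Adj at *
        omega
      · refine ih (opp b.1 k) (A := b :: A) (B := B) ?_ ?_ (S.fwd h hB') ?_
        · simp at h1; omega
        · simp; omega
        · rw [e, rev_cons hA, opp_opp hok.1]

def data (h : E × Bool) : ℕ × Side × List Side :=
  if h.2 then S.start h.1 else rev (S.start h.1).1 [(S.start h.1).2.1] (S.start h.1).2.2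

lemma data_ok (h : E × Bool) : S.LW h.1 (S.data h).1 [(S.data h).2.1] (S.data h).2.2 := by
  unfold data
  split_ifs
  · exact S.base _
  · exact S.rev_ok (S.base _)

lemma data_not (h : E × Bool) :
    S.data (h.1, !h.2) = rev (S.data h).1 [(S.data h).2.1] (S.data h).2.2 := by
  rcases h with ⟨e, _ | _⟩
  · have h1 := S.ok (S.base e)
    have := rev_rev (B := [(S.start e).2.1]) h1 (by simp)
    simp only [data, Bool.not_false, if_true, Bool.false_eq_true, if_false]
    rw [this]
    rcases hs : (S.start e).2.2 with _ | ⟨a, t⟩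
    · rw [hs] at h1; exact absurd rfl h1.ne_nil
    · simp only [rev]; rw [← hs]
  · simp [data]

lemma data_inj : Function.Injective S.data := by
  rintro ⟨e, b⟩ ⟨e', b'⟩ h
  have h1 := S.data_ok (e, b)
  have h2 := S.data_ok (e', b')
  rw [h] at h1
  obtain rfl : e = e' := S.inj h1 h2
  by_cases hb : b = b'
  · rw [hb]
  · exfalso
    have hb' : b' = !b := by cases b <;> cases b' <;> simp_all
    subst hb'
    have h3 := S.data_not (e, b)
    simp only at h3
    rw [h3] at h
    have h4 := S.data_ok (e, b)
    have hne := (S.ok h4).ne_nil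
    refine S.rev_ne _ _ le_rfl ?_ h4 (h.symm.trans ?_)
    · have := List.length_pos_iff.2 hne
      exact this
    · rfl

def key (h : E × Bool) : ℕ × ℕ := ((S.data h).2.1.1, (S.data h).1)

end WordSys

lemma code_inj {w : List Side} : ∀ {w' : List Side} {k e : ℕ}, e < 6 → WOk k w → WOk k w' →
    code k e w = code k e w' → w = w' := by
  induction w with
  | nil => intro w' k e _ h; exact absurd rfl h.ne_nil
  | cons a w ih =>
    intro w' k e he h h' hc
    rcases w' with _ | ⟨b, w'⟩
    · exact absurd rfl h'.ne_nil
    simp only [code, List.cons.injEq] at hc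
    obtain rfl := posn_inj h.adj h'.adj (rel_inj he (posn_lt _ _) (posn_lt _ _) hc.1)
    rcases w with _ | ⟨r, w⟩ <;> rcases w' with _ | ⟨r', w'⟩
    · rfl
    · exact absurd h.2 h'.2.1
    · exact absurd h'.2 h.2.1
    · rw [ih (posn_lt _ _) h.2.2 h'.2.2 hc.2]

/-- The code of a whole half edge. -/
def fullCode (d : ℕ × Side × List Side) : List ℕ := code d.1 (posn d.1 d.2.1) d.2.2

lemma fullCode_rev {A : List Side} : ∀ {k : ℕ} {a : Side} {B B' : List Side}, WOk k (a :: A) →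
    (fullCode (rev k B (a :: A)) < fullCode (rev k B' (a :: A)) ↔
      code k (posn k a) B < code k (posn k a) B') := by
  induction A with
  | nil => intro k a B B' _; rfl
  | cons a' A ih =>
    intro k a B B' h
    simp only [rev]
    rw [ih h.2.2, code_cons_lt_self, opp_opp h.1]

lemma exists_divergence {B : List Side} : ∀ {B' : List Side} {k : ℕ} {a : Side} {A : List Side},
    WOk k B → WOk k B' → WOk k (a :: A) → code k (posn k a) B < code k (posn k a) B' →
    ∃ k' a' A' b C b' C', WOk k' (a' :: A') ∧ rev k B (a :: A) = rev k' (b :: C) (a' :: A') ∧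
      rev k B' (a :: A) = rev k' (b' :: C') (a' :: A') ∧ 
      rel (posn k' a') (posn k' b) < rel (posn k' a') (posn k' b') := by
  induction B with
  | nil => intro B' k a A h; exact absurd rfl h.ne_nil
  | cons b B ih =>
    intro B' k a A h h' hA hlt
    rcases B' with _ | ⟨b', B'⟩
    · exact absurd rfl h'.ne_nil
    by_cases hb : b = b'
    · subst hb
      rw [code_cons_lt_self] at hlt
      rcases B with _ | ⟨r, B⟩ <;> rcases B' with _ | ⟨r', B'⟩
      · exact absurd hlt (lt_irrefl _)
      · exact absurd h.2 h'.2.1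
      · exact absurd h'.2 h.2.1
      · obtain ⟨k', a', A', c, C, c', C', h0, h1, h2, h3⟩ := ih (A := a :: A) h.2.2 h'.2.2
          ⟨adj_opp h.1, h.2.1, by rwa [opp_opp h.1]⟩ hlt
        refine ⟨k', a', A', c, C, c', C', h0, ?_, ?_, h3⟩
        · rw [← h1]; simp only [rev]; rw [opp_opp h.1]
        · rw [← h2]; simp only [rev]; rw [opp_opp h.1]
    · refine ⟨k, a, A, b, B, b', B', hA, rfl, rfl, ?_⟩
      simp only [code, List.cons_lt_cons_iff] at hlt
      refine hlt.resolve_right fun h2 => hb (posn_inj h.adj h'.adj ?_)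
      exact rel_inj (posn_lt _ _) (posn_lt _ _) (posn_lt _ _) h2.1

end SlabPath

namespace SlabPath

lemma ind_code_heads {k c : ℕ} {a b : Side} {A B : List Side}
    (h : rel c (posn k a) ≠ rel c (posn k b)) :
    ind (code k c (a :: A) < code k c (b :: B)) = ind (rel c (posn k a) < rel c (posn k b)) := by
  apply ind_congr
  simp only [code, List.cons_lt_cons_iff]
  simp [h]

lemma ind_true {p : Prop} [Decidable p] (h : p) : ind p = 1 := by simp [ind, h]
lemma ind_false {p : Prop} [Decidable p] (h : ¬ p) : ind p = 0 := by simp [ind, h]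

/-- The four ways in which a path and its successor can turn, seen from a cut of the
boundary of a slab. -/
def Turn (j : Fin 4) (E X Y : ℕ) : Prop :=
  match j with
  | 0 => E ≤ 2 ∧ X = 3 ∧ 4 ≤ Y
  | 1 => E ≤ 2 ∧ X = 4 ∧ Y = 5
  | 2 => E = 2 ∧ 3 ≤ X ∧ Y = 0
  | 3 => E = 0 ∧ X = 2 ∧ 3 ≤ Y

lemma Turn.mix {j : Fin 4} {E X Y E' X' Y' : ℕ} (h : Turn j E X Y) (h' : Turn j E' X' Y') :
    Turn j E X Y' := by
  fin_cases j <;> simp only [Turn] at * <;> omega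

lemma Turn.rel_lt {j : Fin 4} {c p q r : ℕ} (hc : c < 6) (hp : p < 6) (hq : q < 6)
    (hr : r < 6) (h : Turn j (rel c p) (rel c q) (rel c r)) : rel p q < rel p r := by
  fin_cases j <;> simp only [Turn, rel] at * <;> omega

namespace WordSys

variable {E : Type} {n : ℕ} (S : WordSys E n)

/-- Two paths that cross an odd number of times near a common slab. -/
def Linked (e e' : E) : Prop :=
  ∃ k c A B A' B', c < 6 ∧ S.LW e k A B ∧ S.LW e' k A' B' ∧
    A ≠ A' ∧ A ≠ B' ∧ B ≠ A' ∧ B ≠ B' ∧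
    ind (code k c A < code k c A') + ind (code k c A < code k c B') +
      ind (code k c B < code k c A') + ind (code k c B < code k c B') = 1

variable {S}

lemma linked_of_turn {e e' : E} {κ c : ℕ} {a a' b b' : Side} {A A' B B' : List Side} {j : Fin 4}
    (hc : c < 6) (h : S.LW e κ (a :: A) (b :: B)) (h' : S.LW e' κ (a' :: A') (b' :: B'))
    {x y : ℕ}
    (t : Turn j (rel c (posn κ a)) (rel c (posn κ b)) y)
    (t' : Turn j (rel c (posn κ a')) x (rel c (posn κ b')))
    (hlt : code κ c (a :: A) < code κ c (a' :: A')) : S.Linked e e' := by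
  have ne : ∀ {p q : Side}, rel c (posn κ p) ≠ rel c (posn κ q) → p ≠ q := fun h e => h (by rw [e])
  have cne : ∀ {p q : Side} {P Q : List Side}, p ≠ q → p :: P ≠ q :: Q := fun h e =>
    h (List.cons.inj e).1
  have h1 : rel c (posn κ a) ≠ rel c (posn κ b') := by
    fin_cases j <;> simp only [Turn] at * <;> omega
  have h2 : rel c (posn κ b) ≠ rel c (posn κ a') := by
    fin_cases j <;> simp only [Turn] at * <;> omega
  have h3 : rel c (posn κ b) ≠ rel c (posn κ b') := by
    fin_cases j <;> simp only [Turn] at * <;> omega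
  refine ⟨κ, c, _, _, _, _, hc, h, h', fun e => by rw [e] at hlt; exact lt_irrefl _ hlt,
    cne (ne h1), cne (ne h2), cne (ne h3), ?_⟩
  rw [ind_true hlt, ind_code_heads h1, ind_code_heads h2, ind_code_heads h3]
  fin_cases j <;> simp only [Turn] at *
  · rw [ind_true (by omega), ind_false (by omega), ind_true (by omega)]; rfl
  · rw [ind_true (by omega), ind_false (by omega), ind_true (by omega)]; rfl
  · rw [ind_false (by omega), ind_false (by omega), ind_false (by omega)]; rfl
  · rw [ind_true (by omega), ind_false (by omega), ind_true (by omega)]; rfl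

lemma linked_of_heads {e e' : E} {κ c : ℕ} {a a' b b' : Side} {A A' B B' : List Side}
    (hc : c < 6) (h : S.LW e κ (a :: A) (b :: B)) (h' : S.LW e' κ (a' :: A') (b' :: B'))
    (h1 : rel c (posn κ a) = 0) (h2 : rel c (posn κ b) = 2)
    (h3 : rel c (posn κ a') = 1) (h4 : 3 ≤ rel c (posn κ b')) : S.Linked e e' := by
  have ne : ∀ {p q : Side} {P Q : List Side}, rel c (posn κ p) ≠ rel c (posn κ q) →
    p :: P ≠ q :: Q := fun h e => h (by rw [(List.cons.inj e).1])
  have e1 : rel c (posn κ a) ≠ rel c (posn κ a') := by omega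
  have e2 : rel c (posn κ a) ≠ rel c (posn κ b') := by omega
  have e3 : rel c (posn κ b) ≠ rel c (posn κ a') := by omega
  have e4 : rel c (posn κ b) ≠ rel c (posn κ b') := by omega
  refine ⟨κ, c, _, _, _, _, hc, h, h', ne e1, ne e2, ne e3, ne e4, ?_⟩
  rw [ind_code_heads e1, ind_code_heads e2, ind_code_heads e3, ind_code_heads e4,
    ind_true (by omega), ind_true (by omega), ind_false (by omega), ind_true (by omega)]; rfl

variable (S)

/-- `y` is the half edge following `x` around a vertex, within a slab. -/
structure Succ (x y : E × Bool) : Prop where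
  key : S.key x = S.key y
  lt : fullCode (S.data x) < fullCode (S.data y)
  le : ∀ z, S.key x = S.key z → fullCode (S.data x) < fullCode (S.data z) →
    fullCode (S.data y) ≤ fullCode (S.data z)

lemma eq_of_key {x y : E × Bool} (h : S.key x = S.key y)
    (h' : fullCode (S.data x) = fullCode (S.data y)) : x = y := by
  apply S.data_inj
  have hx := S.data_ok x
  have hy := S.data_ok y
  rcases hdx : S.data x with ⟨k, v, w⟩
  rcases hdy : S.data y with ⟨k', v', w'⟩
  simp only [key, hdx, hdy, Prod.mk.injEq, fullCode] at h h' hx hy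
  obtain ⟨h1, rfl⟩ := h
  have hv : v = v' := Prod.ext h1 ((S.ok (S.symm hx)).2.trans (S.ok (S.symm hy)).2.symm)
  subst hv
  rw [code_inj (posn_lt _ _) (S.ok hx) (S.ok hy) h']

lemma Succ.left_unique {x x' y : E × Bool} (h : S.Succ x y) (h' : S.Succ x' y) : x = x' := by
  have hk := h.key.trans h'.key.symm
  rcases lt_trichotomy (fullCode (S.data x)) (fullCode (S.data x')) with c | c | c
  · exact absurd (h.le _ hk c) (not_le.2 h'.lt)
  · exact S.eq_of_key hk c
  · exact absurd (h'.le _ hk.symm c) (not_le.2 h.lt)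

lemma exists_succ [Finite E] {x z : E × Bool} (hk : S.key x = S.key z)
    (hlt : fullCode (S.data x) < fullCode (S.data z)) : ∃ y, S.Succ x y := by
  obtain ⟨y, ⟨h1, h2⟩, h3⟩ := Set.exists_min_image
    {z | S.key x = S.key z ∧ fullCode (S.data x) < fullCode (S.data z)}
    (fun z => fullCode (S.data z)) (Set.toFinite _) ⟨z, hk, hlt⟩
  exact ⟨y, h1, h2, fun z h4 h5 => h3 z ⟨h4, h5⟩⟩

/-- `x` and its successor diverge in the slab `κ` in the way described by `j`. -/
structure Div (j : Fin 4) (κ c : ℕ) (x y : E × Bool) (a : Side) (A : List Side) (b : Side)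
    (C : List Side) (b' : Side) (C' : List Side) : Prop where
  succ : S.Succ x y
  ok : WOk κ (a :: A)
  hx : S.data x = rev κ (b :: C) (a :: A)
  hy : S.data y = rev κ (b' :: C') (a :: A)
  turn : Turn j (rel c (posn κ a)) (rel c (posn κ b)) (rel c (posn κ b'))

def InCls (j : Fin 4) (κ c : ℕ) (x : E × Bool) : Prop :=
  ∃ y a A b C b' C', S.Div j κ c x y a A b C b' C'

variable {S}

lemma Div.LWx {j : Fin 4} {κ c : ℕ} {x y : E × Bool} {a : Side} {A : List Side} {b : Side}
    {C : List Side} {b' : Side} {C' : List Side} (h : S.Div j κ c x y a A b C b' C') :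
    S.LW x.1 κ (a :: A) (b :: C) := by
  have := S.data_ok x
  rw [h.hx] at this
  exact S.of_rev h.ok (by simp) this

lemma Div.LWy {j : Fin 4} {κ c : ℕ} {x y : E × Bool} {a : Side} {A : List Side} {b : Side}
    {C : List Side} {b' : Side} {C' : List Side} (h : S.Div j κ c x y a A b C b' C') :
    S.LW y.1 κ (a :: A) (b' :: C') := by
  have := S.data_ok y
  rw [h.hy] at this
  exact S.of_rev h.ok (by simp) this

lemma rev_key {A : List Side} : ∀ {κ : ℕ} {B B' : List Side}, A ≠ [] →
    (rev κ B A).1 = (rev κ B' A).1 ∧ (rev κ B A).2.1 = (rev κ B' A).2.1 := by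
  induction A with
  | nil => intro κ B B' h; exact absurd rfl h
  | cons a A ih =>
    intro κ B B' _
    by_cases h : A = []
    · subst h; exact ⟨rfl, rfl⟩
    · rw [rev_cons h, rev_cons h]; exact ih h

lemma Div.past_ne {j : Fin 4} {κ c : ℕ} {x y x' y' : E × Bool} {a : Side} {A : List Side}
    {b : Side} {C : List Side} {b' : Side} {C' : List Side} {a₁ : Side} {A₁ : List Side}
    {b₁ : Side} {C₁ : List Side} {b₁' : Side} {C₁' : List Side} (hc : c < 6)
    (h : S.Div j κ c x y a A b C b' C') (h' : S.Div j κ c x' y' a₁ A₁ b₁ C₁ b₁' C₁')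
    (hne : x ≠ x') : code κ c (a :: A) ≠ code κ c (a₁ :: A₁) := by
  intro hcode
  have := code_inj hc h.ok h'.ok hcode
  simp only [List.cons.injEq] at this
  obtain ⟨rfl, rfl⟩ := this
  have key : S.key x = S.key x' := by
    simp only [WordSys.key, h.hx, h'.hx]
    have := rev_key (κ := κ) (B := b :: C) (B' := b₁ :: C₁) (A := a :: A) (by simp)
    rw [this.1, this.2]
  have cmp : ∀ {p q : Side} {P Q : List Side},
      rel (posn κ a) (posn κ p) < rel (posn κ a) (posn κ q) →
      fullCode (rev κ (p :: P) (a :: A)) < fullCode (rev κ (q :: Q) (a :: A)) := by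
    intro p q P Q hpq
    rw [fullCode_rev h.ok]
    simp only [code, List.cons_lt_cons_iff]
    exact Or.inl hpq
  have l1 : fullCode (S.data x) < fullCode (S.data y') := by
    rw [h.hx, h'.hy]
    exact cmp ((h.turn.mix h'.turn).rel_lt hc (posn_lt _ _) (posn_lt _ _) (posn_lt _ _))
  have l2 : fullCode (S.data x') < fullCode (S.data y) := by
    rw [h'.hx, h.hy]
    exact cmp ((h'.turn.mix h.turn).rel_lt hc (posn_lt _ _) (posn_lt _ _) (posn_lt _ _))
  rcases lt_trichotomy (fullCode (S.data x)) (fullCode (S.data x')) with g | g | g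
  · exact absurd (h.succ.le _ key g) (not_le.2 l2)
  · exact hne (S.eq_of_key key g)
  · exact absurd (h'.succ.le _ key.symm g) (not_le.2 l1)

open Classical in
lemma card_edge_le (e : E) [Fintype E] :
    (Finset.univ.filter fun x : E × Bool => x.1 = e).card ≤ 2 := by
  calc _ ≤ ({(e, true), (e, false)} : Finset (E × Bool)).card := by
        apply Finset.card_le_card
        rintro ⟨a, b⟩ h
        simp at h
        subst h
        cases b <;> simp
    _ ≤ 2 := Finset.card_le_two

section
variable [Fintype E] {κ c : ℕ} {j : Fin 4}

open Classical in
lemma card_cls_le_one (hs : ∀ e e', ¬ S.Linked e e') (hc : c < 6) :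
    (Finset.univ.filter (S.InCls j κ c)).card ≤ 1 := by
  rw [Finset.card_le_one]
  intro x hx x' hx'
  simp only [Finset.mem_filter, Finset.mem_univ, true_and] at hx hx'
  obtain ⟨y, a, A, b, C, b', C', h⟩ := hx
  obtain ⟨y₁, a₁, A₁, b₁, C₁, b₁', C₁', h₁⟩ := hx'
  by_contra hne
  rcases lt_or_gt_of_ne (h.past_ne hc h₁ hne) with g | g
  · exact hs _ _ (linked_of_turn hc h.LWx h₁.LWy h.turn h₁.turn g)
  · exact hs _ _ (linked_of_turn hc h₁.LWx h.LWy h₁.turn h.turn g)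

open Classical in
lemma card_succ_le (F : Finset (E × Bool)) (e : E)
    (h : ∀ x ∈ F, ∃ y, S.Succ x y ∧ y.1 = e) : F.card ≤ 2 := by
  choose! f hf using h
  refine le_trans (Finset.card_le_card_of_injOn f (fun x hx => ?_) ?_) (card_edge_le e)
  · simpa using (hf x hx).2
  · intro x hx x' hx' hxx
    have h1 := (hf x hx).1
    have h2 := (hf x' hx').1
    rw [← hxx] at h2
    exact Succ.left_unique S h1 h2

open Classical in
lemma card_cls_le_three (hs : ∀ e e', S.Linked e e' → e = e') (hc : c < 6) :
    (Finset.univ.filter (S.InCls j κ c)).card ≤ 3 := by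
  set F := Finset.univ.filter (S.InCls j κ c) with hF
  rcases F.eq_empty_or_nonempty with h0 | h0
  · simp [h0]
  have hmem : ∀ x ∈ F, S.InCls j κ c x := fun x hx => by simpa [hF] using hx
  choose! y a A b C b' C' h using hmem
  obtain ⟨x₀, hx₀, hmin⟩ := F.exists_min_image (fun x => code κ c (a x :: A x)) h0
  have := card_succ_le (S := S) (F.erase x₀) x₀.1 (fun x hx => by
    have hx' := Finset.mem_of_mem_erase hx
    have hne := Finset.ne_of_mem_erase hx
    refine ⟨y x, (h x hx').succ, ?_⟩
    have g := lt_of_le_of_ne (hmin x hx') ((h x₀ hx₀).past_ne hc (h x hx') hne.symm)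
    exact (hs _ _ (linked_of_turn hc (h x₀ hx₀).LWx (h x hx').LWy (h x₀ hx₀).turn
      (h x hx').turn g)).symm)
  rw [Finset.card_erase_of_mem hx₀] at this
  omega

end

end WordSys

end SlabPath

namespace SlabPath

lemma posn_lt_three {k : ℕ} {r : Side} (h : Adj k r.1) : posn k r < 3 ↔ r.1 + 1 = k := by
  rcases r with ⟨i, s⟩
  simp only [Adj] at h
  unfold posn
  cases s <;> split_ifs with g <;> simp at g ⊢ <;> omega

lemma posn_zero {k : ℕ} {r : Side} (h : r.2 = 0) : posn k r = if r.1 = k then 4 else 1 := by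
  rcases r with ⟨i, s⟩
  simp only at h
  subst h
  rfl

lemma zero_of_posn {k : ℕ} {r : Side} (h : posn k r = 4 ∨ posn k r = 1) : r.2 = 0 := by
  rcases r with ⟨i, s⟩
  unfold posn at h
  cases s
  · rfl
  all_goals split_ifs at h <;> simp at h

lemma TightRel.posn {k : ℕ} {a b : Side} (ha : Adj k a.1) (hb : Adj k b.1) (h : TightRel a b) :
    (posn k a < 3 → posn k b < 3 → posn k a + posn k b = 2 ∧ posn k a ≠ 1) ∧
    (3 ≤ posn k a → 3 ≤ posn k b → posn k a + posn k b = 8 ∧ posn k a ≠ 4) := by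
  rcases a with ⟨i, s⟩
  rcases b with ⟨j, t⟩
  simp only [TightRel, Adj] at *
  have key : i = j → (s = 1 ∧ t = -1) ∨ (s = -1 ∧ t = 1) := by
    intro e; have := h e; revert this; cases s <;> cases t <;> decide
  unfold SlabPath.posn
  by_cases e : i = j
  · subst e
    rcases key rfl with ⟨rfl, rfl⟩ | ⟨rfl, rfl⟩
    · change (_ < 3 → (if i = k then 5 else 0) < 3 → _) ∧ _
      by_cases g : i = k <;> simp [g]
    · by_cases g : i = k <;> simp [g]
  · by_cases g : i = k <;> by_cases g' : j = k <;> simp only [g, g', if_true, if_false] <;>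
      cases s <;> cases t <;> simp <;> omega

namespace WordSys

variable {E : Type} {n : ℕ} {S : WordSys E n}

lemma eq_of_forall_not_succ [Finite E] {x x' : E × Bool} (h : ∀ y, ¬ S.Succ x y)
    (h' : ∀ y, ¬ S.Succ x' y) (hk : S.key x = S.key x') : x = x' := by
  rcases lt_trichotomy (fullCode (S.data x)) (fullCode (S.data x')) with c | c | c
  · obtain ⟨y, hy⟩ := S.exists_succ hk c
    exact absurd hy (h y)
  · exact S.eq_of_key hk c
  · obtain ⟨y, hy⟩ := S.exists_succ hk.symm c
    exact absurd hy (h' y)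

lemma Succ.exists_div {x y : E × Bool} (h : S.Succ x y) :
    ∃ j κ c, (c = 0 ∨ c = 3) ∧ ∃ a A b C b' C', S.Div j κ c x y a A b C b' C' := by
  have hx := S.data_ok x
  have hy := S.data_ok y
  have hk := h.key
  have hlt := h.lt
  rcases hdx : S.data x with ⟨k, v, w⟩
  rcases hdy : S.data y with ⟨k', v', w'⟩
  simp only [WordSys.key, hdx, hdy, Prod.mk.injEq, fullCode] at hk hlt hx hy
  obtain ⟨h1, rfl⟩ := hk
  have hv : v = v' := Prod.ext h1 ((S.ok (S.symm hx)).2.trans (S.ok (S.symm hy)).2.symm)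
  subst hv
  obtain ⟨κ, a, A, b, C, b', C', h0, e1, e2, h3⟩ :=
    exists_divergence (A := []) (S.ok hx) (S.ok hy) (S.ok (S.symm hx)) hlt
  have e1' : S.data x = rev κ (b :: C) (a :: A) := by rw [hdx, ← e1]; rfl
  have e2' : S.data y = rev κ (b' :: C') (a :: A) := by rw [hdy, ← e2]; rfl
  have l1 : S.LW x.1 κ (a :: A) (b :: C) := by
    have := S.data_ok x
    rw [e1'] at this
    exact S.of_rev h0 (by simp) this
  have l2 : S.LW y.1 κ (a :: A) (b' :: C') := by
    have := S.data_ok y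
    rw [e2'] at this
    exact S.of_rev h0 (by simp) this
  have t1 := (S.tight l1).posn h0.adj (S.ok l1).adj
  have t2 := (S.tight l2).posn h0.adj (S.ok l2).adj
  have p := posn_lt κ a
  have q := posn_lt κ b
  have r := posn_lt κ b'
  have : ∃ j c, (c = 0 ∨ c = 3) ∧
      Turn j (rel c (posn κ a)) (rel c (posn κ b)) (rel c (posn κ b')) := by
    generalize posn κ a = α at *
    generalize posn κ b = β at *
    generalize posn κ b' = γ at *
    by_cases hα : α < 3
    · by_cases c1 : β = 2
      · exact ⟨3, 0, Or.inl rfl, by simp only [Turn, rel] at *; omega⟩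
      · by_cases c2 : γ = 0
        · exact ⟨2, 0, Or.inl rfl, by simp only [Turn, rel] at *; omega⟩
        · by_cases c3 : β = 3
          · exact ⟨0, 0, Or.inl rfl, by simp only [Turn, rel] at *; omega⟩
          · exact ⟨1, 0, Or.inl rfl, by simp only [Turn, rel] at *; omega⟩
    · by_cases c1 : β = 5
      · exact ⟨3, 3, Or.inr rfl, by simp only [Turn, rel] at *; omega⟩
      · by_cases c2 : γ = 3
        · exact ⟨2, 3, Or.inr rfl, by simp only [Turn, rel] at *; omega⟩
        · by_cases c3 : β = 0
          · exact ⟨0, 3, Or.inr rfl, by simp only [Turn, rel] at *; omega⟩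
          · exact ⟨1, 3, Or.inr rfl, by simp only [Turn, rel] at *; omega⟩
  obtain ⟨j, c, hc, ht⟩ := this
  exact ⟨j, κ, c, hc, a, A, b, C, b', C', h, h0, e1', e2', ht⟩

def kap {n : ℕ} (q : Fin n × Bool) : ℕ := if q.2 then q.1 else q.1 + 1
def near {n : ℕ} (q : Fin n × Bool) : ℕ := if q.2 then 3 else 0
def far {n : ℕ} (q : Fin n × Bool) : ℕ := if q.2 then 0 else 3
def cut {n : ℕ} (q : Fin n × Bool) (j : Fin 4) : ℕ := if j ≤ 1 then far q else near q

lemma cut_lt (q : Fin n × Bool) (j : Fin 4) : cut q j < 6 := by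
  unfold cut far near; split_ifs <;> norm_num

lemma Div.exists_cut {j : Fin 4} {κ c : ℕ} {x y : E × Bool} {a : Side} {A : List Side}
    {b : Side} {C : List Side} {b' : Side} {C' : List Side} (hc : c = 0 ∨ c = 3)
    (h : S.Div j κ c x y a A b C b' C') : ∃ q : Fin n × Bool, kap q = κ ∧ cut q j = c := by
  have ha := h.ok.adj
  have hb := (S.ok h.LWx).adj
  have la : a.1 < n := S.lt (S.symm h.LWx) a (by simp)
  have lb : b.1 < n := S.lt h.LWx b (by simp)
  have pa := posn_lt_three ha
  have pb := posn_lt_three hb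
  have qa := posn_lt κ a
  have qb := posn_lt κ b
  have ht := h.turn
  unfold Adj at ha hb
  by_cases hj : j ≤ 1
  · refine ⟨(⟨b.1, lb⟩, c = 0), ?_, ?_⟩
    · simp only [kap, decide_eq_true_eq]
      rcases hc with rfl | rfl <;> fin_cases j <;> simp [Turn, rel] at * <;> omega
    · rcases hc with rfl | rfl <;> simp [cut, hj, far]
  · refine ⟨(⟨a.1, la⟩, c = 3), ?_, ?_⟩
    · simp only [kap, decide_eq_true_eq]
      rcases hc with rfl | rfl <;> fin_cases j <;> simp [Turn, rel] at * <;> omega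
    · rcases hc with rfl | rfl <;> simp [cut, hj, near]

lemma exists_key_of_inCls_one {q : Fin n × Bool} {x : E × Bool}
    (h : S.InCls 1 (kap q) (cut q 1) x) : ∃ z, S.key z = ((q.1 : ℕ), kap q) := by
  obtain ⟨y, a, A, b, C, b', C', h⟩ := h
  have hb := S.ok h.LWx
  have ht := h.turn
  have hb4 : posn (kap q) b = if q.2 then 4 else 1 := by
    have := posn_lt (kap q) b
    rcases q with ⟨i, _ | _⟩ <;> simp [Turn, cut, far, rel] at * <;> omega
  have hb0 : b.2 = 0 := zero_of_posn (k := kap q) (by rw [hb4]; split_ifs <;> simp)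
  have hC : C = [] := by
    rcases C with _ | ⟨r, C⟩
    · rfl
    · exact absurd hb0 hb.2.1
  subst hC
  have h1 : S.data (x.1, !x.2) = (kap q, b, a :: A) := by
    rw [S.data_not, h.hx, rev_rev h.ok (by simp)]; rfl
  refine ⟨(x.1, !x.2), ?_⟩
  simp only [WordSys.key, h1, Prod.mk.injEq, and_true]
  have h3 := posn_lt_three hb.adj
  have h4 := hb.adj
  unfold Adj at h4
  rcases q with ⟨i, _ | _⟩ <;> simp [kap] at * <;> omega

lemma exists_heads_of_key {q : Fin n × Bool} {z : E × Bool} (h : S.key z = ((q.1 : ℕ), kap q)) :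
    ∃ v b B, S.LW z.1 (kap q) [v] (b :: B) ∧ rel (near q) (posn (kap q) v) = 1 ∧
      3 ≤ rel (near q) (posn (kap q) b) := by
  have hz := S.data_ok z
  rcases hd : S.data z with ⟨k, v, w⟩
  simp only [WordSys.key, hd, Prod.mk.injEq] at h hz
  obtain ⟨h1, rfl⟩ := h
  have hw := (S.ok hz).ne_nil
  rcases w with _ | ⟨b, B⟩
  · exact absurd rfl hw
  have hv := S.ok (S.symm hz)
  have t := (S.tight hz).posn hv.adj (S.ok hz).adj
  have h0 := posn_zero (k := kap q) hv.2
  rw [h1] at h0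
  refine ⟨v, b, B, hz, ?_, ?_⟩
  · rcases q with ⟨i, _ | _⟩ <;> simp [kap, near, rel] at * <;> omega
  · have := posn_lt (kap q) b
    rcases q with ⟨i, _ | _⟩ <;> simp [kap, near, rel] at * <;> omega

section
variable [Fintype E]

open Classical in
lemma two_mul_card_le (α : ℕ)
    (h : ∀ q : Fin n × Bool,
      (if ∃ z, S.key z = ((q.1 : ℕ), kap q) then 1 else 0) +
        ∑ j : Fin 4, (Finset.univ.filter (S.InCls j (kap q) (cut q j))).card ≤ α) :
    Fintype.card E ≤ α * n := by
  set M : Finset (E × Bool) := Finset.univ.filter fun x => ∀ y, ¬ S.Succ x y with hM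
  have hkey : ∀ x : E × Bool, ∃ q : Fin n × Bool, S.key x = ((q.1 : ℕ), kap q) := by
    intro x
    have hx := S.data_ok x
    have l := S.lt (S.symm hx) _ (List.mem_singleton_self _)
    have ad := (S.ok (S.symm hx)).adj
    refine ⟨(⟨_, l⟩, (S.data x).2.1.1 = (S.data x).1), ?_⟩
    unfold Adj at ad
    simp only [WordSys.key, kap, decide_eq_true_eq, Prod.mk.injEq, true_and]
    split_ifs with g
    · exact g.symm
    · omega
  have cover : (Finset.univ : Finset (E × Bool)) ⊆
      Finset.univ.biUnion fun q : Fin n × Bool =>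
        (M.filter fun x => S.key x = ((q.1 : ℕ), kap q)) ∪
        Finset.univ.biUnion fun j : Fin 4 =>
          Finset.univ.filter (S.InCls j (kap q) (cut q j)) := by
    intro x _
    simp only [Finset.mem_biUnion, Finset.mem_union, Finset.mem_filter, Finset.mem_univ, true_and,
      hM]
    by_cases hx : ∀ y, ¬ S.Succ x y
    · obtain ⟨q, hq⟩ := hkey x
      exact ⟨q, Or.inl ⟨hx, hq⟩⟩
    · push Not at hx
      obtain ⟨y, hy⟩ := hx
      obtain ⟨j, κ, c, hc, a, A, b, C, b', C', hd⟩ := hy.exists_div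
      obtain ⟨q, rfl, rfl⟩ := hd.exists_cut hc
      exact ⟨q, Or.inr ⟨j, y, a, A, b, C, b', C', hd⟩⟩
  have h2 := (Finset.card_le_card cover).trans Finset.card_biUnion_le
  have h3 : ∀ q : Fin n × Bool, ((M.filter fun x => S.key x = ((q.1 : ℕ), kap q)) ∪
        Finset.univ.biUnion fun j : Fin 4 =>
          Finset.univ.filter (S.InCls j (kap q) (cut q j))).card ≤ α := by
    intro q
    refine le_trans ((Finset.card_union_le _ _).trans ?_) (h q)
    refine add_le_add ?_ Finset.card_biUnion_le
    split_ifs with g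
    · rw [Finset.card_le_one]
      intro x hx x' hx'
      simp only [hM, Finset.mem_filter, Finset.mem_univ, true_and] at hx hx'
      exact eq_of_forall_not_succ hx.1 hx'.1 (hx.2.trans hx'.2.symm)
    · rw [Nat.le_zero, Finset.card_eq_zero, Finset.filter_eq_empty_iff]
      exact fun x _ hx => g ⟨x, hx⟩
  have h4 := h2.trans (Finset.sum_le_sum fun q _ => h3 q)
  simp only [Finset.sum_const, Finset.card_univ, Fintype.card_prod, Fintype.card_bool,
    Fintype.card_fin, smul_eq_mul] at h4
  have : n * 2 * α = α * n * 2 := by ring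
  omega

open Classical in
theorem card_le_three_mul (hs : ∀ e e', ¬ S.Linked e e') : Fintype.card E ≤ 3 * n := by
  refine two_mul_card_le (S := S) 3 fun q => ?_
  have c := fun j => card_cls_le_one (j := j) (κ := kap q) hs (cut_lt q j)
  rw [Fin.sum_univ_four]
  have c0 := c 0
  have c1 := c 1
  have c2 := c 2
  have c3 := c 3
  split_ifs with g
  · obtain ⟨z, hz⟩ := g
    obtain ⟨v, b, B, hz, hv, hb⟩ := exists_heads_of_key hz
    have e2 : (Finset.univ.filter (S.InCls 2 (kap q) (cut q 2))).card = 0 := by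
      rw [Finset.card_eq_zero, Finset.filter_eq_empty_iff]
      rintro x - ⟨y, a, A, b₁, C, b', C', h⟩
      exact hs _ _ (linked_of_heads (cut_lt q 2) (S.symm h.LWy) hz h.turn.2.2 h.turn.1 hv hb)
    have e3 : (Finset.univ.filter (S.InCls 3 (kap q) (cut q 3))).card = 0 := by
      rw [Finset.card_eq_zero, Finset.filter_eq_empty_iff]
      rintro x - ⟨y, a, A, b₁, C, b', C', h⟩
      exact hs _ _ (linked_of_heads (cut_lt q 3) h.LWx hz h.turn.1 h.turn.2.1 hv hb)
    omega
  · have e1 : (Finset.univ.filter (S.InCls 1 (kap q) (cut q 1))).card = 0 := by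
      rw [Finset.card_eq_zero, Finset.filter_eq_empty_iff]
      exact fun x _ hx => g (exists_key_of_inCls_one hx)
    omega

open Classical in
theorem card_le_eleven_mul (hs : ∀ e e', S.Linked e e' → e = e') : Fintype.card E ≤ 11 * n := by
  refine two_mul_card_le (S := S) 11 fun q => ?_
  have c := fun j => card_cls_le_three (j := j) (κ := kap q) hs (cut_lt q j)
  rw [Fin.sum_univ_four]
  have c0 := c 0
  have c1 := c 1
  have c2 := c 2
  have c3 := c 3
  split_ifs with g
  · obtain ⟨z, hz⟩ := g
    obtain ⟨v, b, B, hz, hv, hb⟩ := exists_heads_of_key hz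
    have e2 : (Finset.univ.filter (S.InCls 2 (kap q) (cut q 2))).card ≤ 2 := by
      refine card_succ_le (S := S) _ z.1 fun x hx => ?_
      simp only [Finset.mem_filter, Finset.mem_univ, true_and] at hx
      obtain ⟨y, a, A, b₁, C, b', C', h⟩ := hx
      exact ⟨y, h.succ, hs _ _ (linked_of_heads (cut_lt q 2) (S.symm h.LWy) hz h.turn.2.2
        h.turn.1 hv hb)⟩
    have e3 : (Finset.univ.filter (S.InCls 3 (kap q) (cut q 3))).card ≤ 2 := by
      refine le_trans (Finset.card_le_card fun x hx => ?_) (card_edge_le z.1)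
      simp only [Finset.mem_filter, Finset.mem_univ, true_and] at hx ⊢
      obtain ⟨y, a, A, b₁, C, b', C', h⟩ := hx
      exact hs _ _ (linked_of_heads (cut_lt q 3) h.LWx hz h.turn.1 h.turn.2.1 hv hb)
    omega
  · have e1 : (Finset.univ.filter (S.InCls 1 (kap q) (cut q 1))).card = 0 := by
      rw [Finset.card_eq_zero, Finset.filter_eq_empty_iff]
      exact fun x _ hx => g (exists_key_of_inCls_one hx)
    omega

end

end WordSys

end SlabPath

namespace SlabPath

open Set

/-- The curves `f` and `g`, restricted to `[0,1]`, are homotopic relative to their endpoints, with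
interiors avoiding `V` at all times of `U`. -/
def Hom (U : Set ℝ) (V : Set ℂ) (f g : ℝ → ℂ) : Prop :=
  ∃ H : ℝ × ℝ → ℂ, Continuous H ∧ (∀ t, H (0, t) = f t) ∧ (∀ t, H (1, t) = g t) ∧
    (∀ s ∈ Icc (0:ℝ) 1, H (s, 0) = f 0 ∧ H (s, 1) = f 1) ∧
    ∀ s ∈ U, ∀ t ∈ Ioo (0:ℝ) 1, H (s, t) ∉ V

abbrev SHom := Hom (Icc (0:ℝ) 1)

variable {U : Set ℝ} {V : Set ℂ} {f g h : ℝ → ℂ}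

lemma Hom.left (H : Hom U V f g) : f 0 = g 0 ∧ f 1 = g 1 := by
  obtain ⟨H, _, h0, h1, he, _⟩ := H
  have := he 1 (by simp)
  rw [h1, h1] at this
  exact ⟨this.1.symm, this.2.symm⟩

lemma SHom.trans (hU : ∀ s ∈ U, 1/2 < s → 2 * s - 1 ∈ U) (hU' : U ⊆ Icc 0 1)
    (h1 : SHom V f g) (h2 : Hom U V g h) : Hom U V f h := by
  have e := h1.left
  obtain ⟨H, hc, h0, h1, he, hV⟩ := h1
  obtain ⟨H', hc', h0', h1', he', hV'⟩ := h2
  refine ⟨fun p => if p.1 ≤ 1/2 then H (2 * p.1, p.2) else H' (2 * p.1 - 1, p.2), ?_, ?_, ?_, ?_, ?_⟩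
  · refine Continuous.if_le (by fun_prop) (by fun_prop) (by fun_prop) (by fun_prop) ?_
    rintro ⟨s, t⟩ hs
    simp only at hs
    subst hs
    norm_num [h1, h0']
  · intro t; simp [h0]
  · intro t; norm_num [h1']
  · intro s hs
    simp only
    split_ifs with c
    · exact he _ ⟨by linarith [hs.1], by linarith⟩
    · rw [e.1, e.2]
      exact he' _ ⟨by linarith, by linarith [hs.2]⟩
  · intro s hs t ht
    simp only
    split_ifs with c
    · exact hV _ ⟨by linarith [(hU' hs).1], by linarith⟩ t ht
    · exact hV' _ (hU s hs (by linarith)) t ht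

lemma SHom.trans' (h1 : SHom V f g) (h2 : SHom V g h) : SHom V f h :=
  SHom.trans (fun s hs h => ⟨by linarith, by linarith [hs.2]⟩) subset_rfl h1 h2

lemma SHom.symm (h1 : SHom V f g) : SHom V g f := by
  have e := h1.left
  obtain ⟨H, hc, h0, h1, he, hV⟩ := h1
  refine ⟨fun p => H (1 - p.1, p.2), by fun_prop, by simp [h1], by simp [h0], ?_, ?_⟩
  · intro s hs
    rw [← e.1, ← e.2]
    exact he _ ⟨by linarith [hs.2], by linarith [hs.1]⟩
  · intro s hs t ht
    exact hV _ ⟨by linarith [hs.2], by linarith [hs.1]⟩ t ht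

lemma SHom.reverse (h : SHom V f g) : SHom V (fun t => f (1 - t)) (fun t => g (1 - t)) := by
  obtain ⟨H, hc, h0, h1, he, hV⟩ := h
  refine ⟨fun p => H (p.1, 1 - p.2), by fun_prop, by simp [h0], by simp [h1], ?_, ?_⟩
  · intro s hs
    have := he s hs
    simp [this]
  · intro s hs t ht
    exact hV _ hs _ ⟨by linarith [ht.2], by linarith [ht.1]⟩

/-- A linear homotopy. -/
lemma Hom.linear (hf : Continuous f) (hg : Continuous g)
    (e0 : f 0 = g 0) (e1 : f 1 = g 1)
    (hV : ∀ s ∈ U, ∀ t ∈ Ioo (0:ℝ) 1, ((1 - s : ℝ) : ℂ) * f t + (s : ℂ) * g t ∉ V) : Hom U V f g := by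
  refine ⟨fun p => ((1 - p.1 : ℝ) : ℂ) * f p.2 + (p.1 : ℂ) * g p.2, by fun_prop, by simp, by simp,
    ?_, fun s hs t ht => hV s hs t ht⟩
  intro s _
  simp only [← e0, ← e1]
  constructor <;> push_cast <;> ring

lemma SHom.of_reparam (hf : Continuous f) {φ : ℝ → ℝ} (hφ : Continuous φ) (h0 : φ 0 = 0)
    (h1 : φ 1 = 1) (hi : ∀ t ∈ Ioo (0:ℝ) 1, φ t ∈ Ioo (0:ℝ) 1)
    (hV : ∀ t ∈ Ioo (0:ℝ) 1, f t ∉ V) : SHom V (fun t => f (φ t)) f := by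
  refine ⟨fun p => f ((1 - p.1) * φ p.2 + p.1 * p.2), by fun_prop, by simp, by simp, ?_, ?_⟩
  · intro s _; simp [h0, h1]
  · intro s hs t ht
    apply hV
    exact (convex_Ioo (0:ℝ) 1) (hi t ht) ht (by linarith [hs.2]) hs.1 (by ring)

lemma Hom.homotopicIn (hU : Ioo 0 1 ⊆ U) (h : Hom U V f g) :
    ∃ H : unitInterval × unitInterval → ℂ, Continuous H ∧
    (∀ t, H (0, t) = f t) ∧ (∀ t, H (1, t) = g t) ∧
    (∀ s, H (s, 0) = f 0) ∧ (∀ s, H (s, 1) = f 1) ∧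
    (∀ s t : unitInterval, s ≠ 0 → s ≠ 1 → t ≠ 0 → t ≠ 1 → H (s, t) ∉ V) := by
  obtain ⟨H, hc, h0, h1, he, hV⟩ := h
  have io : ∀ s : unitInterval, s ≠ 0 → s ≠ 1 → (s : ℝ) ∈ Ioo (0:ℝ) 1 := fun s a b =>
    ⟨unitInterval.pos_iff_ne_zero.2 a, unitInterval.lt_one_iff_ne_one.2 b⟩
  refine ⟨fun p => H (p.1, p.2), by fun_prop, by simp [h0], by simp [h1], fun s => (he s s.2).1,
    fun s => (he s s.2).2, fun s t a b c d => hV _ (hU (io s a b)) _ (io t c d)⟩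

/-- Two curves which agree outside an interval and stay within a star-convex set in that
interval are homotopic. -/
lemma SHom.of_starConvex {S : Set ℂ} {o : ℂ} (hS : StarConvex ℝ o S) (hSV : Disjoint S V)
    (hf : Continuous f) (hg : Continuous g) {a b : ℝ} (ha : 0 ≤ a) (hab : a < b) (hb : b ≤ 1)
    (e : ∀ t, t ∉ Ioo a b → f t = g t) (hfS : ∀ t ∈ Icc a b, f t ∈ S) (hgS : ∀ t ∈ Icc a b, g t ∈ S)
    (hV : ∀ t ∈ Ioo (0:ℝ) 1, f t ∉ V) : SHom V f g := by
  have hba : 0 < b - a := by linarith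
  have mem : ∀ t : unitInterval, a + t * (b - a) ∈ Icc a b := fun t =>
    ⟨by nlinarith [t.2.1], by nlinarith [t.2.2]⟩
  have : ContractibleSpace S := hS.contractibleSpace ⟨f a, hfS a ⟨le_rfl, hab.le⟩⟩
  let P : Path (⟨f a, hfS a ⟨le_rfl, hab.le⟩⟩ : S) ⟨f b, hfS b ⟨hab.le, le_rfl⟩⟩ :=
    { toFun := fun t => ⟨f (a + t * (b - a)), hfS _ (mem t)⟩
      continuous_toFun := by fun_prop
      source' := by simp
      target' := by simp }
  let Q : Path (⟨f a, hfS a ⟨le_rfl, hab.le⟩⟩ : S) ⟨f b, hfS b ⟨hab.le, le_rfl⟩⟩ :=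
    { toFun := fun t => ⟨g (a + t * (b - a)), hgS _ (mem t)⟩
      continuous_toFun := by fun_prop
      source' := by simp [e a]
      target' := by simp [e b] }
  obtain ⟨F⟩ := SimplyConnectedSpace.paths_homotopic P Q
  let pr : ℝ → unitInterval := projIcc 0 1 zero_le_one
  have hpr : Continuous pr := continuous_projIcc
  have prr : ∀ t ∈ Icc a b, a + (pr ((t - a) / (b - a)) : ℝ) * (b - a) = t := by
    intro t ht
    have : (t - a) / (b - a) ∈ Icc (0:ℝ) 1 :=
      ⟨div_nonneg (by linarith [ht.1]) hba.le, (div_le_one hba).2 (by linarith [ht.2])⟩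
    simp only [pr, projIcc_of_mem zero_le_one this]
    field_simp
    ring
  have pr0 : pr 0 = 0 := projIcc_left _
  have pr1 : pr 1 = 1 := projIcc_right _
  let K : ℝ × ℝ → ℂ := fun p => (F (pr p.1, pr ((p.2 - a) / (b - a))) : ℂ)
  have hK : Continuous K := by
    refine continuous_subtype_val.comp (F.continuous.comp ?_)
    fun_prop
  have Ka : ∀ s, K (s, a) = f a := by
    intro s
    have : F (pr s, 0) = _ := F.source (pr s)
    simp only [K, sub_self, zero_div, pr0, this]
  have Kb : ∀ s, K (s, b) = f b := by
    intro s
    have : F (pr s, 1) = _ := F.target (pr s)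
    simp only [K, div_self hba.ne', pr1, this]
  refine ⟨fun p => if p.2 ≤ a then f p.2 else if p.2 ≤ b then K p else f p.2, ?_, ?_, ?_, ?_, ?_⟩
  · refine Continuous.if_le (by fun_prop) ?_ (by fun_prop) (by fun_prop) ?_
    · refine Continuous.if_le hK (by fun_prop) (by fun_prop) (by fun_prop) ?_
      rintro ⟨s, t⟩ hs
      simp only at hs
      subst hs
      exact Kb s
    · rintro ⟨s, t⟩ hs
      simp only at hs
      subst hs
      simp only [hab.le, if_true]
      exact (Ka s).symm
  · intro t
    simp only
    split_ifs with c d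
    · rfl
    · have : F (0, pr ((t - a) / (b - a))) = P _ := F.apply_zero _
      simp only [K, pr0, this]
      change f _ = _
      rw [prr t ⟨by linarith, d⟩]
    · rfl
  · intro t
    simp only
    split_ifs with c d
    · exact e t fun h => by linarith [h.1]
    · have : F (1, pr ((t - a) / (b - a))) = Q _ := F.apply_one _
      simp only [K, pr1, this]
      change g _ = _
      rw [prr t ⟨by linarith, d⟩]
    · exact e t fun h => by linarith [h.2]
  · intro s _
    simp only
    constructor
    · rw [if_pos ha]
    · rw [if_neg (by linarith)]
      split_ifs with c
      · have : b = 1 := le_antisymm hb c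
        subst this
        exact Kb s
      · rfl
  · intro s hs t ht
    simp only
    split_ifs with c d
    · exact hV t ht
    · exact fun h => disjoint_left.1 hSV (F _).2 h
    · exact hV t ht

end SlabPath

namespace SlabPath

open Set

/-- Points of the plane listed with increasing real part. -/
structure Pts (n : ℕ) where
  v : ℕ → ℂ
  mono : ∀ i j, i < j → j < n → (v i).re < (v j).re

namespace Pts

variable {n : ℕ} (P : Pts n)

def V : Set ℂ := {z | ∃ i < n, z = P.v i}

noncomputable def pt (q : Station) : ℂ := P.v q.1 + (q.2 : ℂ) * Complex.I

def slab (k : ℕ) : Set ℂ :=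
  {z | (∀ i < n, i < k → (P.v i).re < z.re) ∧ ∀ i < n, k ≤ i → z.re < (P.v i).re}

/-- Two adjacent slabs together with one of the two rays separating them. -/
def Window (i : ℕ) (s : ℝ) : Set ℂ :=
  P.slab i ∪ P.slab (i + 1) ∪ {z | z.re = (P.v i).re ∧ 0 < s * (z.im - (P.v i).im)}

variable {P}

lemma pt_re (q : Station) : (P.pt q).re = (P.v q.1).re := by simp [pt]
lemma pt_im (q : Station) : (P.pt q).im = (P.v q.1).im + q.2 := by simp [pt]

lemma re_inj {i j : ℕ} (hi : i < n) (hj : j < n) (h : (P.v i).re = (P.v j).re) : i = j := by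
  rcases lt_trichotomy i j with c | c | c
  · exact absurd h (P.mono i j c hj).ne
  · exact c
  · exact absurd h (P.mono j i c hi).ne'

lemma slab_not_mem {k : ℕ} {z : ℂ} (h : z ∈ P.slab k) : z ∉ P.V := by
  rintro ⟨i, hi, rfl⟩
  rcases lt_or_ge i k with c | c
  · exact lt_irrefl _ (h.1 i hi c)
  · exact lt_irrefl _ (h.2 i hi c)

lemma ray_not_mem {i : ℕ} (hi : i < n) {z : ℂ} (h : z.re = (P.v i).re) (h' : z.im ≠ (P.v i).im) :
    z ∉ P.V := by
  rintro ⟨j, hj, rfl⟩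
  rw [re_inj hj hi h] at h'
  exact h' rfl

lemma pt_not_mem {q : Station} (hi : q.1 < n) (h : q.2 ≠ 0) : P.pt q ∉ P.V :=
  ray_not_mem hi (pt_re q) (by rw [pt_im]; simpa using h)

lemma window_not_mem {i : ℕ} (hi : i < n) {s : ℝ} {z : ℂ} (h : z ∈ P.Window i s) : z ∉ P.V := by
  rcases h with (h | h) | h
  · exact slab_not_mem h
  · exact slab_not_mem h
  · refine ray_not_mem hi h.1 fun e => ?_
    have := h.2
    rw [e] at this
    simp at this

/-- A slab is closed under convex combinations with a point of its closure. -/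
lemma slab_comb {k : ℕ} {z w : ℂ} (hz : z ∈ P.slab k)
    (hw1 : ∀ i < n, i < k → (P.v i).re ≤ w.re) (hw2 : ∀ i < n, k ≤ i → w.re ≤ (P.v i).re)
    {a b : ℝ} (ha : 0 < a) (hb : 0 ≤ b) (hab : a + b = 1) : (a : ℂ) * z + (b : ℂ) * w ∈ P.slab k := by
  constructor
  · intro i hi h
    have h1 := hz.1 i hi h
    have h2 := hw1 i hi h
    simp
    have e : (P.v i).re = a * (P.v i).re + b * (P.v i).re := by rw [← add_mul, hab, one_mul]
    nlinarith [mul_pos ha (sub_pos.2 h1), mul_nonneg hb (sub_nonneg.2 h2)]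
  · intro i hi h
    have h1 := hz.2 i hi h
    have h2 := hw2 i hi h
    simp
    have e : (P.v i).re = a * (P.v i).re + b * (P.v i).re := by rw [← add_mul, hab, one_mul]
    nlinarith [mul_pos ha (sub_pos.2 h1), mul_nonneg hb (sub_nonneg.2 h2)]

lemma closure_of_adj {k i : ℕ} (hi : i < n) (h : Adj k i) {w : ℂ} (hw : w.re = (P.v i).re) :
    (∀ j < n, j < k → (P.v j).re ≤ w.re) ∧ ∀ j < n, k ≤ j → w.re ≤ (P.v j).re := by
  unfold Adj at h
  rw [hw]
  constructor
  · intro j hj hjk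
    rcases eq_or_lt_of_le (show j ≤ i by omega) with e | e
    · rw [e]
    · exact (P.mono _ _ e hi).le
  · intro j hj hjk
    rcases eq_or_lt_of_le (show i ≤ j by omega) with e | e
    · rw [e]
    · exact (P.mono _ _ e hj).le

lemma slab_comb_ray {k i : ℕ} (hi : i < n) (h : Adj k i) {z w : ℂ} (hz : z ∈ P.slab k)
    (hw : w.re = (P.v i).re) {a b : ℝ} (ha : 0 < a) (hb : 0 ≤ b) (hab : a + b = 1) :
    (a : ℂ) * z + (b : ℂ) * w ∈ P.slab k :=
  slab_comb hz (closure_of_adj hi h hw).1 (closure_of_adj hi h hw).2 ha hb hab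

lemma slab_comb_slab {k : ℕ} {z w : ℂ} (hz : z ∈ P.slab k) (hw : w ∈ P.slab k)
    {a b : ℝ} (ha : 0 ≤ a) (hb : 0 ≤ b) (hab : a + b = 1) :
    (a : ℂ) * z + (b : ℂ) * w ∈ P.slab k := by
  rcases ha.eq_or_lt with rfl | ha
  · obtain rfl : b = 1 := by linarith
    simpa using hw
  · exact slab_comb hz (fun i hi h => (hw.1 i hi h).le) (fun i hi h => (hw.2 i hi h).le) ha hb hab

lemma window_comb {i : ℕ} (hi : i < n) {s : ℝ} {z w : ℂ} (hz : z ∈ P.Window i s)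
    (hw : w.re = (P.v i).re) (hw' : 0 < s * (w.im - (P.v i).im)) {a b : ℝ} (ha : 0 ≤ a) (hb : 0 ≤ b)
    (hab : a + b = 1) : (a : ℂ) * z + (b : ℂ) * w ∈ P.Window i s := by
  rcases ha.eq_or_lt with rfl | ha
  · obtain rfl : b = 1 := by linarith
    exact Or.inr (by simpa using ⟨hw, hw'⟩)
  · rcases hz with (h | h) | h
    · exact Or.inl (Or.inl (slab_comb_ray hi (Or.inl rfl) h hw ha hb hab))
    · exact Or.inl (Or.inr (slab_comb_ray hi (Or.inr rfl) h hw ha hb hab))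
    · refine Or.inr ⟨?_, ?_⟩
      · simp only [Complex.add_re, Complex.re_ofReal_mul, h.1, hw]
        rw [← add_mul, hab, one_mul]
      · have h2 := h.2
        simp only [Complex.add_im, Complex.im_ofReal_mul]
        have : s * (a * z.im + b * w.im - (P.v i).im) =
          a * (s * (z.im - (P.v i).im)) + b * (s * (w.im - (P.v i).im)) := by
            have : a = 1 - b := by linarith
            subst this; ring
        rw [this]
        have := mul_pos ha h2
        positivity

lemma window_starConvex {i : ℕ} (hi : i < n) {s : ℝ} {w : ℂ}
    (hw : w.re = (P.v i).re) (hw' : 0 < s * (w.im - (P.v i).im)) : StarConvex ℝ w (P.Window i s) := by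
  intro z hz a b ha hb hab
  have := window_comb hi hz hw hw' hb ha (by linarith)
  simp only [Complex.real_smul]
  rwa [add_comm]

lemma slab_subset_window {i k : ℕ} {s : ℝ} (h : Adj k i) : P.slab k ⊆ P.Window i s := by
  rcases h with rfl | rfl
  · exact fun z hz => Or.inl (Or.inl hz)
  · exact fun z hz => Or.inl (Or.inr hz)

variable (P)

/-- The curve `f`, from the time `c` on, starts in the slab `k` and then crosses the lines at the
stations of the list. -/
def RealF (f : ℝ → ℂ) : ℝ → ℕ → List Station → Prop
  | _, _, [] => False
  | c, k, [q] => c < 1 ∧ q.1 < n ∧ Adj k q.1 ∧ q.2 = 0 ∧ (∀ t ∈ Ioo c 1, f t ∈ P.slab k) ∧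
      f 1 = P.pt q
  | c, k, q :: r :: L => ∃ d, c < d ∧ q.1 < n ∧ Adj k q.1 ∧ q.2 ≠ 0 ∧
      (∀ t ∈ Ioo c d, f t ∈ P.slab k) ∧ f d = P.pt q ∧ RealF f d (opp q.1 k) (r :: L)

variable {P}
variable {f g : ℝ → ℂ}

lemma RealF.ne_nil {c : ℝ} {k : ℕ} {L : List Station} (h : P.RealF f c k L) : L ≠ [] := by
  rintro rfl; exact h

lemma realF_cons {c : ℝ} {k : ℕ} {q : Station} {L : List Station} (hL : L ≠ []) :
    P.RealF f c k (q :: L) ↔ ∃ d, c < d ∧ q.1 < n ∧ Adj k q.1 ∧ q.2 ≠ 0 ∧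
      (∀ t ∈ Ioo c d, f t ∈ P.slab k) ∧ f d = P.pt q ∧ P.RealF f d (opp q.1 k) L := by
  rcases L with _ | ⟨r, t⟩
  · exact absurd rfl hL
  · rfl

lemma RealF.halfOk {L : List Station} : ∀ {c : ℝ} {k : ℕ}, P.RealF f c k L → HalfOk k L := by
  induction L with
  | nil => intro c k h; exact absurd rfl h.ne_nil
  | cons q L ih =>
    intro c k h
    by_cases hL : L = []
    · subst hL; exact ⟨h.2.2.1, h.2.2.2.1⟩
    · obtain ⟨d, _, _, h1, h2, _, _, h3⟩ := (realF_cons hL).1 h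
      exact (halfOk_cons hL).2 ⟨h1, h2, ih h3⟩

lemma RealF.lt_n {L : List Station} : ∀ {c : ℝ} {k : ℕ}, P.RealF f c k L → ∀ q ∈ L, q.1 < n := by
  induction L with
  | nil => intro c k h; exact absurd rfl h.ne_nil
  | cons q L ih =>
    intro c k h
    by_cases hL : L = []
    · subst hL; intro q hq; rw [List.mem_singleton.1 hq]; exact h.2.1
    · obtain ⟨d, _, h0, h1, h2, _, _, h3⟩ := (realF_cons hL).1 h
      intro r hr
      rcases List.mem_cons.1 hr with rfl | hr
      · exact h0
      · exact ih h3 r hr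

lemma RealF.lt_one {L : List Station} : ∀ {c : ℝ} {k : ℕ}, P.RealF f c k L → c < 1 := by
  induction L with
  | nil => intro c k h; exact absurd rfl h.ne_nil
  | cons q L ih =>
    intro c k h
    by_cases hL : L = []
    · subst hL; exact h.1
    · obtain ⟨d, h0, _, h1, h2, _, _, h3⟩ := (realF_cons hL).1 h
      exact h0.trans (ih h3)

lemma RealF.not_mem {L : List Station} : ∀ {c : ℝ} {k : ℕ}, P.RealF f c k L →
    ∀ t ∈ Ioo c 1, f t ∉ P.V := by
  induction L with
  | nil => intro c k h; exact absurd rfl h.ne_nil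
  | cons q L ih =>
    intro c k h t ht
    by_cases hL : L = []
    · subst hL; exact slab_not_mem (h.2.2.2.2.1 t ht)
    · obtain ⟨d, h0, hn, h1, h2, hs, hd, h3⟩ := (realF_cons hL).1 h
      rcases lt_trichotomy t d with c | c | c
      · exact slab_not_mem (hs t ⟨ht.1, c⟩)
      · rw [c, hd]; exact pt_not_mem hn h2
      · exact ih h3 t ⟨c, ht.2⟩

lemma RealF.congr {L : List Station} : ∀ {c : ℝ} {k : ℕ}, P.RealF f c k L →
    (∀ t, c < t → t ≤ 1 → f t = g t) → P.RealF g c k L := by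
  induction L with
  | nil => intro c k h; exact absurd rfl h.ne_nil
  | cons q L ih =>
    intro c k h e
    by_cases hL : L = []
    · subst hL
      obtain ⟨h1, h2, h3, h4, h5, h6⟩ := h
      exact ⟨h1, h2, h3, h4, fun t ht => by rw [← e t ht.1 ht.2.le]; exact h5 t ht,
        by rw [← e 1 h1 le_rfl]; exact h6⟩
    · obtain ⟨d, h0, hn, h1, h2, hs, hd, h3⟩ := (realF_cons hL).1 h
      have := h3.lt_one
      exact (realF_cons hL).2 ⟨d, h0, hn, h1, h2,
        fun t ht => by rw [← e t ht.1 (ht.2.trans this).le]; exact hs t ht,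
        by rw [← e d h0 this.le]; exact hd, ih h3 fun t ht => e t (h0.trans ht)⟩

/-- The starting time can be changed as long as one stays in the first slab. -/
lemma RealF.extend {L : List Station} {c c' : ℝ} {k : ℕ} (h : P.RealF f c k L) (hc : c' ≤ c)
    (hs : ∀ t ∈ Ioc c' c, f t ∈ P.slab k) : P.RealF f c' k L := by
  rcases L with _ | ⟨q, L⟩
  · exact absurd rfl h.ne_nil
  by_cases hL : L = []
  · subst hL
    obtain ⟨h1, h2, h3, h4, h5, h6⟩ := h
    refine ⟨hc.trans_lt h1, h2, h3, h4, fun t ht => ?_, h6⟩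
    rcases le_or_gt t c with g | g
    · exact hs t ⟨ht.1, g⟩
    · exact h5 t ⟨g, ht.2⟩
  · obtain ⟨d, h0, hn, h1, h2, h5, hd, h3⟩ := (realF_cons hL).1 h
    refine (realF_cons hL).2 ⟨d, hc.trans_lt h0, hn, h1, h2, fun t ht => ?_, hd, h3⟩
    rcases le_or_gt t c with g | g
    · exact hs t ⟨ht.1, g⟩
    · exact h5 t ⟨g, ht.2⟩

lemma RealF.exists_next {L : List Station} {c : ℝ} {k : ℕ} (h : P.RealF f c k L) :
    ∃ d, c < d ∧ d ≤ 1 ∧ ∀ t ∈ Ioo c d, f t ∈ P.slab k ∧ P.RealF f t k L := by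
  rcases L with _ | ⟨q, L⟩
  · exact absurd rfl h.ne_nil
  by_cases hL : L = []
  · subst hL
    obtain ⟨h1, h2, h3, h4, h5, h6⟩ := h
    exact ⟨1, h1, le_rfl, fun t ht => ⟨h5 t ht, ht.2, h2, h3, h4,
      fun s hs => h5 s ⟨ht.1.trans hs.1, hs.2⟩, h6⟩⟩
  · obtain ⟨d, h0, hn, h1, h2, h5, hd, h3⟩ := (realF_cons hL).1 h
    exact ⟨d, h0, h3.lt_one.le, fun t ht => ⟨h5 t ht, (realF_cons hL).2 ⟨d, ht.2, hn, h1, h2,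
      fun s hs => h5 s ⟨ht.1.trans hs.1, hs.2⟩, hd, h3⟩⟩⟩

variable (P)

/-- A two-sided version of `RealF`, based at the time `c`. -/
structure Real2 (f : ℝ → ℂ) (c : ℝ) (k : ℕ) (L R : List Station) : Prop where
  mem : f c ∈ P.slab k
  left : P.RealF (fun t => f (1 - t)) (1 - c) k L
  right : P.RealF f c k R

variable {P} {c : ℝ} {k : ℕ} {L R : List Station}

lemma Real2.symm (h : P.Real2 f c k L R) : P.Real2 (fun t => f (1 - t)) (1 - c) k R L :=
  ⟨by simpa using h.mem, by simpa using h.right, h.left⟩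

lemma Real2.symm' (h : P.Real2 (fun t => f (1 - t)) c k L R) : P.Real2 f (1 - c) k R L := by
  simpa using h.symm

lemma Real2.pos (h : P.Real2 f c k L R) : 0 < c := by have := h.left.lt_one; linarith

lemma Real2.not_mem (h : P.Real2 f c k L R) : ∀ t ∈ Ioo (0:ℝ) 1, f t ∉ P.V := by
  intro t ht
  rcases lt_trichotomy t c with g | g | g
  · have := h.left.not_mem (1 - t) ⟨by linarith, by linarith [ht.1]⟩
    simpa using this
  · rw [g]; exact slab_not_mem h.mem
  · exact h.right.not_mem t ⟨g, ht.2⟩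

lemma Real2.shift {q : Station} (h : P.Real2 f c k L (q :: R)) (hR : R ≠ []) :
    ∃ c', c < c' ∧ P.Real2 f c' (opp q.1 k) (q :: L) R := by
  obtain ⟨d, h0, hn, h1, h2, h5, hd, h3⟩ := (realF_cons hR).1 h.right
  obtain ⟨d', hd', _, h6⟩ := h3.exists_next
  have hm := h6 ((d + d') / 2) ⟨by linarith, by linarith⟩
  refine ⟨(d + d') / 2, by linarith, hm.1, (realF_cons h.left.ne_nil).2 ⟨1 - d, by linarith, hn, adj_opp h1, h2, ?_, by simpa using hd, ?_⟩, hm.2⟩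
  · intro t ht
    exact (h6 _ ⟨by linarith [ht.2], by linarith [ht.1]⟩).1
  · rw [opp_opp h1]
    refine h.left.extend (by linarith) fun t ht => ?_
    rcases ht.2.eq_or_lt with e | e
    · rw [e]; simpa using h.mem
    · exact h5 _ ⟨by linarith, by linarith [ht.1]⟩

end Pts

end SlabPath

namespace SlabPath

open Set

namespace Pts

variable {n : ℕ} {P : Pts n} {f g : ℝ → ℂ}

lemma comb_ray {i : ℕ} (hi : i < n) {z w : ℂ} (hz : z.re = (P.v i).re) (hw : w.re = (P.v i).re)
    {τ : ℝ} (hz' : 0 < τ * (z.im - (P.v i).im)) (hw' : 0 < τ * (w.im - (P.v i).im))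
    {a b : ℝ} (ha : 0 ≤ a) (hb : 0 ≤ b) (hab : a + b = 1) : (a : ℂ) * z + (b : ℂ) * w ∉ P.V :=
  window_not_mem hi (window_comb hi (Or.inr ⟨hz, hz'⟩) hw hw' ha hb hab)

lemma exists_sign {p q : Station} (h : side p = side q) (hp : p.2 ≠ 0) :
    ∃ τ : ℝ, 0 < τ * p.2 ∧ 0 < τ * q.2 := by
  have hs := sign_of_side h
  rcases lt_or_gt_of_ne hp with c | c
  · rw [sign_neg c, eq_comm, sign_eq_neg_one_iff] at hs
    exact ⟨-1, by linarith, by linarith⟩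
  · rw [sign_pos c, eq_comm, sign_eq_one_iff] at hs
    exact ⟨1, by linarith, by linarith⟩

/-- Curves with the same combinatorial itinerary can be matched. -/
lemma RealF.exists_match {L : List Station} : ∀ {L' : List Station} {c d : ℝ} {k : ℕ},
    P.RealF f c k L → P.RealF g d k L' → wd L = wd L' →
    ∃ ψ : ℝ → ℝ, Continuous ψ ∧ ψ c = d ∧ ψ 1 = 1 ∧ (∀ t ∈ Ioo c 1, ψ t ∈ Ioo d 1) ∧
      f 1 = g 1 ∧ ∀ t ∈ Ioo c 1, ∀ s ∈ Icc (0:ℝ) 1,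
        ((1 - s : ℝ) : ℂ) * f t + (s : ℂ) * g (ψ t) ∉ P.V := by
  induction L with
  | nil => intro L' c d k h; exact absurd rfl h.ne_nil
  | cons q L ih =>
    intro L' c d k h h' hw
    rcases L' with _ | ⟨q', L'⟩
    · exact absurd rfl h'.ne_nil
    simp only [wd, List.map_cons, List.cons.injEq] at hw
    obtain ⟨hq, hw⟩ := hw
    have hq1 := fst_of_side hq
    by_cases hL : L = []
    · subst hL
      obtain rfl : L' = [] := by simpa using hw.symm
      obtain ⟨h1, h2, h3, h4, h5, h6⟩ := h
      obtain ⟨h1', h2', h3', h4', h5', h6'⟩ := h'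
      have hc : 0 < 1 - c := by linarith
      have hd : 0 < 1 - d := by linarith
      have hr : 0 < (1 - d) / (1 - c) := by positivity
      have hψ : ∀ t ∈ Ioo c 1, d + (t - c) * ((1 - d) / (1 - c)) ∈ Ioo d 1 := by
        intro t ht
        constructor
        · have := mul_pos (sub_pos.2 ht.1) hr
          linarith
        · have : (t - c) * ((1 - d) / (1 - c)) < (1 - c) * ((1 - d) / (1 - c)) :=
            mul_lt_mul_of_pos_right (by linarith [ht.2]) hr
          rw [mul_div_cancel₀ _ hc.ne'] at this
          linarith
      refine ⟨fun t => d + (t - c) * ((1 - d) / (1 - c)), by fun_prop, by simp, by field_simp; ring, hψ, ?_, ?_⟩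
      · rw [h6, h6']
        congr 1
        exact Prod.ext hq1 (h4.trans h4'.symm)
      · intro t ht s hs
        exact slab_not_mem (slab_comb_slab (h5 t ht) (h5' _ (hψ t ht)) (by linarith [hs.2]) hs.1
          (by ring))
    · have hL' : L' ≠ [] := by rintro rfl; simp at hw; exact hL hw
      obtain ⟨c', h0, hn, h1, h2, h5, hd, h3⟩ := (realF_cons hL).1 h
      obtain ⟨d', h0', hn', h1', h2', h5', hd', h3'⟩ := (realF_cons hL').1 h'
      rw [← hq1] at h3'
      obtain ⟨ψ, a1, a2, a3, a4, a5, a6⟩ := ih h3 h3' hw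
      have l3 := h3.lt_one
      have l3' := h3'.lt_one
      have hr : 0 < (d' - d) / (c' - c) := div_pos (by linarith) (by linarith)
      have hψ : ∀ t ∈ Ioo c c', d + (t - c) * ((d' - d) / (c' - c)) ∈ Ioo d d' := by
        intro t ht
        constructor
        · have := mul_pos (sub_pos.2 ht.1) hr
          linarith
        · have : (t - c) * ((d' - d) / (c' - c)) < (c' - c) * ((d' - d) / (c' - c)) :=
            mul_lt_mul_of_pos_right (by linarith [ht.2]) hr
          rw [mul_div_cancel₀ _ (by linarith)] at this
          linarith
      have hend : d + (c' - c) * ((d' - d) / (c' - c)) = d' := by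
        rw [mul_div_cancel₀ _ (by linarith)]; ring
      refine ⟨fun t => if t ≤ c' then d + (t - c) * ((d' - d) / (c' - c)) else ψ t, ?_, ?_, ?_, ?_,
        a5, ?_⟩
      · refine Continuous.if_le (by fun_prop) a1 continuous_id continuous_const ?_
        intro t ht
        subst ht
        rw [hend, a2]
      · simp [h0.le]
      · beta_reduce; rw [if_neg (by linarith), a3]
      · intro t ht
        beta_reduce
        rcases lt_trichotomy t c' with e | e | e
        · rw [if_pos e.le]
          have := hψ t ⟨ht.1, e⟩
          exact ⟨this.1, this.2.trans l3'⟩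
        · rw [if_pos e.le, e, hend]; exact ⟨h0', l3'⟩
        · rw [if_neg (by linarith)]
          have := a4 t ⟨e, ht.2⟩
          exact ⟨h0'.trans this.1, this.2⟩
      · intro t ht s hs
        rcases lt_trichotomy t c' with e | e | e
        · simp only [if_pos e.le]
          exact slab_not_mem (slab_comb_slab (h5 t ⟨ht.1, e⟩) (h5' _ (hψ t ⟨ht.1, e⟩))
            (by linarith [hs.2]) hs.1 (by ring))
        · simp only [e, le_refl, if_true, hend, hd, hd']
          obtain ⟨τ, s1, s2⟩ := exists_sign hq h2
          refine comb_ray hn (pt_re q) (by rw [pt_re, hq1]) (τ := τ) ?_ ?_ (by linarith [hs.2]) hs.1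
            (by ring)
          · rw [pt_im]; simpa using s1
          · rw [pt_im, ← hq1]; simpa using s2
        · simp only [if_neg (not_le.2 e)]
          exact a6 t ⟨e, ht.2⟩ s hs

theorem Real2.sHom {c c' : ℝ} {k : ℕ} {L R L' R' : List Station} (hf : Continuous f)
    (hg : Continuous g) (h : P.Real2 f c k L R) (h' : P.Real2 g c' k L' R') (hL : wd L = wd L')
    (hR : wd R = wd R') : SHom P.V f g := by
  obtain ⟨ψ, a1, a2, a3, a4, a5, a6⟩ := h.right.exists_match h'.right hR
  obtain ⟨φ, b1, b2, b3, b4, b5, b6⟩ := h.left.exists_match h'.left hL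
  have hc0 := h.pos
  have hc1 := h.right.lt_one
  have hd0 := h'.pos
  have hd1 := h'.right.lt_one
  let ω : ℝ → ℝ := fun t => if t ≤ c then 1 - φ (1 - t) else ψ t
  have hω : Continuous ω := by
    refine Continuous.if_le (by fun_prop) a1 continuous_id continuous_const ?_
    intro t ht
    subst ht
    rw [a2, b2]; ring
  have ω0 : ω 0 = 0 := by simp [ω, hc0.le, b3]
  have ω1 : ω 1 = 1 := by simp [ω, not_le.2 hc1, a3]
  simp only [sub_self] at b5
  refine SHom.trans' (g := fun t => g (ω t)) ?_ (SHom.of_reparam hg hω ω0 ω1 ?_ h'.not_mem)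
  · refine Hom.linear hf (by fun_prop) (by rw [ω0, b5]) (by rw [ω1, a5]) ?_
    intro s hs t ht
    rcases lt_trichotomy t c with e | e | e
    · have := b6 (1 - t) ⟨by linarith, by linarith [ht.1]⟩ s hs
      simp only [ω, if_pos e.le]
      simpa using this
    · simp only [ω, e, le_refl, if_true, b2]
      refine slab_not_mem (slab_comb_slab h.mem ?_ (by linarith [hs.2]) hs.1 (by ring))
      simpa using h'.mem
    · simp only [ω, if_neg (not_le.2 e)]
      exact a6 t ⟨e, ht.2⟩ s hs
  · intro t ht
    rcases lt_trichotomy t c with e | e | e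
    · have := b4 (1 - t) ⟨by linarith, by linarith [ht.1]⟩
      simp only [ω, if_pos e.le]
      exact ⟨by linarith [this.2], by linarith [this.1]⟩
    · simp only [ω, e, le_refl, if_true, b2]
      exact ⟨by linarith, by linarith⟩
    · simp only [ω, if_neg (not_le.2 e)]
      have := a4 t ⟨e, ht.2⟩
      exact ⟨by linarith [this.1], this.2⟩

/-- The curve `f` with its restriction to `[a, b]` replaced by a segment. -/
noncomputable def straighten (f : ℝ → ℂ) (a b : ℝ) (t : ℝ) : ℂ :=
  if t ≤ a then f t else if t ≤ b then
    ((1 - (t - a) / (b - a) : ℝ) : ℂ) * f a + ((t - a) / (b - a) : ℝ) * f b else f t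

lemma straighten_continuous (hf : Continuous f) {a b : ℝ} (hab : a < b) :
    Continuous (straighten f a b) := by
  have : b - a ≠ 0 := by linarith
  refine Continuous.if_le hf ?_ continuous_id continuous_const ?_
  · refine Continuous.if_le ?_ hf continuous_id continuous_const ?_
    · have : Continuous fun t : ℝ => (t - a) / (b - a) := by fun_prop
      fun_prop
    · intro t ht
      subst ht
      rw [div_self this]; simp
  · intro t ht
    subst ht
    rw [if_pos hab.le]; simp

lemma straighten_of_notMem {a b t : ℝ} (h : t ∉ Ioo a b) (hab : a < b) :
    straighten f a b t = f t := by
  unfold straighten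
  split_ifs with h1 h2
  · rfl
  · have : t = b := le_antisymm h2 (by by_contra c; exact h ⟨by linarith, by linarith⟩)
    subst this
    rw [div_self (by linarith)]; simp
  · rfl

lemma straighten_of_mem {a b t : ℝ} (h : t ∈ Ioo a b) :
    ∃ x y : ℝ, 0 < x ∧ 0 < y ∧ x + y = 1 ∧ straighten f a b t = (x : ℂ) * f a + (y : ℂ) * f b := by
  have hba : 0 < b - a := by linarith [h.1, h.2]
  refine ⟨1 - (t - a) / (b - a), (t - a) / (b - a), ?_, div_pos (by linarith [h.1]) hba, by ring, ?_⟩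
  · rw [sub_pos, div_lt_one hba]; linarith [h.2]
  · unfold straighten; rw [if_neg (by linarith [h.1]), if_pos h.2.le]

lemma Real2.mid (hf : Continuous f) {c : ℝ} {k : ℕ} {p p' : Station} {L R : List Station}
    (h : P.Real2 f c k L (p :: p' :: R)) (hR : R ≠ []) (hs : side p = side p') :
    ∃ g, Continuous g ∧ SHom P.V f g ∧ P.Real2 g c k L R := by
  obtain ⟨d, h0, hn, h1, h2, h5, hd, h3⟩ := (realF_cons (by simp)).1 h.right
  obtain ⟨d', h0', hn', h1', h2', h5', hd', h3'⟩ := (realF_cons hR).1 h3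
  have hp := fst_of_side hs
  rw [← hp, opp_opp h1] at h3'
  obtain ⟨e, he, he1, h6⟩ := h3'.exists_next
  obtain ⟨hm, hr⟩ := h6 ((d' + e) / 2) ⟨by linarith, by linarith⟩
  set a := (d' + e) / 2
  have hca : c < a := by simp only [a]; linarith
  have hc0 := h.pos
  have ho : ∀ t, t ∉ Ioo c a → straighten f c a t = f t := fun t ht => straighten_of_notMem ht hca
  have hin : ∀ t ∈ Ioo c a, straighten f c a t ∈ P.slab k := fun t ht => by
    obtain ⟨x, y, hx, hy, hxy, e⟩ := straighten_of_mem (f := f) ht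
    rw [e]
    exact slab_comb_slab h.mem hm hx.le hy.le hxy
  obtain ⟨τ, s1, s2⟩ := exists_sign hs h2
  have hW : ∀ t ∈ Icc c a, f t ∈ P.Window p.1 τ := by
    intro t ht
    rcases lt_trichotomy t d with g | g | g
    · rcases ht.1.eq_or_lt with g' | g'
      · rw [← g']; exact slab_subset_window h1 h.mem
      · exact slab_subset_window h1 (h5 t ⟨g', g⟩)
    · rw [g, hd]; exact Or.inr ⟨pt_re p, by rw [pt_im]; simpa using s1⟩
    rcases lt_trichotomy t d' with g' | g' | g'
    · exact slab_subset_window (adj_opp h1) (h5' t ⟨g, g'⟩)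
    · rw [g', hd']; exact Or.inr ⟨by rw [pt_re, hp], by rw [pt_im, hp]; simpa using s2⟩
    · exact slab_subset_window h1 (h6 t ⟨g', lt_of_le_of_lt ht.2 (by simp only [a]; linarith)⟩).1
  refine ⟨straighten f c a, straighten_continuous hf hca, ?_, ?_, ?_, ?_⟩
  · refine SHom.of_starConvex (S := P.Window p.1 τ) (o := P.pt p) (window_starConvex hn (pt_re p)
      (by rw [pt_im]; simpa using s1)) (Set.disjoint_left.2 fun z hz => window_not_mem hn hz) hf
      (straighten_continuous hf hca) hc0.le hca (by simp only [a]; linarith) (fun t ht => (ho t ht).symm) hW ?_ h.not_mem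
    intro t ht
    by_cases g : t ∈ Ioo c a
    · exact slab_subset_window h1 (hin t g)
    · rw [ho t g]; exact hW t ht
  · rw [ho c (by simp)]; exact h.mem
  · refine h.left.congr fun t ht _ => (ho _ ?_).symm
    exact fun g => by linarith [g.1]
  · refine (hr.congr (g := straighten f c a) fun t ht _ => (ho _ ?_).symm).extend hca.le ?_
    · exact fun g => by linarith [g.2]
    · intro t ht
      rcases ht.2.eq_or_lt with g | g
      · rw [g, ho a (by simp)]; exact hm
      · exact hin t ⟨ht.1, g⟩

/-- Two curves that end at the same vertex within a window are homotopic. -/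
lemma sHom_of_window (hf : Continuous f) (hg : Continuous g) {i : ℕ} (hi : i < n) {τ c : ℝ}
    (hτ : τ ≠ 0) (hc : 0 ≤ c) (hc1 : c < 1) (e : ∀ t ≤ c, f t = g t)
    (hfW : ∀ t ∈ Ico c 1, f t ∈ P.Window i τ) (hgW : ∀ t ∈ Ico c 1, g t ∈ P.Window i τ)
    (hf1 : f 1 = P.v i) (hg1 : g 1 = P.v i) (hV : ∀ t ∈ Ioo 0 1, f t ∉ P.V) : SHom P.V f g := by
  set b := (c + 1) / 2 with hb
  let m : ℝ → ℂ := fun t => P.v i + ((τ * (1 - t) : ℝ) : ℂ) * Complex.I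
  have hm : Continuous m := by fun_prop
  have m_re : ∀ t, (m t).re = (P.v i).re := fun t => by simp [m]
  have m_im : ∀ t < 1, 0 < τ * ((m t).im - (P.v i).im) := fun t ht => by
    have : (m t).im - (P.v i).im = τ * (1 - t) := by simp [m]
    rw [this, ← mul_assoc]
    have := mul_self_pos.2 hτ
    nlinarith
  let χ : ℝ → ℝ := fun t => max 0 (min 1 ((t - c) / (b - c)))
  have hbc : 0 < b - c := by rw [hb]; linarith
  have hχ : Continuous χ := by fun_prop
  have χ0 : ∀ t ≤ c, χ t = 0 := fun t ht => by
    have : (t - c) / (b - c) ≤ 0 := div_nonpos_of_nonpos_of_nonneg (by linarith) hbc.le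
    simp only [χ]
    exact max_eq_left ((min_le_right _ _).trans this)
  have χ1 : ∀ t, b ≤ t → χ t = 1 := fun t ht => by
    have : 1 ≤ (t - c) / (b - c) := by rw [le_div_iff₀ hbc]; linarith
    simp only [χ, min_eq_left this]
    norm_num
  have χm : ∀ t, χ t ∈ Icc (0:ℝ) 1 := fun t => ⟨le_max_left _ _, max_le zero_le_one (min_le_left _ _)⟩
  let push : (ℝ → ℂ) → ℝ → ℂ := fun f t => ((1 - χ t : ℝ) : ℂ) * f t + (χ t : ℂ) * m t
  have pc : ∀ {f : ℝ → ℂ}, Continuous f → Continuous (push f) := fun hf => by fun_prop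
  have main : ∀ f : ℝ → ℂ, Continuous f → (∀ t ∈ Ico c 1, f t ∈ P.Window i τ) → f 1 = P.v i →
      (∀ t ∈ Ioo 0 1, f t ∉ P.V) → SHom P.V f (push f) := by
    intro f hf hfW hf1 hV
    refine Hom.linear hf (pc hf) ?_ ?_ ?_
    · simp [push, χ0 0 hc]
    · simp [push, χ1 1 (by linarith), m, hf1]
    · intro s hs t ht
      have eq : ((1 - s : ℝ) : ℂ) * f t + (s : ℂ) * push f t =
          ((1 - s * χ t : ℝ) : ℂ) * f t + ((s * χ t : ℝ) : ℂ) * m t := by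
        simp only [push]; push_cast; ring
      rw [eq]
      rcases le_or_gt t c with g | g
      · rw [χ0 t g]; simpa using hV t ht
      · have h1 : 0 ≤ s * χ t := mul_nonneg hs.1 (χm t).1
        have h2 : s * χ t ≤ 1 := mul_le_one₀ hs.2 (χm t).1 (χm t).2
        exact window_not_mem hi (window_comb hi (hfW t ⟨g.le, ht.2⟩) (m_re t) (m_im t ht.2)
          (by linarith) h1 (by ring))
  have hV' : ∀ t ∈ Ioo (0:ℝ) 1, g t ∉ P.V := fun t ht => by
    rcases le_or_gt t c with h | h
    · rw [← e t h]; exact hV t ht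
    · exact window_not_mem hi (hgW t ⟨h.le, ht.2⟩)
  have hpW : ∀ f : ℝ → ℂ, (∀ t ∈ Ico c 1, f t ∈ P.Window i τ) → ∀ t ∈ Ico c 1,
      push f t ∈ P.Window i τ := fun f hf t ht =>
    window_comb hi (hf t ht) (m_re t) (m_im t ht.2) (by linarith [(χm t).2]) (χm t).1 (by ring)
  refine ((main f hf hfW hf1 hV).trans' ?_).trans' (main g hg hgW hg1 hV').symm
  refine SHom.of_starConvex (S := P.Window i τ) (o := m c) (a := c) (b := b)
    (window_starConvex hi (m_re c) (m_im c hc1)) (Set.disjoint_left.2 fun z hz => window_not_mem hi hz)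
    (pc hf) (pc hg) hc (by linarith) (by linarith) ?_ ?_ ?_ ?_
  · intro t ht
    rcases le_or_gt t c with h | h
    · simp only [push, e t h]
    · have : b ≤ t := by by_contra hh; exact ht ⟨h, by linarith⟩
      simp [push, χ1 t this]
  · exact fun t ht => hpW f hfW t ⟨ht.1, by linarith [ht.2]⟩
  · exact fun t ht => hpW g hgW t ⟨ht.1, by linarith [ht.2]⟩
  · intro t ht
    rcases le_or_gt t c with h | h
    · simpa [push, χ0 t h] using hV t ht
    · exact window_not_mem hi (hpW f hfW t ⟨h.le, ht.2⟩)

lemma Real2.last (hf : Continuous f) {c : ℝ} {k : ℕ} {p v : Station} {L : List Station}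
    (h : P.Real2 f c k L [p, v]) (hs : p.1 = v.1) :
    ∃ g, Continuous g ∧ SHom P.V f g ∧ P.Real2 g c k L [v] := by
  obtain ⟨d, h0, hn, h1, h2, h5, hd, h3⟩ := h.right
  obtain ⟨h1', hn', h3', hv, h5', hv1⟩ := h3
  have hc0 := h.pos
  have hc1 : c < 1 := h.right.lt_one
  have ho : ∀ t, t ∉ Ioo c 1 → straighten f c 1 t = f t := fun t ht => straighten_of_notMem ht hc1
  have hvp : P.pt v = P.v p.1 := by simp [pt, hv, hs]
  have hin : ∀ t ∈ Ioo c 1, straighten f c 1 t ∈ P.slab k := fun t ht => by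
    obtain ⟨x, y, hx, hy, hxy, e⟩ := straighten_of_mem (f := f) ht
    rw [e]
    exact slab_comb_ray hn h1 h.mem (by rw [hv1, hvp]) hx hy.le hxy
  refine ⟨straighten f c 1, straighten_continuous hf hc1, ?_, ?_, ?_, ?_⟩
  · refine sHom_of_window hf (straighten_continuous hf hc1) hn h2 hc0.le hc1
      (fun t ht => (ho t fun g => by linarith [g.1]).symm) ?_ ?_ (by rw [hv1, hvp])
      (by rw [ho 1 (by simp), hv1, hvp]) h.not_mem
    · intro t ht
      rcases lt_trichotomy t d with g | g | g
      · rcases ht.1.eq_or_lt with g' | g'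
        · rw [← g']; exact slab_subset_window h1 h.mem
        · exact slab_subset_window h1 (h5 t ⟨g', g⟩)
      · rw [g, hd]; exact Or.inr ⟨pt_re p, by rw [pt_im]; simpa using mul_self_pos.2 h2⟩
      · exact slab_subset_window (adj_opp h1) (h5' t ⟨g, ht.2⟩)
    · intro t ht
      rcases ht.1.eq_or_lt with g' | g'
      · rw [← g', ho c (by simp)]; exact slab_subset_window h1 h.mem
      · exact slab_subset_window h1 (hin t ⟨g', ht.2⟩)
  · rw [ho c (by simp)]; exact h.mem
  · refine h.left.congr fun t ht _ => (ho _ ?_).symm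
    exact fun g => by linarith [g.1]
  · refine ⟨hc1, hs ▸ hn, hs ▸ h1, hv, hin, ?_⟩
    rw [ho 1 (by simp), hv1]

/-- A curve whose two ends lie on a common line and which stays in a slab is a trivial loop. -/
lemma Real2.trivial (hf : Continuous f) {c : ℝ} {k : ℕ} {v w : Station}
    (h : P.Real2 f c k [v] [w]) (hs : v.1 = w.1) : Hom (Ico 0 1) P.V f (fun _ => f 0) := by
  obtain ⟨h1, hn, h3, hv, h5, hv1⟩ := h.left
  obtain ⟨h1', hn', h3', hv', h5', hv1'⟩ := h.right
  simp only [sub_self] at hv1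
  have e : f 1 = f 0 := by rw [hv1, hv1', Prod.ext hs (hv.trans hv'.symm)]
  refine Hom.linear hf continuous_const rfl e fun s hs t ht => ?_
  have ht' : f t ∈ P.slab k := by
    rcases lt_trichotomy t c with g | g | g
    · have := h5 (1 - t) ⟨by linarith, by linarith [ht.1]⟩
      simpa using this
    · rw [g]; exact h.mem
    · exact h5' t ⟨g, ht.2⟩
  exact slab_not_mem (slab_comb_ray hn h3 ht' (by rw [hv1, pt_re]) (by linarith [hs.2]) hs.1 (by ring))

end Pts

end SlabPath

namespace SlabPath

open Set

/-- The curve `f` is homotopic to a constant one. -/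
def TrivHom (V : Set ℂ) (f : ℝ → ℂ) : Prop := Hom (Ico 0 1) V f (fun _ => f 0)

lemma SHom.trivHom {V : Set ℂ} {f g : ℝ → ℂ} (h : SHom V f g) (hg : TrivHom V g) : TrivHom V f := by
  have e := h.left.1
  unfold TrivHom
  rw [e]
  exact SHom.trans (fun s hs h => ⟨by linarith, by linarith [hs.2]⟩) Ico_subset_Icc_self h hg

lemma SHom.refl_of {V : Set ℂ} {f : ℝ → ℂ} (hf : Continuous f) (hV : ∀ t ∈ Ioo (0:ℝ) 1, f t ∉ V) :
    SHom V f f :=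
  ⟨fun p => f p.2, by fun_prop, by simp, by simp, by simp, fun _ _ t ht => hV t ht⟩

lemma SHom.reverse_left {V : Set ℂ} {f g : ℝ → ℂ} (h : SHom V (fun t => f (1 - t)) g) :
    SHom V f fun t => g (1 - t) := by
  simpa using h.reverse

namespace Pts

variable {n : ℕ} {P : Pts n} {f g : ℝ → ℂ}

variable (P) in
/-- The curve `f` is homotopic to a curve with a tight itinerary, whose lifts are simulated by
those of the given itinerary. -/
def Reduces (f : ℝ → ℂ) (k : ℕ) (L R : List Station) : Prop :=
  ∃ g c k' L' R', Continuous g ∧ SHom P.V f g ∧ P.Real2 g c k' L' R' ∧ Simulates k L R k' L' R' ∧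
    Tight (wd L') ∧ Tight (wd R') ∧ ∀ a ∈ (wd L').head?, ∀ b ∈ (wd R').head?, TightRel a b

lemma Reduces.of_sHom {k k' : ℕ} {L R L' R' : List Station} (h : SHom P.V f g)
    (hs : Simulates k L R k' L' R') (hr : P.Reduces g k' L' R') : P.Reduces f k L R := by
  obtain ⟨g', c, k'', L'', R'', h1, h2, h3, h4, h5⟩ := hr
  exact ⟨g', c, k'', L'', R'', h1, h.trans' h2, h3, hs.trans h4, h5⟩

lemma Real2.shift' {c : ℝ} {k : ℕ} {L R : List Station} {q : Station}
    (h : P.Real2 f c k (q :: L) R) (hL : L ≠ []) :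
    ∃ c', P.Real2 f c' (opp q.1 k) L (q :: R) := by
  obtain ⟨c', _, h'⟩ := h.symm.shift hL
  exact ⟨_, h'.symm'⟩

lemma Real2.halfOk {c : ℝ} {k : ℕ} {L R : List Station} (h : P.Real2 f c k L R) :
    HalfOk k L ∧ HalfOk k R := ⟨h.left.halfOk, h.right.halfOk⟩

lemma side_eq_of_not_tightRel {p q : Station} (hp : p.2 ≠ 0) (hq : q.2 ≠ 0)
    (h : ¬ TightRel (side p) (side q)) : side p = side q := by
  simp only [TightRel, side, Classical.not_imp, not_lt] at h
  obtain ⟨h1, h2⟩ := h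
  refine Prod.ext h1 ?_
  simp only [side]
  rcases lt_or_gt_of_ne hp with a | a <;> rcases lt_or_gt_of_ne hq with b | b <;>
    simp [a, b, sign_neg, sign_pos] at h2 ⊢

lemma Real2.reduces {N : ℕ} : ∀ {f : ℝ → ℂ} {c : ℝ} {k : ℕ} {L R : List Station},
    2 * L.length + 3 * R.length ≤ N → Continuous f → ¬ TrivHom P.V f → P.Real2 f c k L R →
    Tight (wd L) → P.Reduces f k L R := by
  induction N with
  | zero =>
    intro f c k L R hN _ _ h
    have := h.left.ne_nil
    have : L.length ≠ 0 := by simpa using this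
    omega
  | succ N ih =>
    intro f c k L R hN hf ht h tL
    rcases L with _ | ⟨l, L⟩
    · exact absurd rfl h.left.ne_nil
    rcases R with _ | ⟨r, R⟩
    · exact absurd rfl h.right.ne_nil
    simp only [List.length_cons] at hN
    have hself := SHom.refl_of hf h.not_mem
    obtain ⟨oL, oR⟩ := h.halfOk
    by_cases hlr : TightRel (side l) (side r)
    · by_cases hR : R = []
      · subst hR
        exact ⟨f, c, k, l :: L, [r], hf, hself, h, .refl _ _ _, tL, by simp [Tight, wd],
          by simpa [wd] using hlr⟩
      · obtain ⟨c', _, h'⟩ := h.shift hR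
        refine .of_sHom hself (.shift ((halfOk_cons hR).1 oR).1 (by simp) hR)
          (ih ?_ hf ht h' ?_)
        · simp only [List.length_cons]; omega
        · exact List.isChain_cons_cons.2 ⟨hlr.symm, tL⟩
    · by_cases hL : L = []
      · subst hL
        have l0 : l.2 = 0 := oL.2
        have e : l.1 = r.1 := by
          by_contra e; exact hlr fun e' => absurd e' e
        by_cases hR : R = []
        · subst hR
          exact absurd (h.trivial hf e) ht
        · obtain ⟨c', _, h'⟩ := h.shift hR
          have oR' := (halfOk_cons hR).1 oR
          have h2 := h'.symm
          have o2 : HalfOk (opp r.1 k) [r, l] := h2.right.halfOk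
          obtain ⟨g, hg, hs, h3⟩ := h2.last (by fun_prop) e.symm
          have hs' := hs.reverse_left
          have h4 := h3.symm
          refine .of_sHom hs' ?_ (ih ?_ (by fun_prop) (fun g' => ht (hs'.trivHom g')) h4
            (by simp [Tight, wd]))
          · exact (Simulates.shift oR'.1 (by simp) hR).trans
              ((Simulates.symm _ _ _).trans ((Simulates.last o2 e.symm).trans (.symm _ _ _)))
          · simp only [List.length_cons, List.length_nil] at hN ⊢; omega
      · have oL' := (halfOk_cons hL).1 oL
        obtain ⟨c', h'⟩ := h.shift' hL
        have sim : Simulates k (l :: L) (r :: R) (opp l.1 k) L (l :: r :: R) :=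
          (Simulates.symm _ _ _).trans ((Simulates.shift oL'.1 (by simp) hL).trans (.symm _ _ _))
        have o2 := h'.right.halfOk
        have tL' : Tight (wd L) := List.IsChain.tail tL
        by_cases hR : R = []
        · subst hR
          have e : l.1 = r.1 := by
            by_contra e; exact hlr fun e' => absurd e' e
          obtain ⟨g, hg, hs, h3⟩ := h'.last hf e
          refine .of_sHom hs (sim.trans (Simulates.last o2 e)) (ih ?_ hg
            (fun g' => ht (hs.trivHom g')) h3 tL')
          simp only [List.length_cons, List.length_nil] at hN ⊢; omega
        · have e := side_eq_of_not_tightRel oL'.2.1 ((halfOk_cons hR).1 oR).2.1 hlr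
          obtain ⟨g, hg, hs, h3⟩ := h'.mid hf hR e
          refine .of_sHom hs (sim.trans (Simulates.mid o2 hR e)) (ih ?_ hg
            (fun g' => ht (hs.trivHom g')) h3 tL')
          omega

/-- Every realised itinerary can be started at its end. -/
lemma Real2.exists_singleton {R : List Station} : ∀ {c : ℝ} {k : ℕ} {L : List Station},
    P.Real2 f c k L R → ∃ c' k' v L', P.Real2 f c' k' L' [v] ∧ Simulates k L R k' L' [v] := by
  induction R with
  | nil => intro c k L h; exact absurd rfl h.right.ne_nil
  | cons r R ih =>
    intro c k L h
    by_cases hR : R = []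
    · subst hR; exact ⟨c, k, r, L, h, .refl _ _ _⟩
    · obtain ⟨c', _, h'⟩ := h.shift hR
      obtain ⟨c'', k', v, L', h1, h2⟩ := ih h'
      exact ⟨c'', k', v, L', h1,
        (Simulates.shift ((halfOk_cons hR).1 h.right.halfOk).1 h.left.ne_nil hR).trans h2⟩

/-- Every itinerary of a curve is simulating a tight one. -/
theorem Real2.exists_tight {c : ℝ} {k : ℕ} {L R : List Station} (hf : Continuous f)
    (ht : ¬ TrivHom P.V f) (h : P.Real2 f c k L R) : P.Reduces f k L R := by
  obtain ⟨c', k', v, L', h1, h2⟩ := h.symm.exists_singleton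
  have := Real2.reduces le_rfl hf ht h1.symm' (by simp [Tight, wd])
  exact .of_sHom (SHom.refl_of hf h.not_mem) ((Simulates.symm _ _ _).trans (h2.trans (.symm _ _ _)))
    this

end Pts

end SlabPath

namespace SlabPath

open Set

lemma exists_log {F : ℝ × ℝ → ℂ} (hF : Continuous F) (h0 : ∀ p, F p ≠ 0) :
    ∃ L : ℝ × ℝ → ℂ, Continuous L ∧ ∀ p, Complex.exp (L p) = F p := by
  obtain ⟨L, ⟨-, hL⟩, -⟩ := Complex.isCoveringMap_exp.existsUnique_continuousMap_lifts
    (⟨fun p => ⟨F p, h0 p⟩, by fun_prop⟩ : C(ℝ × ℝ, {z : ℂ // z ≠ 0})) (0, 0)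
    (Complex.log (F (0, 0))) (by ext; simpa using Complex.exp_log (h0 _))
  refine ⟨L, L.continuous, fun p => ?_⟩
  exact congrArg Subtype.val (congrFun hL p)

lemma log_sub_log {L : ℝ → ℂ} (hL : Continuous L) {u : ℂ} (hu : u ≠ 0)
    (h : ∀ t ∈ Icc (0:ℝ) 1, u * Complex.exp (L t) ∈ Complex.slitPlane) :
    L 1 - L 0 = Complex.log (u * Complex.exp (L 1)) - Complex.log (u * Complex.exp (L 0)) := by
  have := Complex.isCoveringMap_exp.eqOn_of_comp_eqOn (s := Icc (0:ℝ) 1) isPreconnected_Icc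
    (g₁ := L) (g₂ := fun t => Complex.log (u * Complex.exp (L t)) -
      Complex.log (u * Complex.exp (L 0)) + L 0) hL.continuousOn
    (by
      refine ContinuousOn.add (ContinuousOn.sub (ContinuousOn.clog ?_ h) continuousOn_const)
        continuousOn_const
      fun_prop)
    (by
      intro t _
      apply Subtype.ext
      have : ∀ z, u * Complex.exp z ≠ 0 := fun z => mul_ne_zero hu (Complex.exp_ne_zero _)
      simp only [Function.comp, Complex.exp_add, Complex.exp_sub, Complex.exp_log (this _)]
      field_simp [Complex.exp_ne_zero])
    (a := 0) (by simp) (by simp)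
  have := this (show (1:ℝ) ∈ Icc (0:ℝ) 1 by simp)
  simp only at this
  linear_combination this

lemma log_mul_I_of_pos {x : ℝ} (hx : 0 < x) :
    (Complex.log (Complex.I * x)).im = Real.pi / 2 ∧ (Complex.log (-Complex.I * x)).im = -(Real.pi / 2) := by
  rw [Complex.log_im, Complex.log_im, Complex.arg_mul_real hx, Complex.arg_mul_real hx]
  simp

lemma log_mul_I_of_neg {x : ℝ} (hx : x < 0) :
    (Complex.log (Complex.I * x)).im = -(Real.pi / 2) ∧ (Complex.log (-Complex.I * x)).im = Real.pi / 2 := by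
  have := log_mul_I_of_pos (neg_pos.2 hx)
  push_cast at this
  simpa [and_comm] using this

lemma upper_mem {z : ℂ} (hz : z ≠ 0) (h : 0 ≤ z.im) : -Complex.I * z ∈ Complex.slitPlane := by
  rw [Complex.mem_slitPlane_iff]
  rcases h.eq_or_lt with h | h
  · right
    intro h'
    exact hz (Complex.ext (by simpa using h') h.symm)
  · left; simpa using h

lemma lower_mem {z : ℂ} (hz : z ≠ 0) (h : z.im ≤ 0) : Complex.I * z ∈ Complex.slitPlane := by
  have := upper_mem (z := -z) (by simpa) (by simpa using h)
  simpa using this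

/-- Two curves in a closed half plane with interlaced endpoints meet. -/
theorem exists_meet_halfPlane {f g : ℝ → ℂ} (hf : ContinuousOn f (Icc 0 1))
    (hg : ContinuousOn g (Icc 0 1)) (hf0 : ∀ t ∈ Icc (0:ℝ) 1, 0 ≤ (f t).im)
    (hg0 : ∀ t ∈ Icc (0:ℝ) 1, 0 ≤ (g t).im) {a b c d : ℝ} (ha : f 0 = a) (hb : f 1 = b) (hc : g 0 = c)
    (hd : g 1 = d) (hac : a < c) (hcb : c < b) (hbd : b < d) :
    ∃ s ∈ Icc (0:ℝ) 1, ∃ t ∈ Icc (0:ℝ) 1, f s = g t := by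
  by_contra! hne
  let p : ℝ → ℝ := fun t => max 0 (min 1 t)
  have hp : ∀ t, p t ∈ Icc (0:ℝ) 1 := fun t => ⟨le_max_left _ _, max_le zero_le_one (min_le_left _ _)⟩
  have hpc : Continuous p := by fun_prop
  have p0 : p 0 = 0 := by simp [p]
  have p1 : p 1 = 1 := by simp [p]
  have hf' : Continuous fun t => f (p t) := hf.comp_continuous hpc hp
  have hg' : Continuous fun t => g (p t) := hg.comp_continuous hpc hp
  obtain ⟨L, hL, hLF⟩ := exists_log (F := fun q => f (p q.1) - g (p q.2))
    ((hf'.comp continuous_fst).sub (hg'.comp continuous_snd))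
    (fun q => sub_ne_zero.2 (hne _ (hp _) _ (hp _)))
  have hne' : ∀ s t, f (p s) - g (p t) ≠ 0 := fun s t => sub_ne_zero.2 (hne _ (hp _) _ (hp _))
  have e1 := log_sub_log (L := fun t => L (0, t)) (by fun_prop) Complex.I_ne_zero (fun t _ => by
    rw [hLF]; exact lower_mem (hne' _ _) (by simp [p0, ha, hg0 _ (hp t)]))
  have e2 := log_sub_log (L := fun t => L (1, t)) (by fun_prop) Complex.I_ne_zero (fun t _ => by
    rw [hLF]; exact lower_mem (hne' _ _) (by simp [p1, hb, hg0 _ (hp t)]))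
  have e3 := log_sub_log (L := fun t => L (t, 0)) (by fun_prop) (neg_ne_zero.2 Complex.I_ne_zero)
    (fun t _ => by rw [hLF]; exact upper_mem (hne' _ _) (by simp [p0, hc, hf0 _ (hp t)]))
  have e4 := log_sub_log (L := fun t => L (t, 1)) (by fun_prop) (neg_ne_zero.2 Complex.I_ne_zero)
    (fun t _ => by rw [hLF]; exact upper_mem (hne' _ _) (by simp [p1, hd, hf0 _ (hp t)]))
  simp only [hLF, p0, p1, ha, hb, hc, hd] at e1 e2 e3 e4
  have q1 := log_mul_I_of_neg (x := a - c) (by linarith)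
  have q2 := log_mul_I_of_neg (x := a - d) (by linarith)
  have q3 := log_mul_I_of_pos (x := b - c) (by linarith)
  have q4 := log_mul_I_of_neg (x := b - d) (by linarith)
  push_cast at q1 q2 q3 q4
  have i1 := congrArg Complex.im e1
  have i2 := congrArg Complex.im e2
  have i3 := congrArg Complex.im e3
  have i4 := congrArg Complex.im e4
  simp only [Complex.sub_im, q1, q2, q3, q4] at i1 i2 i3 i4
  have := Real.pi_pos
  linarith

/-- Two curves in a closed half plane with interlaced endpoints meet. -/
theorem exists_meet_of_interlaced {f g : ℝ → ℂ} {s s' t t' : ℝ} (hs : s ≤ s') (ht : t ≤ t')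
    (hf : ContinuousOn f (Icc s s')) (hg : ContinuousOn g (Icc t t'))
    (hf0 : ∀ x ∈ Icc s s', 0 ≤ (f x).im) (hg0 : ∀ x ∈ Icc t t', 0 ≤ (g x).im) {a b c d : ℝ}
    (ha : f s = a) (hb : f s' = b) (hc : g t = c) (hd : g t' = d)
    (h1 : a ≠ c) (h2 : a ≠ d) (h3 : b ≠ c) (h4 : b ≠ d)
    (hsum : (if c < a then 1 else 0) + (if d < a then 1 else 0) + (if c < b then 1 else 0) +
      (if d < b then 1 else 0) = (1 : ZMod 2)) :
    ∃ x ∈ Icc s s', ∃ y ∈ Icc t t', f x = g y := by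
  have fw : ∀ {x x' : ℝ}, x ≤ x' → ∀ r ∈ Icc (0:ℝ) 1, x + r * (x' - x) ∈ Icc x x' :=
    fun hx r hr => ⟨by nlinarith [hr.1], by nlinarith [hr.2]⟩
  have bw : ∀ {x x' : ℝ}, x ≤ x' → ∀ r ∈ Icc (0:ℝ) 1, x' + r * (x - x') ∈ Icc x x' :=
    fun hx r hr => ⟨by nlinarith [hr.2], by nlinarith [hr.1]⟩
  have main : ∀ {f g : ℝ → ℂ} {s s' t t' : ℝ} (u v : ℝ → ℝ), Continuous u → Continuous v →
      ContinuousOn f (Icc s s') → ContinuousOn g (Icc t t') →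
      (∀ x ∈ Icc s s', 0 ≤ (f x).im) → (∀ x ∈ Icc t t', 0 ≤ (g x).im) →
      (∀ r ∈ Icc (0:ℝ) 1, u r ∈ Icc s s') → (∀ r ∈ Icc (0:ℝ) 1, v r ∈ Icc t t') →
      ∀ {a b c d : ℝ}, f (u 0) = a → f (u 1) = b → g (v 0) = c → g (v 1) = d → a < c → c < b →
        b < d → ∃ x ∈ Icc s s', ∃ y ∈ Icc t t', f x = g y := by
    intro f g s s' t t' u v hu hv hf hg hf0 hg0 hus hvt a b c d ha hb hc hd h1 h2 h3
    obtain ⟨x, hx, y, hy, e⟩ := exists_meet_halfPlane (f := fun r => f (u r)) (g := fun r => g (v r))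
      (hf.comp hu.continuousOn hus) (hg.comp hv.continuousOn hvt) (fun r hr => hf0 _ (hus r hr))
      (fun r hr => hg0 _ (hvt r hr)) ha hb hc hd h1 h2 h3
    exact ⟨_, hus x hx, _, hvt y hy, e⟩
  have main' : ∀ {f g : ℝ → ℂ} {s s' t t' : ℝ}, s ≤ s' → t ≤ t' →
      ContinuousOn f (Icc s s') → ContinuousOn g (Icc t t') →
      (∀ x ∈ Icc s s', 0 ≤ (f x).im) → (∀ x ∈ Icc t t', 0 ≤ (g x).im) →
      ∀ {a b c d : ℝ}, f s = a → f s' = b → g t = c → g t' = d →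
      ((a < c ∧ c < b ∧ b < d) ∨ (a < d ∧ d < b ∧ b < c) ∨ (b < c ∧ c < a ∧ a < d) ∨
        (b < d ∧ d < a ∧ a < c)) → ∃ x ∈ Icc s s', ∃ y ∈ Icc t t', f x = g y := by
    intro f g s s' t t' hs ht hf hg hf0 hg0 a b c d ha hb hc hd h
    rcases h with ⟨h1, h2, h3⟩ | ⟨h1, h2, h3⟩ | ⟨h1, h2, h3⟩ | ⟨h1, h2, h3⟩
    · exact main (fun r => s + r * (s' - s)) (fun r => t + r * (t' - t)) (by fun_prop) (by fun_prop)
        hf hg hf0 hg0 (fw hs) (fw ht) (by simpa using ha) (by simpa using hb) (by simpa using hc)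
        (by simpa using hd) h1 h2 h3
    · exact main (fun r => s + r * (s' - s)) (fun r => t' + r * (t - t')) (by fun_prop) (by fun_prop)
        hf hg hf0 hg0 (fw hs) (bw ht) (by simpa using ha) (by simpa using hb) (by simpa using hd)
        (by simpa using hc) h1 h2 h3
    · exact main (fun r => s' + r * (s - s')) (fun r => t + r * (t' - t)) (by fun_prop) (by fun_prop)
        hf hg hf0 hg0 (bw hs) (fw ht) (by simpa using hb) (by simpa using ha) (by simpa using hc)
        (by simpa using hd) h1 h2 h3
    · exact main (fun r => s' + r * (s - s')) (fun r => t' + r * (t - t')) (by fun_prop) (by fun_prop)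
        hf hg hf0 hg0 (bw hs) (bw ht) (by simpa using hb) (by simpa using ha) (by simpa using hd)
        (by simpa using hc) h1 h2 h3
  have key : ((a < c ∧ c < b ∧ b < d) ∨ (a < d ∧ d < b ∧ b < c) ∨ (b < c ∧ c < a ∧ a < d) ∨
      (b < d ∧ d < a ∧ a < c)) ∨ ((c < a ∧ a < d ∧ d < b) ∨ (c < b ∧ b < d ∧ d < a) ∨
      (d < a ∧ a < c ∧ c < b) ∨ (d < b ∧ b < c ∧ c < a)) := by
    rcases lt_or_gt_of_ne h1 with h1 | h1 <;> rcases lt_or_gt_of_ne h2 with h2 | h2 <;>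
      rcases lt_or_gt_of_ne h3 with h3 | h3 <;> rcases lt_or_gt_of_ne h4 with h4 | h4 <;>
      simp only [h1, h2, h3, h4, h1.not_gt, h2.not_gt, h3.not_gt, h4.not_gt, if_true, if_false] at hsum <;>
      first
      | exact absurd hsum (by decide)
      | grind
  rcases key with h | h
  · exact main' hs ht hf hg hf0 hg0 ha hb hc hd h
  · obtain ⟨x, hx, y, hy, e⟩ := main' ht hs hg hf hg0 hf0 hc hd ha hb h
    exact ⟨y, hy, x, hx, e.symm⟩

end SlabPath

namespace SlabPath

open Set

namespace Pts

variable {n : ℕ} (P : Pts n)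

def cslab (k : ℕ) : Set ℂ :=
  {z | (∀ i < n, i < k → (P.v i).re ≤ z.re) ∧ ∀ i < n, k ≤ i → z.re ≤ (P.v i).re}

variable {P}

lemma slab_subset_cslab {k : ℕ} : P.slab k ⊆ P.cslab k :=
  fun _ h => ⟨fun i hi hk => (h.1 i hi hk).le, fun i hi hk => (h.2 i hi hk).le⟩

lemma pt_mem_cslab {k : ℕ} {q : Station} (hq : q.1 < n) (h : Adj k q.1) : P.pt q ∈ P.cslab k :=
  closure_of_adj hq h (pt_re q)

/-- A closed slab can be mapped to a closed half plane. -/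
lemma exists_flat (k : ℕ) (hn : 0 < n) (hk : k ≤ n) : ∃ Ψ : ℂ → ℂ, Continuous Ψ ∧
    (∀ z ∈ P.cslab k, 0 ≤ (Ψ z).im) ∧ InjOn Ψ (P.cslab k) ∧
    (∀ a : Station, a.1 < n → Adj k a.1 → (Ψ (P.pt a)).im = 0) ∧
    ∀ a c : Station, a.1 < n → c.1 < n → Adj k a.1 → Adj k c.1 →
      beta k a c = if (Ψ (P.pt c)).re < (Ψ (P.pt a)).re then 1 else 0 := by
  rcases Nat.eq_zero_or_pos k with rfl | hk0
  · have h0 : ∀ a : Station, Adj 0 a.1 → a.1 = 0 := fun a h => by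
      rcases h with h | h <;> omega
    refine ⟨fun z => -Complex.I * (z - P.v 0), by fun_prop, ?_, ?_, ?_, ?_⟩
    · intro z hz
      simpa using hz.2 0 hn le_rfl
    · intro z _ w _ e
      simpa using e
    · intro a _ h
      simp [pt, h0 a h]
    · intro a c _ _ ha hc
      simp [beta, pt, h0 a ha, h0 c hc]
  rcases hk.eq_or_lt with rfl | hkn
  · have h0 : ∀ a : Station, a.1 < k → Adj k a.1 → a.1 = k - 1 := fun a h' h => by
      rcases h with h | h <;> omega
    refine ⟨fun z => Complex.I * (z - P.v (k - 1)), by fun_prop, ?_, ?_, ?_, ?_⟩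
    · intro z hz
      simpa using hz.1 (k - 1) (by omega) (by omega)
    · intro z _ w _ e
      simpa using e
    · intro a h' h
      simp [pt, h0 a h' h]
    · intro a c ha' hc' ha hc
      have : k - 1 ≠ k := by omega
      simp [beta, pt, h0 a ha' ha, h0 c hc' hc, this]
  · set x := (P.v (k - 1)).re with hx
    set y := (P.v k).re with hy
    have hxy : x < y := P.mono _ _ (by omega) hkn
    have hw : 0 < y - x := by linarith
    have h0 : ∀ a : Station, Adj k a.1 → a.1 = k - 1 ∨ a.1 = k := fun a h => by
      rcases h with h | h <;> omega
    let Λ : ℂ → ℂ := fun z => ((Real.pi / (y - x) : ℝ) : ℂ) * Complex.I * (z - x)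
    have Λre : ∀ z, (Λ z).re = -(Real.pi / (y - x) * z.im) := fun z => by
      simp only [Λ, mul_assoc, Complex.re_ofReal_mul]; simp
    have Λim : ∀ z, (Λ z).im = Real.pi / (y - x) * (z.re - x) := fun z => by
      simp only [Λ, mul_assoc, Complex.im_ofReal_mul]; simp
    have hπ : 0 < Real.pi / (y - x) := div_pos Real.pi_pos hw
    have hcs : ∀ z ∈ P.cslab k, x ≤ z.re ∧ z.re ≤ y := fun z hz =>
      ⟨hz.1 (k - 1) (by omega) (by omega), hz.2 k hkn le_rfl⟩
    have him : ∀ z ∈ P.cslab k, 0 ≤ (Λ z).im ∧ (Λ z).im ≤ Real.pi := fun z hz => by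
      rw [Λim]
      obtain ⟨h1, h2⟩ := hcs z hz
      refine ⟨by have : 0 ≤ z.re - x := by linarith
                 positivity, ?_⟩
      calc Real.pi / (y - x) * (z.re - x) ≤ Real.pi / (y - x) * (y - x) := by gcongr
        _ = Real.pi := by field_simp
    have imL : ∀ a : Station, a.1 = k - 1 → (Λ (P.pt a)).im = 0 := fun a h => by
      rw [Λim, pt_re, h, ← hx]; simp
    have imR : ∀ a : Station, a.1 = k → (Λ (P.pt a)).im = Real.pi := fun a h => by
      rw [Λim, pt_re, h, ← hy]; field_simp
    have reL : ∀ a : Station, a.1 = k - 1 →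
        (Complex.exp (Λ (P.pt a))).re = Real.exp (-(Real.pi / (y - x) * ((P.v (k - 1)).im + a.2))) := by
      intro a h
      rw [Complex.exp_re, imL a h, Real.cos_zero, mul_one, Λre, pt_im, h]
    have reR : ∀ a : Station, a.1 = k →
        (Complex.exp (Λ (P.pt a))).re = -Real.exp (-(Real.pi / (y - x) * ((P.v k).im + a.2))) := by
      intro a h
      rw [Complex.exp_re, imR a h, Real.cos_pi, Λre, pt_im, h]; ring
    refine ⟨fun z => Complex.exp (Λ z), by fun_prop, ?_, ?_, ?_, ?_⟩
    · intro z hz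
      rw [Complex.exp_im]
      exact mul_nonneg (Real.exp_pos _).le (Real.sin_nonneg_of_nonneg_of_le_pi (him z hz).1 (him z hz).2)
    · intro z hz w hw' e
      obtain ⟨a1, a2⟩ := him z hz
      obtain ⟨b1, b2⟩ := him w hw'
      obtain ⟨m, hm⟩ := Complex.exp_eq_exp_iff_exists_int.1 e
      have hm' := congrArg Complex.im hm
      simp at hm'
      have hpi := Real.pi_pos
      have m0 : m = 0 := by
        have l1 : (m:ℝ) < 1 := by
          by_contra! h
          nlinarith
        have l2 : (-1:ℝ) < m := by
          by_contra! h
          nlinarith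
        have l1' : m < 1 := by exact_mod_cast l1
        have l2' : -1 < m := by exact_mod_cast l2
        omega
      rw [m0] at hm
      simp only [Int.cast_zero, zero_mul, add_zero, Λ] at hm
      have hne : ((Real.pi / (y - x) : ℝ) : ℂ) * Complex.I ≠ 0 :=
        mul_ne_zero (by exact_mod_cast hπ.ne') Complex.I_ne_zero
      simpa using mul_left_cancel₀ hne hm
    · intro a ha h
      rw [Complex.exp_im]
      rcases h0 a h with h | h
      · simp [imL a h]
      · simp [imR a h]
    · intro a c _ _ ha hc
      have hk1 : k - 1 ≠ k := by omega
      have hk2 : ¬ k < k - 1 := by omega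
      have hk3 : k - 1 < k := by omega
      rcases h0 a ha with ha | ha <;> rcases h0 c hc with hc | hc
      · rw [reL a ha, reL c hc]
        have : (-(Real.pi / (y - x) * ((P.v (k - 1)).im + c.2)) <
          -(Real.pi / (y - x) * ((P.v (k - 1)).im + a.2))) ↔ a.2 < c.2 := by
          rw [neg_lt_neg_iff, mul_lt_mul_iff_right₀ hπ]; simp
        simp [beta, ha, hc, hk1, Real.exp_lt_exp, this]
      · rw [reL a ha, reR c hc, if_pos (by have := Real.exp_pos; linarith [this (-(Real.pi / (y - x) * ((P.v k).im + c.2))), this (-(Real.pi / (y - x) * ((P.v (k - 1)).im + a.2)))])]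
        simp [beta, ha, hc, hk3]
      · rw [reR a ha, reL c hc, if_neg (by have := Real.exp_pos; linarith [this (-(Real.pi / (y - x) * ((P.v k).im + a.2))), this (-(Real.pi / (y - x) * ((P.v (k - 1)).im + c.2)))])]
        simp [beta, ha, hc, hk1.symm, hk2]
      · rw [reR a ha, reR c hc]
        have : (-(Real.pi / (y - x) * ((P.v k).im + a.2)) <
          -(Real.pi / (y - x) * ((P.v k).im + c.2))) ↔ c.2 < a.2 := by
          rw [neg_lt_neg_iff, mul_lt_mul_iff_right₀ hπ]; simp
        simp [beta, ha, hc, Real.exp_lt_exp, this]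

/-- Curves crossing a slab with interlaced ends meet. -/
theorem exists_meet_slab {f g : ℝ → ℂ} (hf : Continuous f) (hg : Continuous g) {k : ℕ}
    {s s' t t' : ℝ} (hs : s < s') (ht : t < t') {a b c d : Station}
    (ha : a.1 < n) (hb : b.1 < n) (hc : c.1 < n) (hd : d.1 < n)
    (aa : Adj k a.1) (ab : Adj k b.1) (ac : Adj k c.1) (ad : Adj k d.1)
    (fa : f s = P.pt a) (fb : f s' = P.pt b) (gc : g t = P.pt c) (gd : g t' = P.pt d)
    (hfs : ∀ x ∈ Ioo s s', f x ∈ P.slab k) (hgs : ∀ x ∈ Ioo t t', g x ∈ P.slab k)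
    (hsum : beta k a c + beta k a d + beta k b c + beta k b d = 1) :
    ∃ x ∈ Icc s s', ∃ y ∈ Icc t t', f x = g y := by
  have hkn : k ≤ n := by rcases aa with h | h <;> omega
  obtain ⟨Ψ, h1, h2, h3, h4, h5⟩ := P.exists_flat k (by omega) hkn
  by_cases e1 : f s = g t
  · exact ⟨s, ⟨le_rfl, hs.le⟩, t, ⟨le_rfl, ht.le⟩, e1⟩
  by_cases e2 : f s = g t'
  · exact ⟨s, ⟨le_rfl, hs.le⟩, t', ⟨ht.le, le_rfl⟩, e2⟩
  by_cases e3 : f s' = g t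
  · exact ⟨s', ⟨hs.le, le_rfl⟩, t, ⟨le_rfl, ht.le⟩, e3⟩
  by_cases e4 : f s' = g t'
  · exact ⟨s', ⟨hs.le, le_rfl⟩, t', ⟨ht.le, le_rfl⟩, e4⟩
  have cmem : ∀ {f : ℝ → ℂ} {s s' : ℝ} {a b : Station}, a.1 < n → b.1 < n → Adj k a.1 → Adj k b.1 →
      f s = P.pt a → f s' = P.pt b → (∀ x ∈ Ioo s s', f x ∈ P.slab k) →
      ∀ x ∈ Icc s s', f x ∈ P.cslab k := by
    intro f s s' a b ha hb aa ab fa fb h x hx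
    rcases hx.1.eq_or_lt with e | e
    · rw [← e, fa]; exact pt_mem_cslab ha aa
    rcases hx.2.eq_or_lt with e' | e'
    · rw [e', fb]; exact pt_mem_cslab hb ab
    · exact slab_subset_cslab (h x ⟨e, e'⟩)
  have mf := cmem ha hb aa ab fa fb hfs
  have mg := cmem hc hd ac ad gc gd hgs
  have pc : ∀ {a : Station}, a.1 < n → Adj k a.1 → P.pt a ∈ P.cslab k := fun h h' => pt_mem_cslab h h'
  have real : ∀ {a : Station}, a.1 < n → Adj k a.1 → Ψ (P.pt a) = ((Ψ (P.pt a)).re : ℂ) :=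
    fun h h' => Complex.ext rfl (by simpa using h4 _ h h')
  have ne : ∀ {a c : Station}, a.1 < n → Adj k a.1 → c.1 < n → Adj k c.1 → P.pt a ≠ P.pt c →
      (Ψ (P.pt a)).re ≠ (Ψ (P.pt c)).re := fun ha aa hc ac hne e =>
    hne (h3 (pc ha aa) (pc hc ac) (by rw [real ha aa, real hc ac, e]))
  rw [fa, gc] at e1
  rw [fa, gd] at e2
  rw [fb, gc] at e3
  rw [fb, gd] at e4
  rw [h5 _ _ ha hc aa ac, h5 _ _ ha hd aa ad, h5 _ _ hb hc ab ac, h5 _ _ hb hd ab ad] at hsum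
  obtain ⟨x, hx, y, hy, e⟩ := exists_meet_of_interlaced (f := fun t => Ψ (f t)) (g := fun t => Ψ (g t))
    hs.le ht.le (by fun_prop) (by fun_prop) (fun x hx => h2 _ (mf x hx)) (fun x hx => h2 _ (mg x hx))
    (by rw [fa]; exact real ha aa) (by rw [fb]; exact real hb ab) (by rw [gc]; exact real hc ac)
    (by rw [gd]; exact real hd ad) (ne ha aa hc ac e1) (ne ha aa hd ad e2) (ne hb ab hc ac e3)
    (ne hb ab hd ad e4) hsum
  exact ⟨x, hx, y, hy, h3 (mf x hx) (mg y hy) e⟩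

end Pts

end SlabPath

namespace SlabPath

open Set

lemma inter_sum_left {ι : Type*} (S : Finset ι) (u : ι → Multiset Inc) (Q : Multiset Inc) :
    inter (∑ i ∈ S, u i) Q = ∑ i ∈ S, inter (u i) Q := by
  classical
  induction S using Finset.induction_on with
  | empty => simp [inter]
  | insert a S ha ih => rw [Finset.sum_insert ha, Finset.sum_insert ha, inter_add_left, ih]

lemma inter_sum_right {ι : Type*} (S : Finset ι) (u : ι → Multiset Inc) (Q : Multiset Inc) :
    inter Q (∑ i ∈ S, u i) = ∑ i ∈ S, inter Q (u i) := by
  classical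
  induction S using Finset.induction_on with
  | empty => simp [inter]
  | insert a S ha ih => rw [Finset.sum_insert ha, Finset.sum_insert ha, inter_add_right, ih]

namespace Pts

variable {n : ℕ} (P : Pts n)

/-- A curve between two vertices, cut at the times when it meets the vertical lines. -/
structure Track (f : ℝ → ℂ) where
  M : ℕ
  d : ℕ → ℝ
  q : ℕ → Station
  k : ℕ → ℕ
  d_zero : d 0 = 0
  d_last : d (M + 1) = 1
  d_lt : ∀ i ≤ M, d i < d (i + 1)
  q_lt : ∀ i ≤ M + 1, (q i).1 < n
  adj : ∀ i ≤ M, Adj (k i) (q i).1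
  adj' : ∀ i ≤ M, Adj (k i) (q (i + 1)).1
  k_succ : ∀ i < M, k (i + 1) = opp (q (i + 1)).1 (k i)
  slab : ∀ i ≤ M, ∀ t ∈ Ioo (d i) (d (i + 1)), f t ∈ P.slab (k i)
  eq_pt : ∀ i ≤ M + 1, f (d i) = P.pt (q i)
  q_zero : (q 0).2 = 0
  q_last : (q (M + 1)).2 = 0
  q_ne : ∀ i, 0 < i → i ≤ M → (q i).2 ≠ 0

variable {P} {f g : ℝ → ℂ}

namespace Track

variable (A : P.Track f) (B : P.Track g)

/-- The stations of a track from the `i`-th piece on, `m + 1` of them. -/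
def tl (q : ℕ → Station) : ℕ → ℕ → List Station
  | i, 0 => [q (i + 1)]
  | i, m + 1 => q (i + 1) :: tl q (i + 1) m

lemma tl_ne_nil (q : ℕ → Station) (i m : ℕ) : tl q i m ≠ [] := by
  cases m <;> simp [tl]

/-- The lift of a track to the tree of slabs. -/
noncomputable def node (s : List Side) : ℕ → Node
  | 0 => (A.k 0, s)
  | i + 1 => step (A.q (i + 1)) (node s i)

lemma node_fst (s : List Side) : ∀ i ≤ A.M, (A.node s i).1 = A.k i
  | 0, _ => rfl
  | i + 1, h => by
    rw [A.k_succ i (by omega), ← node_fst s i (by omega)]; rfl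

lemma node_red {s : List Side} (hs : Reduced s) : ∀ i, Reduced (A.node s i).2
  | 0 => hs
  | i + 1 => (node_red hs i).toggle _

lemma half_eq (s : List Side) : ∀ m i, i + m = A.M →
    {(A.node s i, A.q i)} + half (A.node s i) (tl A.q i m) =
      ∑ j ∈ Finset.range (m + 1), {(A.node s (i + j), A.q (i + j)), (A.node s (i + j), A.q (i + j + 1))}
  | 0, i, _ => by simp [tl, half]
  | m + 1, i, h => by
    have ih := half_eq s m (i + 1) (by omega)
    rw [Finset.sum_range_succ']
    have e : ∀ j, i + (j + 1) = i + 1 + j := fun j => by omega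
    rw [Finset.sum_congr rfl fun j _ => by rw [e j], ← ih]
    rw [tl, half_cons (tl_ne_nil _ _ _)]
    simp only [add_zero]
    change _ = {(step (A.q (i + 1)) (A.node s i), A.q (i + 1))} +
      half (step (A.q (i + 1)) (A.node s i)) (tl A.q (i + 1) m) + _
    rw [← Multiset.singleton_add, ← Multiset.singleton_add, Multiset.insert_eq_cons,
      ← Multiset.singleton_add]
    abel

lemma incs_eq (s : List Side) : incs (A.k 0, s) [A.q 0] (tl A.q 0 A.M) =
    ∑ i ∈ Finset.range (A.M + 1), {(A.node s i, A.q i), (A.node s i, A.q (i + 1))} := by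
  have := A.half_eq s A.M 0 (by omega)
  simp only [zero_add] at this
  rw [← this]
  rfl

lemma mem_incs {s : List Side} {x : Inc} : x ∈ incs (A.k 0, s) [A.q 0] (tl A.q 0 A.M) ↔
    ∃ i ≤ A.M, x = (A.node s i, A.q i) ∨ x = (A.node s i, A.q (i + 1)) := by
  rw [incs_eq, Multiset.mem_sum]
  simp

lemma d_le : ∀ {i j : ℕ}, i ≤ j → j ≤ A.M + 1 → A.d i ≤ A.d j := by
  intro i j h
  induction j, h using Nat.le_induction with
  | base => intro _; exact le_rfl
  | succ j _ ih => intro h; exact (ih (by omega)).trans (A.d_lt j (by omega)).le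

lemma d_lt' {i j : ℕ} (h : i < j) (hj : j ≤ A.M + 1) : A.d i < A.d j :=
  (A.d_lt i (by omega)).trans_le (A.d_le h hj)

lemma d_mem {i : ℕ} (h : 0 < i) (h' : i ≤ A.M) : A.d i ∈ Ioo (0:ℝ) 1 := by
  constructor
  · rw [← A.d_zero]; exact A.d_lt' h (by omega)
  · rw [← A.d_last]; exact A.d_lt' (by omega) le_rfl

lemma realF : ∀ m i, i + m = A.M → ∀ c, A.d i ≤ c → c < A.d (i + 1) →
    P.RealF f c (A.k i) (tl A.q i m)
  | 0, i, h, c, h1, h2 => by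
    obtain rfl : i = A.M := by omega
    have := A.d_last
    refine ⟨by linarith, A.q_lt _ le_rfl, A.adj' _ le_rfl, A.q_last, fun t ht => ?_, ?_⟩
    · exact A.slab _ le_rfl t ⟨by linarith [ht.1], by linarith [ht.2]⟩
    · rw [← A.eq_pt _ le_rfl, A.d_last]
  | m + 1, i, h, c, h1, h2 => by
    rw [tl, realF_cons (tl_ne_nil _ _ _)]
    refine ⟨A.d (i + 1), h2, A.q_lt _ (by omega), A.adj' _ (by omega), A.q_ne _ (by omega) (by omega),
      fun t ht => A.slab i (by omega) t ⟨by linarith [ht.1], ht.2⟩, A.eq_pt _ (by omega), ?_⟩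
    rw [← A.k_succ i (by omega)]
    exact realF m (i + 1) (by omega) _ le_rfl (A.d_lt _ (by omega))

lemma real2 : ∃ c, P.Real2 f c (A.k 0) [A.q 0] (tl A.q 0 A.M) := by
  have h0 := A.d_lt 0 (by omega)
  have h1 := A.d_le (i := 1) (j := A.M + 1) (by omega) le_rfl
  rw [A.d_zero] at h0
  rw [A.d_last] at h1
  have hs : ∀ t, 0 < t → t < A.d (0 + 1) → f t ∈ P.slab (A.k 0) := fun t h h' =>
    A.slab 0 (by omega) t ⟨by rwa [A.d_zero], h'⟩
  refine ⟨A.d 1 / 2, hs _ (by simpa using h0) (by simp at *; linarith), ⟨?_, A.q_lt _ (by omega), A.adj _ (by omega),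
    A.q_zero, fun t ht => hs _ (by linarith [ht.2]) ?_, ?_⟩, ?_⟩
  · simp at *; linarith
  · have := ht.1; simp at *; linarith
  · rw [← A.eq_pt _ (by omega), A.d_zero]; simp
  · exact A.realF A.M 0 (by omega) _ (by rw [A.d_zero]; simp at *; linarith) (by simp at *; linarith)

lemma halfOk : HalfOk (A.k 0) (tl A.q 0 A.M) := A.real2.choose_spec.right.halfOk

lemma halfOk' : HalfOk (A.k 0) [A.q 0] := A.real2.choose_spec.left.halfOk

lemma interior_not_mem {f : ℝ → ℂ} (A : P.Track f) {t : ℝ} (ht : t ∈ Ioo (0:ℝ) 1) : f t ∉ P.V := Real2.not_mem A.real2.choose_spec t ht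

lemma end_cases {i : ℕ} (hi : i ≤ A.M) {t : ℝ} (ht : t ∈ Icc (A.d i) (A.d (i + 1)))
    (hV : f t ∈ P.V) : ∃ j, (j = i ∨ j = i + 1) ∧ (A.q j).2 = 0 ∧ f t = P.pt (A.q j) := by
  have h0 : 0 ≤ t := by rw [← A.d_zero]; exact (A.d_le (by omega) (by omega)).trans ht.1
  have h1 : t ≤ 1 := by rw [← A.d_last]; exact ht.2.trans (A.d_le (by omega) (by omega))
  rcases h0.eq_or_lt with e | e
  · have : i = 0 := by
      by_contra h
      have := (A.d_mem (i := i) (by omega) hi).1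
      linarith [ht.1]
    subst this
    exact ⟨0, Or.inl rfl, A.q_zero, by rw [← A.eq_pt _ (by omega), A.d_zero, e]⟩
  rcases h1.eq_or_lt with e' | e'
  · have : i = A.M := by
      by_contra h
      have := (A.d_mem (i := i + 1) (by omega) (by omega)).2
      linarith [ht.2]
    subst this
    exact ⟨A.M + 1, Or.inr rfl, A.q_last, by rw [← A.eq_pt _ le_rfl, A.d_last, e']⟩
  · exact absurd hV (A.interior_not_mem ⟨e, e'⟩)

lemma mem_incs_of {s : List Side} {i j : ℕ} (hi : i ≤ A.M) (hj : j = i ∨ j = i + 1) :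
    (A.node s i, A.q j) ∈ incs (A.k 0, s) [A.q 0] (tl A.q 0 A.M) := by
  rw [mem_incs]
  rcases hj with rfl | rfl
  · exact ⟨j, hi, Or.inl rfl⟩
  · exact ⟨i, hi, Or.inr rfl⟩

lemma exists_of_mem {s : List Side} {x : Inc} (hx : x ∈ incs (A.k 0, s) [A.q 0] (tl A.q 0 A.M)) :
    ∃ i ≤ A.M, ∃ j, (j = i ∨ j = i + 1) ∧ x = (A.node s i, A.q j) := by
  obtain ⟨i, hi, h | h⟩ := A.mem_incs.1 hx
  · exact ⟨i, hi, i, Or.inl rfl, h⟩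
  · exact ⟨i, hi, i + 1, Or.inr rfl, h⟩

/-- A combinatorial intersection of lifts comes from an intersection of the curves. -/
theorem exists_meet (hf : Continuous f) (hg : Continuous g) {s s' : List Side}
    (hap : ∀ x ∈ incs (A.k 0, s) [A.q 0] (tl A.q 0 A.M), ∀ y ∈ incs (B.k 0, s') [B.q 0] (tl B.q 0 B.M),
      x.2.2 = 0 → label x ≠ label y)
    (h : (∃ x ∈ incs (A.k 0, s) [A.q 0] (tl A.q 0 A.M), x ∈ incs (B.k 0, s') [B.q 0] (tl B.q 0 B.M) ∧
      x.2.2 ≠ 0) ∨ inter (incs (A.k 0, s) [A.q 0] (tl A.q 0 A.M))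
        (incs (B.k 0, s') [B.q 0] (tl B.q 0 B.M)) = 1) :
    ∃ i ≤ A.M, ∃ j ≤ B.M, A.node s i = B.node s' j ∧ ∃ t ∈ Ioo (0:ℝ) 1, ∃ t' ∈ Ioo (0:ℝ) 1,
      t ∈ Icc (A.d i) (A.d (i + 1)) ∧ t' ∈ Icc (B.d j) (B.d (j + 1)) ∧ f t = g t' := by
  suffices ∃ i ≤ A.M, ∃ j ≤ B.M, A.node s i = B.node s' j ∧ ∃ t t',
      t ∈ Icc (A.d i) (A.d (i + 1)) ∧ t' ∈ Icc (B.d j) (B.d (j + 1)) ∧ f t = g t' by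
    obtain ⟨i, hi, j, hj, hN, t, t', ht, ht', e⟩ := this
    have hV : f t ∉ P.V := by
      intro hV
      obtain ⟨a, ha, ha0, hap1⟩ := A.end_cases hi ht hV
      obtain ⟨b, hb, hb0, hbp⟩ := B.end_cases hj ht' (e ▸ hV)
      have hq : A.q a = B.q b := by
        rw [e, hbp] at hap1
        have := congrArg Complex.re hap1
        rw [pt_re, pt_re] at this
        have := re_inj (B.q_lt b (by omega)) (A.q_lt a (by omega)) this
        exact Prod.ext this.symm (by rw [ha0, hb0])
      refine hap _ (A.mem_incs_of hi ha) _ (B.mem_incs_of hj hb) ha0 ?_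
      rw [hN, hq]
    have mem : ∀ {f : ℝ → ℂ} (A : P.Track f) {i : ℕ} {t : ℝ}, i ≤ A.M → t ∈ Icc (A.d i) (A.d (i + 1)) →
        f t ∉ P.V → t ∈ Ioo (0:ℝ) 1 := by
      intro f A i t hi ht hV
      have h0 : 0 ≤ t := by rw [← A.d_zero]; exact (A.d_le (by omega) (by omega)).trans ht.1
      have h1 : t ≤ 1 := by rw [← A.d_last]; exact ht.2.trans (A.d_le (by omega) (by omega))
      constructor
      · refine h0.lt_of_ne fun e => hV ⟨(A.q 0).1, A.q_lt _ (by omega), ?_⟩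
        rw [← e, ← A.d_zero, A.eq_pt _ (by omega), pt, A.q_zero]; simp
      · refine h1.lt_of_ne fun e => hV ⟨(A.q (A.M + 1)).1, A.q_lt _ le_rfl, ?_⟩
        rw [e, ← A.d_last, A.eq_pt _ le_rfl, pt, A.q_last]; simp
    exact ⟨i, hi, j, hj, hN, t, mem A hi ht hV, t', mem B hj ht' (e ▸ hV), ht, ht', e⟩
  rcases h with ⟨x, hx, hx', h0⟩ | h
  · obtain ⟨i, hi, a, ha, rfl⟩ := A.exists_of_mem hx
    obtain ⟨j, hj, b, hb, e⟩ := B.exists_of_mem hx'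
    obtain ⟨e1, e2⟩ := Prod.ext_iff.1 e
    refine ⟨i, hi, j, hj, e1, A.d a, B.d b, ?_, ?_, ?_⟩
    · rcases ha with rfl | rfl
      · exact ⟨le_rfl, (A.d_lt _ hi).le⟩
      · exact ⟨(A.d_lt _ hi).le, le_rfl⟩
    · rcases hb with rfl | rfl
      · exact ⟨le_rfl, (B.d_lt _ hj).le⟩
      · exact ⟨(B.d_lt _ hj).le, le_rfl⟩
    · rw [A.eq_pt _ (by omega), B.eq_pt _ (by omega)]
      exact congrArg P.pt e2
  · rw [A.incs_eq, B.incs_eq, inter_sum_left] at h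
    obtain ⟨i, hi, h⟩ := Finset.exists_ne_zero_of_sum_ne_zero (h.trans_ne one_ne_zero)
    rw [inter_sum_right] at h
    obtain ⟨j, hj, h⟩ := Finset.exists_ne_zero_of_sum_ne_zero h
    rw [Finset.mem_range, Nat.lt_succ_iff] at hi hj
    have hN : A.node s i = B.node s' j := by
      by_contra hN
      refine h (inter_eq_zero ?_)
      simp [hN]
    have hk : B.k j = A.k i := by
      rw [← A.node_fst s i hi, ← B.node_fst s' j hj, hN]
    refine ⟨i, hi, j, hj, hN, ?_⟩
    have one : ∀ z : ZMod 2, z ≠ 0 → z = 1 := by decide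
    have h1 := one _ h
    simp only [inter, Multiset.insert_eq_cons, Multiset.map_cons, Multiset.map_singleton,
      Multiset.sum_cons, Multiset.sum_singleton, pair, hN, if_true, B.node_fst s' j hj] at h1
    obtain ⟨x, hx, y, hy, e⟩ := exists_meet_slab hf hg (A.d_lt i hi) (B.d_lt j hj) (A.q_lt i (by omega))
      (A.q_lt (i + 1) (by omega)) (B.q_lt j (by omega)) (B.q_lt (j + 1) (by omega)) (A.adj i hi)
      (A.adj' i hi) (hk ▸ B.adj j hj) (hk ▸ B.adj' j hj) (A.eq_pt i (by omega)) (A.eq_pt _ (by omega))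
      (B.eq_pt j (by omega)) (B.eq_pt _ (by omega)) (A.slab i hi) (hk ▸ B.slab j hj)
      (by rw [← h1, hk]; ring)
    exact ⟨x, y, hx, hy, e⟩

end Track

/-- Self-intersections of the curve are confined to convex sets without vertices. -/
def LocSimple (V : Set ℂ) (f : ℝ → ℂ) : Prop :=
  ∀ t₁ ∈ Ioo (0:ℝ) 1, ∀ t₂ ∈ Ioo (0:ℝ) 1, t₁ ≤ t₂ → f t₁ = f t₂ →
    ∃ C : Set ℂ, Convex ℝ C ∧ Disjoint C V ∧ f '' Icc t₁ t₂ ⊆ C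

/-- Move a word along the line of slabs to the slab `0`, crossing each line on the chosen side. -/
def moveZero (ρ : ℕ → Side) : ℕ → List Side → List Side
  | 0, s => s
  | k + 1, s => moveZero ρ k (toggle (ρ k) s)

lemma moveZero_inj (ρ : ℕ → Side) : ∀ (k : ℕ) {s s' : List Side}, Reduced s → Reduced s' →
    moveZero ρ k s = moveZero ρ k s' → s = s'
  | 0, _, _, _, _, h => h
  | k + 1, s, s', hs, hs', h => by
    have := moveZero_inj ρ k (hs.toggle _) (hs'.toggle _) h
    rw [← toggle_toggle hs (ρ k), this, toggle_toggle hs']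

lemma moveZero_toggle (ρ : ℕ → Side) {k l : ℕ} (h : Adj k l) {s : List Side} (hs : Reduced s) :
    moveZero ρ (opp l k) (toggle (ρ l) s) = moveZero ρ k s := by
  rcases h with rfl | rfl
  · have : opp l l = l + 1 := by unfold opp; omega
    rw [this, moveZero, toggle_toggle hs]
  · have : opp l (l + 1) = l := by unfold opp; omega
    rw [this, moveZero]

namespace Track

variable (A : P.Track f)

lemma eq_of_node_eq {s s' : List Side} (hs : Reduced s) (hs' : Reduced s') :
    ∀ i ≤ A.M, A.node s i = A.node s' i → s = s'
  | 0, _, h => (Prod.ext_iff.1 h).2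
  | i + 1, hi, h => by
    refine eq_of_node_eq hs hs' i (by omega) ?_
    have ok : ∀ {s}, Reduced s → Ok (A.node s i) (A.q (i + 1)) := fun hs =>
      ⟨by rw [A.node_fst _ i (by omega)]; exact A.adj' i (by omega), A.node_red hs i⟩
    rw [← step_step (ok hs), ← step_step (ok hs')]
    exact congrArg _ h

lemma eq_of_node_eq_of_le (hl : LocSimple P.V f) {s s' : List Side} (hs : Reduced s) (hs' : Reduced s')
    {i j : ℕ} (hij : i ≤ j) (hj : j ≤ A.M) (hN : A.node s i = A.node s' j) {t t' : ℝ}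
    (ht : t ∈ Ioo (0:ℝ) 1) (ht' : t' ∈ Ioo (0:ℝ) 1) (h1 : t ∈ Icc (A.d i) (A.d (i + 1)))
    (h2 : t' ∈ Icc (A.d j) (A.d (j + 1))) (e : f t = f t') : s = s' := by
  rcases hij.eq_or_lt with rfl | hij
  · exact A.eq_of_node_eq hs hs' i hj hN
  have hd := A.d_le (i := i + 1) (j := j) (by omega) (by omega)
  obtain ⟨C, hC, hCV, hfC⟩ := hl t ht t' ht' (h1.2.trans (hd.trans h2.1)) e
  have hq : ∀ a, i < a → a ≤ j → P.pt (A.q a) ∈ C := fun a h h' => by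
    rw [← A.eq_pt a (by omega)]
    exact hfC ⟨_, ⟨h1.2.trans (A.d_le (by omega) (by omega)), (A.d_le h' (by omega)).trans h2.1⟩, rfl⟩
  have key : ∀ a b, i < a → a ≤ j → i < b → b ≤ j → (A.q a).1 = (A.q b).1 → (A.q a).2 < 0 →
      0 < (A.q b).2 → False := by
    intro a b ha ha' hb hb' h h0 h0'
    refine Set.disjoint_left.1 hCV ?_ (show P.v (A.q a).1 ∈ P.V from ⟨_, A.q_lt a (by omega), rfl⟩)
    have := hC (hq a ha ha') (hq b hb hb') (a := (A.q b).2 / ((A.q b).2 - (A.q a).2))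
      (b := -(A.q a).2 / ((A.q b).2 - (A.q a).2)) (div_nonneg h0'.le (by linarith))
      (div_nonneg (by linarith) (by linarith)) (by rw [← add_div]; exact div_self (by linarith))
    convert this using 1
    have h3 : ((A.q b).2 : ℂ) - (A.q a).2 ≠ 0 := by
      rw [← Complex.ofReal_sub, Complex.ofReal_ne_zero]; linarith
    simp only [pt, ← h, Complex.real_smul, Complex.ofReal_div, Complex.ofReal_sub, Complex.ofReal_neg]
    field_simp
    ring
  have side_eq : ∀ a b, i < a → a ≤ j → i < b → b ≤ j → (A.q a).1 = (A.q b).1 →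
      side (A.q a) = side (A.q b) := by
    intro a b ha ha' hb hb' h
    refine Prod.ext h ?_
    have na := A.q_ne a (by omega) (by omega)
    have nb := A.q_ne b (by omega) (by omega)
    change SignType.sign (A.q a).2 = SignType.sign (A.q b).2
    rcases na.lt_or_gt with c | c <;> rcases nb.lt_or_gt with c' | c'
    · rw [sign_neg c, sign_neg c']
    · exact (key a b ha ha' hb hb' h c c').elim
    · exact (key b a hb hb' ha ha' h.symm c' c).elim
    · rw [sign_pos c, sign_pos c']
  classical
  let ρ : ℕ → Side := fun l => if h : ∃ a, i < a ∧ a ≤ j ∧ (A.q a).1 = l then side (A.q h.choose) else (l, 0)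
  have hρ : ∀ a, i < a → a ≤ j → ρ (A.q a).1 = side (A.q a) := by
    intro a ha ha'
    have h : ∃ b, i < b ∧ b ≤ j ∧ (A.q b).1 = (A.q a).1 := ⟨a, ha, ha', rfl⟩
    simp only [ρ, dif_pos h]
    exact side_eq _ _ h.choose_spec.1 h.choose_spec.2.1 ha ha' h.choose_spec.2.2
  have inv : ∀ l, i ≤ l → l ≤ j →
      moveZero ρ (A.k l) (A.node s' l).2 = moveZero ρ (A.k i) (A.node s' i).2 := by
    intro l hl
    induction l, hl using Nat.le_induction with
    | base => intro _; rfl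
    | succ l hl ih =>
      intro hlj
      rw [← ih (by omega), ← moveZero_toggle ρ (A.adj' l (by omega)) (A.node_red hs' l),
        hρ _ (by omega) hlj, A.k_succ l (by omega)]
      rfl
  have hk : A.k i = A.k j := by
    rw [← A.node_fst s i (by omega), hN, A.node_fst s' j hj]
  refine A.eq_of_node_eq hs hs' i (by omega) (Prod.ext ?_ (moveZero_inj ρ (A.k i) (A.node_red hs i)
    (A.node_red hs' i) ?_))
  · rw [A.node_fst _ i (by omega), A.node_fst _ i (by omega)]
  · rw [← inv j (by omega) le_rfl, hN, hk]

/-- Different lifts of a curve without essential self-intersections do not meet. -/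
theorem eq_of_locSimple (hl : LocSimple P.V f) {s s' : List Side} (hs : Reduced s) (hs' : Reduced s')
    {i j : ℕ} (hi : i ≤ A.M) (hj : j ≤ A.M) (hN : A.node s i = A.node s' j) {t t' : ℝ}
    (ht : t ∈ Ioo (0:ℝ) 1) (ht' : t' ∈ Ioo (0:ℝ) 1) (h1 : t ∈ Icc (A.d i) (A.d (i + 1)))
    (h2 : t' ∈ Icc (A.d j) (A.d (j + 1))) (e : f t = f t') : s = s' := by
  rcases le_total i j with h | h
  · exact A.eq_of_node_eq_of_le hl hs hs' h hj hN ht ht' h1 h2 e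
  · exact (A.eq_of_node_eq_of_le hl hs' hs h hi hN.symm ht' ht h2 h1 e.symm).symm

end Track

end Pts

end SlabPath

namespace SlabPath

open Set

namespace Pts

variable {n : ℕ} (P : Pts n)

/-- A curve between two vertices that meets the vertical lines finitely often and crosses them. -/
structure Transverse (f : ℝ → ℂ) : Prop where
  cont : Continuous f
  zero : f 0 ∈ P.V
  one : f 1 ∈ P.V
  not_mem : ∀ t ∈ Ioo (0:ℝ) 1, f t ∉ P.V
  fin : {t ∈ Ioo (0:ℝ) 1 | ∃ l < n, (f t).re = (P.v l).re}.Finite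
  cross : ∀ t ∈ Ioo (0:ℝ) 1, ∀ l < n, (f t).re = (P.v l).re → ∃ ε > 0, ∀ t₁ ∈ Ioo (t - ε) t,
    ∀ t₂ ∈ Ioo t (t + ε), ((f t₁).re - (P.v l).re) * ((f t₂).re - (P.v l).re) < 0

variable {P} {f : ℝ → ℂ}

lemma exists_slab {z : ℂ} (h : ∀ l < n, z.re ≠ (P.v l).re) : ∃ k ≤ n, z ∈ P.slab k := by
  classical
  by_cases h0 : ∃ k, k < n ∧ z.re < (P.v k).re
  · refine ⟨Nat.find h0, (Nat.find_spec h0).1.le, fun i hi hk => ?_, fun i hi hk => ?_⟩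
    · have := Nat.find_min h0 hk
      push Not at this
      exact (this hi).lt_of_ne (h i hi).symm
    · have := (Nat.find_spec h0).2
      rcases hk.eq_or_lt with e | e
      · rwa [e] at this
      · exact this.trans (P.mono _ _ e hi)
  · push Not at h0
    exact ⟨n, le_rfl, fun i hi _ => (h0 i hi).lt_of_ne (h i hi).symm, fun i hi hk => by omega⟩

lemma exists_slab_Ioo (hf : Continuous f) {a b : ℝ}
    (h : ∀ t ∈ Ioo a b, ∀ l < n, (f t).re ≠ (P.v l).re) : ∃ k ≤ n, ∀ t ∈ Ioo a b, f t ∈ P.slab k := by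
  rcases le_or_gt b a with hab | hab
  · exact ⟨0, Nat.zero_le _, fun t ht => absurd (ht.1.trans ht.2) (not_lt.2 hab)⟩
  have hm : (a + b) / 2 ∈ Ioo a b := ⟨by linarith, by linarith⟩
  obtain ⟨k, hkn, hk⟩ := exists_slab (h _ hm)
  have key : ∀ t ∈ Ioo a b, ∀ s ∈ Ioo a b, ∀ l < n, (f t).re < (P.v l).re → (f s).re < (P.v l).re := by
    intro t ht s hs l hl h1
    by_contra h2
    obtain ⟨u, hu, e⟩ := isPreconnected_Ioo.intermediate_value ht hs
      (Complex.continuous_re.comp hf).continuousOn ⟨h1.le, not_lt.1 h2⟩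
    exact h u hu l hl e
  refine ⟨k, hkn, fun t ht => ⟨fun i hi hik => ?_, fun i hi hik => key _ hm _ ht i hi (hk.2 i hi hik)⟩⟩
  refine lt_of_not_ge fun hle => ?_
  have := key _ ht _ hm i hi (hle.lt_of_ne (h t ht i hi))
  exact lt_asymm this (hk.1 i hi hik)

lemma adj_of_closure {k i : ℕ} (hk : k ≤ n) (hi : i < n) {z : ℂ} (hz : z.re = (P.v i).re) (h : z ∈ P.cslab k) :
    Adj k i := by
  unfold Adj
  have mono : ∀ {a b : ℕ}, a < n → b < n → (P.v a).re ≤ (P.v b).re → a ≤ b := fun ha hb h => by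
    by_contra c
    exact absurd (P.mono _ _ (not_le.1 c) ha) (not_lt.2 h)
  rcases lt_or_ge i k with c | c
  · right
    by_contra hne
    have h1 : i + 1 < k := by omega
    have := h.1 (i + 1) (by omega) h1
    rw [hz] at this
    have := mono (by omega) hi this
    omega
  · left
    have := h.2 k (by omega) le_rfl
    rw [hz] at this
    have := mono hi (by omega) this
    omega

lemma cslab_of_Ioo (hf : Continuous f) {a b : ℝ} (hab : a < b) {k : ℕ}
    (h : ∀ t ∈ Ioo a b, f t ∈ P.slab k) : ∀ t ∈ Icc a b, f t ∈ P.cslab k := by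
  have hc : IsClosed (P.cslab k) := by
    have : P.cslab k = (⋂ i, ⋂ (_ : i < n), ⋂ (_ : i < k), {z : ℂ | (P.v i).re ≤ z.re}) ∩
      ⋂ i, ⋂ (_ : i < n), ⋂ (_ : k ≤ i), {z : ℂ | z.re ≤ (P.v i).re} := by
      ext z; simp [cslab]
    rw [this]
    refine IsClosed.inter ?_ ?_
    · exact isClosed_iInter fun i => isClosed_iInter fun _ => isClosed_iInter fun _ =>
        isClosed_le continuous_const Complex.continuous_re
    · exact isClosed_iInter fun i => isClosed_iInter fun _ => isClosed_iInter fun _ =>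
        isClosed_le Complex.continuous_re continuous_const
  intro t ht
  have := closure_Ioo hab.ne ▸ ht
  exact closure_minimal (t := f ⁻¹' P.cslab k) (fun t ht => slab_subset_cslab (h t ht)) (hc.preimage hf) this

theorem Transverse.exists_track (h : P.Transverse f) : Nonempty (P.Track f) := by
  classical
  obtain ⟨H, hH⟩ : ∃ H : Finset ℝ, ∀ t, t ∈ H ↔ t ∈ Icc (0:ℝ) 1 ∧ ∃ l < n, (f t).re = (P.v l).re := by
    refine ⟨insert 0 (insert 1 h.fin.toFinset), fun t => ?_⟩
    simp only [Finset.mem_insert, Set.Finite.mem_toFinset, mem_ofPred_eq]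
    constructor
    · rintro (rfl | rfl | ⟨h1, h2⟩)
      · obtain ⟨i, hi, e⟩ := h.zero
        exact ⟨by simp, i, hi, by rw [e]⟩
      · obtain ⟨i, hi, e⟩ := h.one
        exact ⟨by simp, i, hi, by rw [e]⟩
      · exact ⟨⟨h1.1.le, h1.2.le⟩, h2⟩
    · rintro ⟨h1, h2⟩
      rcases h1.1.eq_or_lt with e | e
      · exact Or.inl e.symm
      rcases h1.2.eq_or_lt with e' | e'
      · exact Or.inr (Or.inl e')
      · exact Or.inr (Or.inr ⟨⟨e, e'⟩, h2⟩)
  have h0 : (0:ℝ) ∈ H := (hH 0).2 ⟨by simp, by obtain ⟨i, hi, e⟩ := h.zero; exact ⟨i, hi, by rw [e]⟩⟩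
  have h1 : (1:ℝ) ∈ H := (hH 1).2 ⟨by simp, by obtain ⟨i, hi, e⟩ := h.one; exact ⟨i, hi, by rw [e]⟩⟩
  obtain ⟨M, hM⟩ : ∃ M, H.card = M + 2 := by
    have : 1 < H.card := Finset.one_lt_card.2 ⟨0, h0, 1, h1, by simp⟩
    exact ⟨H.card - 2, by omega⟩
  let o := H.orderEmbOfFin hM
  have ho : ∀ i, o i ∈ H := fun i => Finset.orderEmbOfFin_mem H hM i
  have ho' : ∀ t ∈ H, ∃ i, o i = t := fun t ht => by
    have : t ∈ Set.range o := by rw [Finset.range_orderEmbOfFin]; exact ht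
    exact this
  let d : ℕ → ℝ := fun i => if hi : i < M + 2 then o ⟨i, hi⟩ else 0
  have hd : ∀ i (hi : i < M + 2), d i = o ⟨i, hi⟩ := fun i hi => dif_pos hi
  have hdH : ∀ i ≤ M + 1, d i ∈ H := fun i hi => by rw [hd i (by omega)]; exact ho _
  have hlt : ∀ i j, i < j → j ≤ M + 1 → d i < d j := fun i j hij hj => by
    rw [hd i (by omega), hd j (by omega)]
    exact o.strictMono hij
  have hle : ∀ i j, i ≤ j → j ≤ M + 1 → d i ≤ d j := fun i j hij hj => by
    rcases hij.eq_or_lt with rfl | c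
    · exact le_rfl
    · exact (hlt i j c hj).le
  have hex : ∀ t ∈ H, ∃ i ≤ M + 1, d i = t := fun t ht => by
    obtain ⟨⟨i, hi⟩, e⟩ := ho' t ht
    exact ⟨i, by omega, by rw [hd i hi, e]⟩
  have d0 : d 0 = 0 := by
    obtain ⟨i, hi, e⟩ := hex 0 h0
    refine le_antisymm (e ▸ hle 0 i (by omega) hi) ((hH _).1 (hdH 0 (by omega))).1.1
  have d1 : d (M + 1) = 1 := by
    obtain ⟨i, hi, e⟩ := hex 1 h1
    exact le_antisymm ((hH _).1 (hdH _ le_rfl)).1.2 (e ▸ hle i (M + 1) hi le_rfl)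
  have hno : ∀ i ≤ M, ∀ t ∈ Ioo (d i) (d (i + 1)), ∀ l < n, (f t).re ≠ (P.v l).re := by
    intro i hi t ht l hl e
    have hm : t ∈ H := (hH t).2 ⟨⟨?_, ?_⟩, l, hl, e⟩
    · obtain ⟨j, hj, rfl⟩ := hex t hm
      rcases le_or_gt j i with c | c
      · exact absurd ht.1 (not_lt.2 (hle _ _ c (by omega)))
      · exact absurd ht.2 (not_lt.2 (hle _ _ c hj))
    · rw [← d0]; exact (hle 0 i (by omega) (by omega)).trans ht.1.le
    · rw [← d1]; exact ht.2.le.trans (hle _ _ (by omega) le_rfl)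
  have hk : ∀ i, ∃ k, i ≤ M → k ≤ n ∧ ∀ t ∈ Ioo (d i) (d (i + 1)), f t ∈ P.slab k := by
    intro i
    by_cases hi : i ≤ M
    · obtain ⟨k, hk, hk'⟩ := exists_slab_Ioo h.cont (hno i hi)
      exact ⟨k, fun _ => ⟨hk, hk'⟩⟩
    · exact ⟨0, fun h => absurd h hi⟩
  choose k hk using hk
  have hl : ∀ i, ∃ l, i ≤ M + 1 → l < n ∧ (f (d i)).re = (P.v l).re := by
    intro i
    by_cases hi : i ≤ M + 1
    · obtain ⟨_, l, hl⟩ := (hH _).1 (hdH i hi)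
      exact ⟨l, fun _ => hl⟩
    · exact ⟨0, fun h => absurd h hi⟩
  choose l hl using hl
  have mid : ∀ i, 0 < i → i ≤ M → d i ∈ Ioo (0:ℝ) 1 := fun i h0 h1 =>
    ⟨d0 ▸ hlt 0 i h0 (by omega), d1 ▸ hlt i (M + 1) (by omega) le_rfl⟩
  have adj : ∀ i ≤ M, Adj (k i) (l i) ∧ Adj (k i) (l (i + 1)) := fun i hi => by
    have := cslab_of_Ioo h.cont (hlt i (i + 1) (by omega) (by omega)) (hk i hi).2
    have hh := hlt i (i + 1) (by omega) (by omega)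
    exact ⟨adj_of_closure (hk i hi).1 (hl i (by omega)).1 (hl i (by omega)).2 (this _ ⟨le_rfl, hh.le⟩),
      adj_of_closure (hk i hi).1 (hl _ (by omega)).1 (hl _ (by omega)).2 (this _ ⟨hh.le, le_rfl⟩)⟩
  have pt_eq : ∀ i ≤ M + 1, f (d i) = P.pt (l i, (f (d i)).im - (P.v (l i)).im) := fun i hi =>
    Complex.ext (by rw [pt_re]; exact (hl i hi).2) (by rw [pt_im]; simp)
  have zero : ∀ i ≤ M + 1, f (d i) ∈ P.V → (f (d i)).im - (P.v (l i)).im = 0 := by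
    rintro i hi ⟨j, hj, e⟩
    have := (hl i hi).2
    rw [e] at this ⊢
    rw [re_inj hj (hl i hi).1 this]; simp
  refine ⟨⟨M, d, fun i => (l i, (f (d i)).im - (P.v (l i)).im), k, d0, d1,
    fun i hi => hlt _ _ (by omega) (by omega), fun i hi => (hl i hi).1, fun i hi => (adj i hi).1,
    fun i hi => (adj i hi).2, ?_, fun i hi => (hk i hi).2, pt_eq, ?_, ?_, ?_⟩⟩
  · intro i hi
    have a1 := (adj i hi.le).2
    have a2 := (adj (i + 1) hi).1
    have hne : k (i + 1) ≠ k i := by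
      intro e
      obtain ⟨ε, hε, hc⟩ := h.cross _ (mid (i + 1) (by omega) hi) _ (hl (i + 1) (by omega)).1
        (hl (i + 1) (by omega)).2
      have e1 := hlt i (i + 1) (by omega) (by omega)
      have e2 := hlt (i + 1) (i + 2) (by omega) (by omega)
      obtain ⟨t₁, ht₁⟩ := exists_between (max_lt e1 (sub_lt_self (d (i + 1)) hε))
      obtain ⟨t₂, ht₂⟩ := exists_between (lt_min e2 (lt_add_of_pos_right (d (i + 1)) hε))
      have s1 := (hk i hi.le).2 t₁ ⟨(le_max_left _ _).trans_lt ht₁.1, ht₁.2⟩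
      have s2 := (hk (i + 1) hi).2 t₂ ⟨ht₂.1, ht₂.2.trans_le (min_le_left _ _)⟩
      have := hc t₁ ⟨(le_max_right _ _).trans_lt ht₁.1, ht₁.2⟩ t₂ ⟨ht₂.1, ht₂.2.trans_le (min_le_right _ _)⟩
      rw [e] at s2
      have hln := (hl (i + 1) (by omega)).1
      rcases lt_or_ge (l (i + 1)) (k i) with c | c
      · nlinarith [s1.1 _ hln c, s2.1 _ hln c]
      · nlinarith [s1.2 _ hln c, s2.2 _ hln c]
    unfold Adj at a1 a2
    unfold opp
    simp only
    omega
  · exact zero 0 (by omega) (d0 ▸ h.zero)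
  · exact zero _ le_rfl (d1 ▸ h.one)
  · intro i hi hi' e
    refine h.not_mem _ (mid i hi hi') ⟨l i, (hl i (by omega)).1, ?_⟩
    rw [pt_eq i (by omega), pt]
    simp only at e
    rw [e]; simp

end Pts

end SlabPath

namespace SlabPath

open Set

/-- The two halves of a tight path. -/
structure TightPair (A B : List Side) : Prop where
  left : Tight A
  right : Tight B
  head : ∀ a ∈ A.head?, ∀ b ∈ B.head?, TightRel a b

lemma TightPair.symm {A B : List Side} (h : TightPair A B) : TightPair B A :=
  ⟨h.right, h.left, fun a ha b hb => (h.head b hb a ha).symm⟩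

lemma Link.tightPair {k₀ k : ℕ} {L₀ R₀ L R : List Station} (h : Link k₀ L₀ R₀ k L R)
    (ht : TightPair (wd L₀) (wd R₀)) : TightPair (wd L) (wd R) := by
  induction h with
  | base => exact ht
  | symm _ ih => exact ih.symm
  | @fwd k q L R _ hR ih =>
    obtain ⟨h1, h2, h3⟩ := ih
    have h2' := List.isChain_cons.1 h2
    refine ⟨List.isChain_cons.2 ⟨fun b hb => (h3 b hb (side q) (by simp [wd])).symm, h1⟩, h2'.2, ?_⟩
    intro a ha b hb
    obtain rfl : side q = a := by simpa [wd] using ha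
    exact h2'.1 b hb

lemma HalfOk.wOk : ∀ {L : List Station} {k : ℕ}, HalfOk k L → WOk k (wd L)
  | [], _, h => h.elim
  | [q], _, h => ⟨h.1, by simpa [side] using h.2⟩
  | q :: r :: L, _, h => ⟨h.1, by simpa [side] using h.2.1, HalfOk.wOk (L := r :: L) h.2.2⟩

lemma Link.exists_singleton {k₀ : ℕ} {L₀ R₀ : List Station} : ∀ {L : List Station} {k : ℕ} {R : List Station},
    L ≠ [] → Link k₀ L₀ R₀ k L R → ∃ k' v R', Link k₀ L₀ R₀ k' [v] R'
  | [], _, _, h, _ => absurd rfl h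
  | [v], k, R, _, h => ⟨k, v, R, h⟩
  | q :: r :: L, _, _, _, h => exists_singleton (L := r :: L) (by simp) (h.symm.fwd (by simp)).symm

namespace Pts

variable {n : ℕ} {P : Pts n}

lemma Real2.of_link {f : ℝ → ℂ} {c : ℝ} {k₀ k : ℕ} {L₀ R₀ L R : List Station}
    (h : P.Real2 f c k₀ L₀ R₀) (hl : Link k₀ L₀ R₀ k L R) :
    ∃ c', P.Real2 f c' k L R ∨ P.Real2 (fun t => f (1 - t)) c' k L R := by
  induction hl with
  | base => exact ⟨c, .inl h⟩
  | symm _ ih =>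
    obtain ⟨c', h | h⟩ := ih
    · exact ⟨_, .inr h.symm⟩
    · exact ⟨_, .inl h.symm'⟩
  | fwd _ hR ih =>
    obtain ⟨c', h | h⟩ := ih
    · obtain ⟨c'', _, h'⟩ := h.shift hR
      exact ⟨c'', .inl h'⟩
    · obtain ⟨c₂, _, h₂⟩ := h.shift hR
      exact ⟨c₂, .inr h₂⟩

/-- A family of pairwise non-homotopic transverse curves. -/
structure Family (P : Pts n) (E : Type) where
  φ : E → ℝ → ℂ
  track : ∀ e, P.Track (φ e)
  cont : ∀ e, Continuous (φ e)
  nontriv : ∀ e, ¬ TrivHom P.V (φ e)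
  not_hom : ∀ e e', e ≠ e' → ¬ SHom P.V (φ e) (φ e')
  not_hom' : ∀ e e', e ≠ e' → ¬ SHom P.V (φ e) fun t => φ e' (1 - t)

namespace Family

variable {E : Type} (F : P.Family E)

/-- The tightening of a curve of the family. -/
lemma exists_tight (e : E) : ∃ g c k L R, SHom P.V (F.φ e) g ∧ Continuous g ∧ P.Real2 g c k L R ∧
    Simulates ((F.track e).k 0) [(F.track e).q 0] (Track.tl (F.track e).q 0 (F.track e).M) k L R ∧
    TightPair (wd L) (wd R) := by
  obtain ⟨c, h⟩ := (F.track e).real2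
  obtain ⟨g, c, k, L, R, h1, h2, h3, h4, h5, h6, h7⟩ := h.exists_tight (F.cont e) (F.nontriv e)
  exact ⟨g, c, k, L, R, h2, h1, h3, h4, h5, h6, h7⟩

noncomputable def g (e : E) : ℝ → ℂ := (F.exists_tight e).choose
noncomputable def c (e : E) : ℝ := (F.exists_tight e).choose_spec.choose
noncomputable def k (e : E) : ℕ := (F.exists_tight e).choose_spec.choose_spec.choose
noncomputable def L (e : E) : List Station := (F.exists_tight e).choose_spec.choose_spec.choose_spec.choose
noncomputable def R (e : E) : List Station :=
  (F.exists_tight e).choose_spec.choose_spec.choose_spec.choose_spec.choose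

lemma spec (e : E) : SHom P.V (F.φ e) (F.g e) ∧ Continuous (F.g e) ∧
    P.Real2 (F.g e) (F.c e) (F.k e) (F.L e) (F.R e) ∧
    Simulates ((F.track e).k 0) [(F.track e).q 0] (Track.tl (F.track e).q 0 (F.track e).M)
      (F.k e) (F.L e) (F.R e) ∧ TightPair (wd (F.L e)) (wd (F.R e)) :=
  (F.exists_tight e).choose_spec.choose_spec.choose_spec.choose_spec.choose_spec

lemma real2 (e : E) : P.Real2 (F.g e) (F.c e) (F.k e) (F.L e) (F.R e) := (F.spec e).2.2.1

lemma not_hom_g {e e' : E} (h : e ≠ e') : ¬ SHom P.V (F.g e) (F.g e') := fun H =>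
  F.not_hom e e' h (((F.spec e).1.trans' H).trans' (F.spec e').1.symm)

lemma not_hom_g' {e e' : E} (h : e ≠ e') : ¬ SHom P.V (F.g e) fun t => F.g e' (1 - t) := fun H =>
  F.not_hom' e e' h (((F.spec e).1.trans' H).trans' (F.spec e').1.symm.reverse)

lemma exists_start (e : E) : ∃ p : ℕ × Station × List Station,
    Link (F.k e) (F.L e) (F.R e) p.1 [p.2.1] p.2.2 := by
  obtain ⟨k, v, R, h⟩ := Link.exists_singleton (F.real2 e).left.ne_nil .base
  exact ⟨⟨k, v, R⟩, h⟩

/-- The words of the tightened curves. -/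
noncomputable def wordSys : WordSys E n where
  LW e k A B := ∃ L R, Link (F.k e) (F.L e) (F.R e) k L R ∧ wd L = A ∧ wd R = B
  start e := ((F.exists_start e).choose.1, side (F.exists_start e).choose.2.1,
    wd (F.exists_start e).choose.2.2)
  base e := ⟨_, _, (F.exists_start e).choose_spec, rfl, rfl⟩
  symm := by
    rintro e k _ _ ⟨L, R, h, rfl, rfl⟩
    exact ⟨R, L, h.symm, rfl, rfl⟩
  fwd := by
    rintro e k _ a B ⟨L, R, h, rfl, hR⟩ hB
    rcases R with _ | ⟨q, R⟩
    · simp [wd] at hR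
    obtain ⟨rfl, rfl⟩ := List.cons_eq_cons.1 hR
    exact ⟨q :: L, R, h.fwd (by rintro rfl; exact hB rfl), rfl, rfl⟩
  ok := by
    rintro e k _ _ ⟨L, R, h, rfl, rfl⟩
    exact (h.halfOk (F.real2 e).left.halfOk (F.real2 e).right.halfOk).2.wOk
  tight := by
    rintro e k a _ b _ ⟨L, R, h, h1, h2⟩
    exact (h.tightPair (F.spec e).2.2.2.2).head a (by simp [h1]) b (by simp [h2])
  lt := by
    rintro e k _ _ ⟨L, R, h, rfl, rfl⟩ a ha
    obtain ⟨q, hq, rfl⟩ := List.mem_map.1 ha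
    obtain ⟨c, h | h⟩ := (F.real2 e).of_link h
    · exact h.right.lt_n q hq
    · exact h.right.lt_n q hq
  inj := by
    rintro e e' k v w ⟨L, R, h, h1, h2⟩ ⟨L', R', h', h1', h2'⟩
    by_contra hne
    have cg := (F.spec e).2.1
    have cg' := (F.spec e').2.1
    obtain ⟨c, h | h⟩ := (F.real2 e).of_link h <;> obtain ⟨c', h' | h'⟩ := (F.real2 e').of_link h'
    · exact F.not_hom_g hne (Real2.sHom cg cg' h h' (h1.trans h1'.symm) (h2.trans h2'.symm))
    · exact F.not_hom_g' hne (Real2.sHom cg (by fun_prop) h h' (h1.trans h1'.symm) (h2.trans h2'.symm))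
    · exact F.not_hom_g' hne
        (Real2.sHom (by fun_prop) cg' h h' (h1.trans h1'.symm) (h2.trans h2'.symm)).reverse_left
    · exact F.not_hom_g hne (by
        simpa using (Real2.sHom (by fun_prop) (by fun_prop) h h' (h1.trans h1'.symm)
          (h2.trans h2'.symm)).reverse)

lemma exists_meet_of_linked {e e' : E} (h : F.wordSys.Linked e e') : ∃ s s', Reduced s ∧ Reduced s' ∧
    (e = e' → s ≠ s') ∧ ∃ i ≤ (F.track e).M, ∃ j ≤ (F.track e').M,
      (F.track e).node s i = (F.track e').node s' j ∧ ∃ t ∈ Ioo (0:ℝ) 1, ∃ t' ∈ Ioo (0:ℝ) 1,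
      t ∈ Icc ((F.track e).d i) ((F.track e).d (i + 1)) ∧
      t' ∈ Icc ((F.track e').d j) ((F.track e').d (j + 1)) ∧ F.φ e t = F.φ e' t' := by
  obtain ⟨k, c, A, B, A', B', hc, ⟨L, R, hl, rfl, rfl⟩, ⟨L', R', hl', rfl, rfl⟩, n1, n2, n3, n4, hs⟩ := h
  have r := F.real2 e
  have r' := F.real2 e'
  have ho := hl.halfOk r.left.halfOk r.right.halfOk
  have ho' := hl'.halfOk r'.left.halfOk r'.right.halfOk
  have ht := hl.tightPair (F.spec e).2.2.2.2
  have ht' := hl'.tightPair (F.spec e').2.2.2.2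
  obtain ⟨s, s', hs, hs', hap, hm⟩ := exists_crossing (F.track e).halfOk' (F.track e).halfOk
    (F.track e').halfOk' (F.track e').halfOk
    ((F.spec e).2.2.2.1.trans (hl.simulates r.left.halfOk r.right.halfOk))
    ((F.spec e').2.2.2.1.trans (hl'.simulates r'.left.halfOk r'.right.halfOk))
    ho.1 ho.2 ho'.1 ho'.2 ht.1 ht.2 ht'.1 ht'.2 n1 n2 n3 n4 hc hs
  refine ⟨s, s', hs, hs', ?_, (F.track e).exists_meet (F.track e') (F.cont e) (F.cont e') hap hm⟩
  rintro rfl rfl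
  have := (F.track e).mem_incs_of (s := s) (i := 0) (Nat.zero_le _) (Or.inl rfl)
  exact hap _ this _ this (F.track e).q_zero rfl

theorem card_le_eleven_mul [Fintype E]
    (hd : ∀ e e', e ≠ e' → ∀ t ∈ Ioo (0:ℝ) 1, ∀ t' ∈ Ioo (0:ℝ) 1, F.φ e t ≠ F.φ e' t') :
    Fintype.card E ≤ 11 * n := by
  refine F.wordSys.card_le_eleven_mul fun e e' h => ?_
  by_contra hne
  obtain ⟨_, _, _, _, _, _, _, _, _, _, t, ht, t', ht', _, _, h⟩ := F.exists_meet_of_linked h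
  exact hd e e' hne t ht t' ht' h

theorem card_le_three_mul [Fintype E]
    (hd : ∀ e e', e ≠ e' → ∀ t ∈ Ioo (0:ℝ) 1, ∀ t' ∈ Ioo (0:ℝ) 1, F.φ e t ≠ F.φ e' t')
    (hl : ∀ e, LocSimple P.V (F.φ e)) : Fintype.card E ≤ 3 * n := by
  refine F.wordSys.card_le_three_mul fun e e' h => ?_
  obtain ⟨s, s', hs, hs', hne, i, hi, j, hj, hN, t, ht, t', ht', h1, h2, h⟩ := F.exists_meet_of_linked h
  by_cases he : e = e'
  · subst he
    exact hne rfl ((F.track e).eq_of_locSimple (hl e) hs hs' hi hj hN ht ht' h1 h2 h)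
  · exact hd e e' he t ht t' ht' h

end Family

end Pts

end SlabPath

namespace SlabPath

open Set

variable {V : Set ℂ} {f g : ℝ → ℂ}

lemma SHom.of_eqOn (hf : Continuous f) (hg : Continuous g) (h : ∀ t ∈ Icc (0:ℝ) 1, f t = g t)
    (hV : ∀ t ∈ Ioo (0:ℝ) 1, f t ∉ V) : SHom V f g := by
  refine Hom.linear hf hg (h 0 (by simp)) (h 1 (by simp)) fun s _ t ht => ?_
  rw [← h t ⟨ht.1.le, ht.2.le⟩, ← add_mul, ← Complex.ofReal_add]
  simpa using hV t ht

/-- Replace the curve up to the time `a` by a segment starting at `v`. -/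
noncomputable def coneAt (v : ℂ) (f : ℝ → ℂ) (a t : ℝ) : ℂ :=
  v + ((max t 0 / max a (max t 0) : ℝ) : ℂ) * (f (max a (max t 0)) - v)

lemma coneAt_continuous (hf : Continuous f) {v : ℂ} (h0 : f 0 = v) :
    Continuous fun p : ℝ × ℝ => coneAt v f (max p.1 0) p.2 := by
  rw [continuous_iff_continuousAt]
  intro p
  by_cases hp : max (max p.1 0) (max p.2 0) = 0
  · have e : coneAt v f (max p.1 0) p.2 = v := by simp [coneAt, hp]
    have hc : Continuous fun p : ℝ × ℝ => ‖f (max (max p.1 0) (max p.2 0)) - v‖ := by fun_prop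
    have hl := hc.tendsto p
    rw [hp, h0, sub_self, norm_zero] at hl
    show Filter.Tendsto (fun p : ℝ × ℝ => coneAt v f (max p.1 0) p.2) (nhds p)
      (nhds (coneAt v f (max p.1 0) p.2))
    rw [e, tendsto_iff_norm_sub_tendsto_zero]
    refine squeeze_zero (fun _ => norm_nonneg _) (fun q => ?_) hl
    simp only [coneAt, add_sub_cancel_left, norm_mul, Complex.norm_real]
    refine mul_le_of_le_one_left (norm_nonneg _) ?_
    have h1 : 0 ≤ max q.2 0 := le_max_right _ _
    have h2 : max q.2 0 ≤ max (max q.1 0) (max q.2 0) := le_max_right _ _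
    rw [Real.norm_of_nonneg (div_nonneg h1 (h1.trans h2))]
    exact div_le_one_of_le₀ h2 (h1.trans h2)
  · unfold coneAt
    have : ContinuousAt (fun p : ℝ × ℝ => max p.2 0 / max (max p.1 0) (max p.2 0)) p :=
      ContinuousAt.div (by fun_prop) (by fun_prop) hp
    fun_prop

lemma coneAt_of_le {v : ℂ} {a t : ℝ} (ha : 0 ≤ a) (h : a ≤ t) (h0 : f 0 = v) : coneAt v f a t = f t := by
  have h1 : max t 0 = t := max_eq_left (ha.trans h)
  rw [coneAt, h1, max_eq_right h]
  rcases (ha.trans h).eq_or_lt with e | e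
  · rw [← e, h0]; simp
  · rw [div_self e.ne']; simp

lemma coneAt_of_ge {v : ℂ} {a t : ℝ} (ht : 0 ≤ t) (h : t ≤ a) :
    coneAt v f a t = v + ((t / a : ℝ) : ℂ) * (f a - v) := by
  rw [coneAt, max_eq_left ht, max_eq_left h]

lemma SHom.coneAt (hf : Continuous f) {v : ℂ} {r a : ℝ} (h0 : f 0 = v) (ha : 0 < a) (ha1 : a < 1)
    (hr : ∀ z ∈ Metric.ball v r, z ∈ V → z = v) (hv : v ∈ V) (hb : ∀ t ∈ Icc 0 a, f t ∈ Metric.ball v r)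
    (hV : ∀ t ∈ Ioo (0:ℝ) 1, f t ∉ V) : SHom V f (coneAt v f a) := by
  have hc := coneAt_continuous hf h0
  have hc0 : Continuous (SlabPath.coneAt v f 0) := by
    have := hc.comp (show Continuous fun t : ℝ => ((0:ℝ), t) by fun_prop)
    simpa [Function.comp_def] using this
  have e0 : ∀ t ∈ Icc (0:ℝ) 1, f t = SlabPath.coneAt v f 0 t := fun t ht =>
    (coneAt_of_le le_rfl ht.1 h0).symm
  refine (SHom.of_eqOn hf hc0 e0 hV).trans' ⟨fun p => SlabPath.coneAt v f (max (p.1 * a) 0) p.2,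
    hc.comp (show Continuous fun p : ℝ × ℝ => (p.1 * a, p.2) by fun_prop), by simp,
    by simp [max_eq_left ha.le], ?_, ?_⟩
  · intro s hs
    have h1 : 0 ≤ s * a := mul_nonneg hs.1 ha.le
    have h2 : s * a ≤ 1 := by nlinarith [hs.2]
    refine ⟨?_, ?_⟩
    · simp [SlabPath.coneAt]
    · simp only
      rw [max_eq_left h1, coneAt_of_le h1 h2 h0, ← e0 1 (by simp)]
  · intro s hs t ht
    have h1 : 0 ≤ s * a := mul_nonneg hs.1 ha.le
    have h2 : s * a ≤ a := mul_le_of_le_one_left ha.le hs.2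
    simp only
    rw [max_eq_left h1]
    rcases le_or_gt (s * a) t with c | c
    · rw [coneAt_of_le h1 c h0]; exact hV t ht
    · have hm : 0 < s * a := ht.1.trans c
      rw [coneAt_of_ge ht.1.le c.le]
      intro hmem
      have hq0 : 0 < t / (s * a) := div_pos ht.1 hm
      have hq1 : t / (s * a) ≤ 1 := div_le_one_of_le₀ c.le h1
      have hball := hb (s * a) ⟨h1, h2⟩
      have := hr _ (by
        rw [mem_ball_iff_norm] at hball ⊢
        rw [add_sub_cancel_left, norm_mul, Complex.norm_real, Real.norm_of_nonneg hq0.le]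
        exact (mul_le_of_le_one_left (norm_nonneg _) hq1).trans_lt hball) hmem
      have h3 : f (s * a) - v = 0 := by
        have h4 : ((t / (s * a) : ℝ) : ℂ) * (f (s * a) - v) = 0 := by
          linear_combination this
        exact (mul_eq_zero.1 h4).resolve_left (by exact_mod_cast hq0.ne')
      exact hV (s * a) ⟨hm, h2.trans_lt ha1⟩ (by rw [sub_eq_zero.1 h3]; exact hv)

end SlabPath

namespace SlabPath

open Set

variable {V : Set ℂ} {f g : ℝ → ℂ}

/-- A curve which starts and ends with segments of length `ρ`, and otherwise keeps distance `ρ`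
from `V`. -/
structure Straight (V : Set ℂ) (ρ : ℝ) (g : ℝ → ℂ) : Prop where
  cont : Continuous g
  zero : g 0 ∈ V
  one : g 1 ∈ V
  left : ∀ t ∈ Icc (0:ℝ) (1/3), g t = g 0 + ((3 * t : ℝ) : ℂ) * (g (1/3) - g 0)
  right : ∀ t ∈ Icc (2/3 : ℝ) 1, g t = g 1 + ((3 * (1 - t) : ℝ) : ℂ) * (g (2/3) - g 1)
  far : ∀ t ∈ Icc (1/3 : ℝ) (2/3), ∀ u ∈ V, ρ ≤ ‖g t - u‖
  norm_left : ‖g (1/3) - g 0‖ = ρ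
  norm_right : ‖g (2/3) - g 1‖ = ρ

noncomputable def toMid (t : ℝ) : ℝ := max (1/3) (min t (2/3))

noncomputable def radius (t : ℝ) : ℝ := min 1 (min (3 * t) (3 * (1 - t)))

lemma toMid_mem (t : ℝ) : toMid t ∈ Icc (1/3 : ℝ) (2/3) :=
  ⟨le_max_left _ _, max_le (by norm_num) (min_le_right _ _)⟩

lemma radius_pos {t : ℝ} (ht : t ∈ Ioo (0:ℝ) 1) : 0 < radius t :=
  lt_min one_pos (lt_min (by linarith [ht.1]) (by linarith [ht.2]))

lemma radius_le_one (t : ℝ) : radius t ≤ 1 := min_le_left _ _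

lemma toMid_radius (t : ℝ) : (t ≤ 1/3 ∧ toMid t = 1/3 ∧ radius t = 3 * t) ∨
    (t ∈ Icc (1/3 : ℝ) (2/3) ∧ toMid t = t ∧ radius t = 1) ∨
    (2/3 ≤ t ∧ toMid t = 2/3 ∧ radius t = 3 * (1 - t)) := by
  rcases le_total t (1/3) with c | c
  · refine .inl ⟨c, ?_, ?_⟩
    · rw [toMid, min_eq_left (by linarith), max_eq_left c]
    · rw [radius, min_eq_left (by linarith : 3 * t ≤ 3 * (1 - t)), min_eq_right (by linarith)]
  rcases le_total (2/3) t with c' | c'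
  · refine .inr (.inr ⟨c', ?_, ?_⟩)
    · rw [toMid, min_eq_right c', max_eq_right (by norm_num)]
    · rw [radius, min_eq_right (by linarith : 3 * (1 - t) ≤ 3 * t), min_eq_right (by linarith)]
  · refine .inr (.inl ⟨⟨c, c'⟩, ?_, ?_⟩)
    · rw [toMid, min_eq_left c', max_eq_right c]
    · rw [radius, min_eq_left (le_min (by linarith) (by linarith))]

lemma eq_of_toMid_eq {t t' : ℝ} (h : toMid t = toMid t') (h' : radius t = radius t') : t = t' := by
  rcases toMid_radius t with ⟨a, b, c⟩ | ⟨a, b, c⟩ | ⟨a, b, c⟩ <;>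
  rcases toMid_radius t' with ⟨a', b', c'⟩ | ⟨a', b', c'⟩ | ⟨a', b', c'⟩ <;>
  rw [b, b'] at h <;> rw [c, c'] at h' <;> linarith

namespace Straight

variable {ρ : ℝ}

lemma polar (hg : Straight V ρ g) {t : ℝ} (ht : t ∈ Ioo (0:ℝ) 1) :
    ∃ v ∈ V, g t = v + (radius t : ℂ) * (g (toMid t) - v) ∧
      (radius t = 1 ∨ ‖g (toMid t) - v‖ = ρ) := by
  rcases toMid_radius t with ⟨a, b, c⟩ | ⟨a, b, c⟩ | ⟨a, b, c⟩ <;> rw [b, c]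
  · exact ⟨_, hg.zero, hg.left t ⟨ht.1.le, a⟩, .inr hg.norm_left⟩
  · exact ⟨_, hg.zero, by simp, .inl rfl⟩
  · exact ⟨_, hg.one, hg.right t ⟨a, ht.2.le⟩, .inr hg.norm_right⟩

lemma far' (hg : Straight V ρ g) {t : ℝ} (ht : t ∈ Ioo (0:ℝ) 1) (h : radius t = 1) :
    ∀ u ∈ V, ρ ≤ ‖g t - u‖ := by
  obtain ⟨v, -, e, -⟩ := hg.polar ht
  rw [h] at e
  intro u hu
  rw [e]
  simpa using hg.far _ (toMid_mem t) u hu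

lemma norm_sub {t : ℝ} {v z : ℂ} (ht : t ∈ Ioo (0:ℝ) 1)
    (e : g t = v + (radius t : ℂ) * (z - v)) (h : ‖z - v‖ = ρ) : ‖g t - v‖ = radius t * ρ := by
  rw [e, add_sub_cancel_left, norm_mul, h, Complex.norm_real, Real.norm_of_nonneg (radius_pos ht).le]

/-- The vertices are `2ρ`-separated. -/
lemma collision (hρ : 0 < ρ) (hV : ∀ u ∈ V, ∀ w ∈ V, u ≠ w → 2 * ρ ≤ ‖u - w‖) {g' : ℝ → ℂ}
    (hg : Straight V ρ g) (hg' : Straight V ρ g') {t t' : ℝ} (ht : t ∈ Ioo (0:ℝ) 1)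
    (ht' : t' ∈ Ioo (0:ℝ) 1) (e : g t = g' t') :
    radius t = radius t' ∧ g (toMid t) = g' (toMid t') := by
  obtain ⟨v, hv, h1, h2⟩ := hg.polar ht
  obtain ⟨v', hv', h1', h2'⟩ := hg'.polar ht'
  have lt : ∀ x, radius x ≠ 1 → radius x * ρ < ρ := fun x hx =>
    mul_lt_of_lt_one_left hρ (lt_of_le_of_ne (radius_le_one x) hx)
  by_cases c : radius t = 1
  · by_cases c' : radius t' = 1
    · refine ⟨c.trans c'.symm, ?_⟩
      rw [h1, h1', c, c'] at e
      simpa using e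
    · have := norm_sub ht' h1' (h2'.resolve_left c')
      have h3 := hg.far' ht c v' hv'
      rw [e, this] at h3
      exact absurd h3 (lt _ c').not_ge
  · have h := norm_sub ht h1 (h2.resolve_left c)
    by_cases c' : radius t' = 1
    · have h3 := hg'.far' ht' c' v hv
      rw [← e, h] at h3
      exact absurd h3 (lt _ c).not_ge
    · have h' := norm_sub ht' h1' (h2'.resolve_left c')
      have hvv : v = v' := by
        by_contra hne
        have h3 := hV v hv v' hv' hne
        have h4 : ‖v - v'‖ ≤ ‖g t - v‖ + ‖g' t' - v'‖ := by
          rw [← norm_neg (g t - v)]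
          refine le_trans (le_of_eq ?_) (norm_add_le _ _)
          rw [e]; congr 1; ring
        have := lt _ c
        have := lt _ c'
        linarith
      subst hvv
      rw [e, h'] at h
      have hr : radius t = radius t' := (mul_right_cancel₀ hρ.ne' h).symm
      refine ⟨hr, ?_⟩
      rw [h1, h1', hr] at e
      have h5 := mul_left_cancel₀ (by exact_mod_cast (radius_pos ht').ne') (add_left_cancel e)
      exact sub_left_injective h5

lemma not_mem (hρ : 0 < ρ) (hV : ∀ u ∈ V, ∀ w ∈ V, u ≠ w → 2 * ρ ≤ ‖u - w‖) (hg : Straight V ρ g)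
    {t : ℝ} (ht : t ∈ Ioo (0:ℝ) 1) : g t ∉ V := by
  intro hm
  obtain ⟨v, hv, h1, h2⟩ := hg.polar ht
  by_cases c : radius t = 1
  · have := hg.far' ht c _ hm
    simp at this
    linarith
  · have h := norm_sub ht h1 (h2.resolve_left c)
    have h3 : 0 < radius t * ρ := mul_pos (radius_pos ht) hρ
    have h4 := hV _ hm v hv (by rintro e; rw [e] at h; simp at h; linarith [h.resolve_left (by rintro e; simp [e] at h3)])
    have := radius_le_one t
    nlinarith

end Straight

end SlabPath

namespace SlabPath

open Set

variable {V : Set ℂ} {f g : ℝ → ℂ}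

lemma exists_last_time {h : ℝ → ℝ} (hh : Continuous h) (h0 : h 0 = 0) {a ρ : ℝ} (ha : 0 ≤ a)
    (hρ : 0 < ρ) (hρa : ρ ≤ h a) :
    ∃ t₁ ∈ Ioc 0 a, h t₁ = ρ ∧ ∀ t ∈ Icc t₁ a, ρ ≤ h t := by
  have hT : IsCompact (Icc 0 a ∩ {t | h t ≤ ρ}) :=
    isCompact_Icc.inter_right (isClosed_le hh continuous_const)
  obtain ⟨t₁, ⟨⟨h1, h2⟩, h3⟩, h4⟩ := hT.exists_isGreatest
    ⟨0, ⟨le_rfl, ha⟩, by simp only [mem_ofPred_eq, h0]; exact hρ.le⟩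
  have h5 : h t₁ = ρ := by
    obtain ⟨s, hs, e⟩ := intermediate_value_Icc h2 hh.continuousOn ⟨h3, hρa⟩
    have := h4 ⟨⟨h1.trans hs.1, hs.2⟩, e.le⟩
    rw [← e, le_antisymm this hs.1]
  refine ⟨t₁, ⟨lt_of_le_of_ne h1 ?_, h2⟩, h5, ?_⟩
  · rintro rfl; linarith
  · intro t ht
    by_contra! c
    have := h4 ⟨⟨h1.trans ht.1, ht.2⟩, c.le⟩
    rw [le_antisymm this ht.1] at c
    linarith

lemma exists_ball (hf : Continuous f) {r : ℝ} (hr : 0 < r) :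
    ∃ a ∈ Ioo (0:ℝ) (1/2), ∀ t ∈ Icc 0 a, f t ∈ Metric.ball (f 0) r := by
  obtain ⟨δ, hδ, h⟩ := Metric.continuous_iff.1 hf 0 r hr
  refine ⟨min (δ/2) (1/4), ⟨by positivity, (min_le_right _ _).trans_lt (by norm_num)⟩, fun t ht => ?_⟩
  apply h
  rw [Real.dist_eq, sub_zero, abs_of_nonneg ht.1]
  linarith [ht.2.trans (min_le_left _ _)]

lemma le_norm_sub_of_ball {r ρ : ℝ} (hV : ∀ u ∈ V, ∀ w ∈ V, u ≠ w → 2 * r ≤ ‖u - w‖) (hρ : ρ ≤ r)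
    {v z : ℂ} (hv : v ∈ V) (hz : z ∈ Metric.ball v r) (h : ρ ≤ ‖z - v‖) : ∀ u ∈ V, ρ ≤ ‖z - u‖ := by
  intro u hu
  by_cases e : v = u
  · rwa [← e]
  · have h1 := hV v hv u hu e
    rw [mem_ball_iff_norm, norm_sub_rev] at hz
    have h2 : ‖v - u‖ ≤ ‖v - z‖ + ‖z - u‖ := norm_sub_le_norm_sub_add_norm_sub _ _ _
    linarith

lemma exists_far (hfin : V.Finite) {r : ℝ} (hr : 0 < r)
    (hV : ∀ u ∈ V, ∀ w ∈ V, u ≠ w → 2 * r ≤ ‖u - w‖)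
    (hf : Continuous f) (h0 : f 0 ∈ V) (h1 : f 1 ∈ V) (hfV : ∀ t ∈ Ioo (0:ℝ) 1, f t ∉ V) :
    ∃ ρ₀ > 0, ∀ ρ, 0 < ρ → ρ ≤ ρ₀ → ∃ t₁ t₂, 0 < t₁ ∧ t₁ < t₂ ∧ t₂ < 1 ∧
      (∀ t ∈ Icc 0 t₁, f t ∈ Metric.ball (f 0) r) ∧ (∀ t ∈ Icc t₂ 1, f t ∈ Metric.ball (f 1) r) ∧
      ‖f t₁ - f 0‖ = ρ ∧ ‖f t₂ - f 1‖ = ρ ∧ ∀ t ∈ Icc t₁ t₂, ∀ u ∈ V, ρ ≤ ‖f t - u‖ := by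
  obtain ⟨a, ha, hab⟩ := exists_ball hf hr
  have hf' : Continuous fun t => f (1 - t) := by fun_prop
  obtain ⟨b, hb, hbb⟩ := exists_ball hf' hr
  simp only [sub_zero] at hbb
  have hcl : IsClosed V := hfin.isClosed
  have hK : (Icc a (1 - b)).Nonempty := ⟨a, le_rfl, by linarith [ha.2, hb.2]⟩
  obtain ⟨s, hs, hmin⟩ := isCompact_Icc.exists_isMinOn hK
    (f := fun t => Metric.infDist (f t) V) (by fun_prop)
  have hpos : 0 < Metric.infDist (f s) V := by
    refine (hcl.notMem_iff_infDist_pos ⟨_, h0⟩).1 (hfV s ⟨ha.1.trans_le hs.1, ?_⟩)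
    linarith [hs.2, hb.1]
  refine ⟨min r (Metric.infDist (f s) V), lt_min hr hpos, fun ρ hρ hρ' => ?_⟩
  have hm : ∀ t ∈ Icc a (1 - b), ∀ u ∈ V, ρ ≤ ‖f t - u‖ := by
    intro t ht u hu
    rw [← dist_eq_norm]
    exact ((hρ'.trans (min_le_right _ _)).trans (hmin ht)).trans (Metric.infDist_le_dist_of_mem hu)
  obtain ⟨t₁, ht₁, e₁, hl₁⟩ := exists_last_time (h := fun t => ‖f t - f 0‖) (by fun_prop) (by simp)
    ha.1.le hρ (hm a ⟨le_rfl, by linarith [ha.2, hb.2]⟩ _ h0)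
  obtain ⟨t₂, ht₂, e₂, hl₂⟩ := exists_last_time (h := fun t => ‖f (1 - t) - f 1‖) (by fun_prop) (by simp)
    hb.1.le hρ (hm (1 - b) ⟨by linarith [ha.2, hb.2], le_rfl⟩ _ h1)
  refine ⟨t₁, 1 - t₂, ht₁.1, by linarith [ht₁.2, ht₂.2, ha.2, hb.2], by linarith [ht₂.1],
    fun t ht => hab t ⟨ht.1, ht.2.trans ht₁.2⟩, fun t ht => ?_, e₁, e₂, fun t ht => ?_⟩
  · simpa using hbb (1 - t) ⟨by linarith [ht.2], by linarith [ht.1, ht₂.2]⟩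
  · rcases le_total t a with c | c
    · exact le_norm_sub_of_ball hV (hρ'.trans (min_le_left _ _)) h0
        (hab t ⟨ht₁.1.le.trans ht.1, c⟩) (hl₁ t ⟨ht.1, c⟩)
    rcases le_total t (1 - b) with c' | c'
    · exact hm t ⟨c, c'⟩
    · have h2 := hbb (1 - t) ⟨by linarith [ht.2, ht₂.1], by linarith⟩
      have h3 := hl₂ (1 - t) ⟨by linarith [ht.2], by linarith⟩
      simp only [_root_.sub_sub_cancel] at h2 h3
      exact le_norm_sub_of_ball hV (hρ'.trans (min_le_left _ _)) h1 h2 h3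

lemma SHom.not_mem_right (h : SHom V f g) : ∀ t ∈ Ioo (0:ℝ) 1, g t ∉ V := by
  obtain ⟨K, -, -, k1, -, kV⟩ := h
  intro t ht
  have := kV 1 (by simp) t ht
  rwa [k1] at this

noncomputable def clamp (x : ℝ) : ℝ := max 0 (min x 1)

lemma clamp_of_nonpos {x : ℝ} (h : x ≤ 0) : clamp x = 0 := max_eq_left ((min_le_left _ _).trans h)

lemma clamp_of_one_le {x : ℝ} (h : 1 ≤ x) : clamp x = 1 := by
  rw [clamp, min_eq_right h, max_eq_right zero_le_one]

lemma clamp_of_mem {x : ℝ} (h : 0 ≤ x) (h' : x ≤ 1) : clamp x = x := by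
  rw [clamp, min_eq_left h', max_eq_right h]

noncomputable def thirds (t₁ t₂ t : ℝ) : ℝ :=
  t₁ * clamp (3 * t) + (t₂ - t₁) * clamp (3 * t - 1) + (1 - t₂) * clamp (3 * t - 2)

lemma thirds_continuous (t₁ t₂ : ℝ) : Continuous (thirds t₁ t₂) := by
  unfold thirds clamp
  fun_prop

lemma thirds_left {t₁ t₂ t : ℝ} (h : 0 ≤ t) (h' : t ≤ 1/3) : thirds t₁ t₂ t = t₁ * (3 * t) := by
  rw [thirds, clamp_of_mem (by linarith) (by linarith), clamp_of_nonpos (by linarith),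
    clamp_of_nonpos (by linarith)]
  ring

lemma thirds_mid {t₁ t₂ t : ℝ} (h : 1/3 ≤ t) (h' : t ≤ 2/3) :
    thirds t₁ t₂ t = t₁ + (3 * t - 1) * (t₂ - t₁) := by
  rw [thirds, clamp_of_one_le (by linarith), clamp_of_mem (by linarith) (by linarith),
    clamp_of_nonpos (by linarith)]
  ring

lemma thirds_right {t₁ t₂ t : ℝ} (h : 2/3 ≤ t) (h' : t ≤ 1) :
    1 - thirds t₁ t₂ t = (1 - t₂) * (3 * (1 - t)) := by
  rw [thirds, clamp_of_one_le (by linarith), clamp_of_one_le (by linarith),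
    clamp_of_mem (by linarith) (by linarith)]
  ring

lemma exists_straight (hfin : V.Finite) {r : ℝ} (hr : 0 < r)
    (hV : ∀ u ∈ V, ∀ w ∈ V, u ≠ w → 2 * r ≤ ‖u - w‖)
    (hf : Continuous f) (h0 : f 0 ∈ V) (h1 : f 1 ∈ V) (hfV : ∀ t ∈ Ioo (0:ℝ) 1, f t ∉ V) :
    ∃ ρ₀ > 0, ∀ ρ, 0 < ρ → ρ ≤ ρ₀ → ∃ g, Straight V ρ g ∧ SHom V f g ∧
      ∃ t₁ t₂, 0 < t₁ ∧ t₁ < t₂ ∧ t₂ < 1 ∧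
        ∀ t ∈ Icc (1/3 : ℝ) (2/3), g t = f (t₁ + (3 * t - 1) * (t₂ - t₁)) := by
  obtain ⟨ρ₀, hρ₀, H⟩ := exists_far hfin hr hV hf h0 h1 hfV
  have hball : ∀ v ∈ V, ∀ z ∈ Metric.ball v r, z ∈ V → z = v := by
    intro v hv z hz hzV
    by_contra c
    rw [mem_ball_iff_norm] at hz
    linarith [hV z hzV v hv c]
  refine ⟨ρ₀, hρ₀, fun ρ hρ hρ' => ?_⟩
  obtain ⟨t₁, t₂, p1, p2, p3, b1, b2, e1, e2, far⟩ := H ρ hρ hρ'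
  set f₁ := coneAt (f 0) f t₁ with hf₁
  have cont1 : Continuous f₁ := by
    have := (coneAt_continuous hf rfl).comp (show Continuous fun t : ℝ => (t₁, t) by fun_prop)
    simpa [Function.comp_def, max_eq_left p1.le] using this
  have s1 : SHom V f f₁ := SHom.coneAt hf rfl p1 (p2.trans p3) (hball _ h0) h0 b1 hfV
  have hf₁V : ∀ t ∈ Ioo (0:ℝ) 1, f₁ t ∉ V := s1.not_mem_right
  have r1 : ∀ t, t₁ ≤ t → f₁ t = f t := fun t ht => coneAt_of_le p1.le ht rfl
  have l1 : ∀ t, 0 ≤ t → t ≤ t₁ → f₁ t = f 0 + ((t / t₁ : ℝ) : ℂ) * (f t₁ - f 0) :=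
    fun t ht ht' => coneAt_of_ge ht ht'
  have cont1' : Continuous fun t => f₁ (1 - t) := by fun_prop
  have e10 : (fun t => f₁ (1 - t)) 0 = f 1 := by
    simp only [sub_zero]; exact r1 1 (by linarith)
  set f₂ := coneAt (f 1) (fun t => f₁ (1 - t)) (1 - t₂) with hf₂
  have q2 : 0 < 1 - t₂ := by linarith
  have cont2 : Continuous f₂ := by
    have := (coneAt_continuous cont1' e10).comp (show Continuous fun t : ℝ => (1 - t₂, t) by fun_prop)
    simpa [Function.comp_def, max_eq_left q2.le] using this
  have s2 : SHom V (fun t => f₁ (1 - t)) f₂ := by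
    refine SHom.coneAt cont1' e10 q2 (by linarith) (hball _ h1) h1 (fun t ht => ?_) fun t ht => ?_
    · rw [r1 _ (by linarith [ht.2])]
      exact b2 _ ⟨by linarith [ht.2], by linarith [ht.1]⟩
    · exact hf₁V _ ⟨by linarith [ht.2], by linarith [ht.1]⟩
  have s3 := s2.reverse
  simp only [_root_.sub_sub_cancel] at s3
  have s4 : SHom V f fun t => f₂ (1 - t) := s1.trans' s3
  have hf₂V : ∀ t ∈ Ioo (0:ℝ) 1, f₂ (1 - t) ∉ V := s4.not_mem_right
  have m2 : ∀ t, t₁ ≤ t → t ≤ t₂ → f₂ (1 - t) = f t := fun t ht ht' => by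
    rw [hf₂, coneAt_of_le q2.le (by linarith) e10, _root_.sub_sub_cancel, r1 t ht]
  have l2 : ∀ t, 0 ≤ t → t ≤ t₁ → f₂ (1 - t) = f 0 + ((t / t₁ : ℝ) : ℂ) * (f t₁ - f 0) :=
    fun t ht ht' => by
      rw [hf₂, coneAt_of_le q2.le (by linarith) e10, _root_.sub_sub_cancel, l1 t ht ht']
  have r2 : ∀ t, 0 ≤ t → t ≤ 1 - t₂ → f₂ t = f 1 + ((t / (1 - t₂) : ℝ) : ℂ) * (f t₂ - f 1) :=
    fun t ht ht' => by
      rw [hf₂, coneAt_of_ge ht ht', _root_.sub_sub_cancel, r1 _ p2.le]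
  have c2 : Continuous fun t => f₂ (1 - t) := by fun_prop
  have th0 : thirds t₁ t₂ 0 = 0 := by rw [thirds_left le_rfl (by norm_num)]; simp
  have th1 : thirds t₁ t₂ 1 = 1 := by
    have := thirds_right (t₁ := t₁) (t₂ := t₂) (t := 1) (by norm_num) le_rfl
    linarith
  have th13 : thirds t₁ t₂ (1/3) = t₁ := by rw [thirds_mid le_rfl (by norm_num)]; ring
  have th23 : thirds t₁ t₂ (2/3) = t₂ := by rw [thirds_mid (by norm_num) le_rfl]; ring
  have s5 := SHom.of_reparam c2 (thirds_continuous t₁ t₂) th0 th1 (fun t ht => ?_) hf₂V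
  swap
  · rcases le_total t (1/3) with c | c
    · rw [thirds_left ht.1.le c]
      exact ⟨by nlinarith [ht.1], by nlinarith [ht.1]⟩
    rcases le_total t (2/3) with c' | c'
    · rw [thirds_mid c c']
      exact ⟨by nlinarith, by nlinarith⟩
    · have := thirds_right (t₁ := t₁) (t₂ := t₂) c' ht.2.le
      exact ⟨by nlinarith [ht.2], by nlinarith [ht.2]⟩
  set g := fun t => f₂ (1 - thirds t₁ t₂ t) with hg
  have mid : ∀ t ∈ Icc (1/3 : ℝ) (2/3), g t = f (t₁ + (3 * t - 1) * (t₂ - t₁)) := by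
    intro t ht
    simp only [hg]
    rw [thirds_mid ht.1 ht.2]
    exact m2 _ (by nlinarith [ht.1]) (by nlinarith [ht.2])
  have g0 : g 0 = f 0 := by simp only [hg, th0]; rw [l2 0 le_rfl p1.le]; simp
  have g1 : g 1 = f 1 := by simp only [hg, th1]; rw [sub_self, r2 0 le_rfl q2.le]; simp
  have g13 : g (1/3) = f t₁ := by simp only [hg, th13]; exact m2 _ le_rfl p2.le
  have g23 : g (2/3) = f t₂ := by simp only [hg, th23]; exact m2 _ p2.le le_rfl
  refine ⟨g, ⟨?_, g0 ▸ h0, g1 ▸ h1, ?_, ?_, ?_, ?_, ?_⟩, s4.trans' s5.symm, t₁, t₂, p1, p2, p3, mid⟩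
  · have := thirds_continuous t₁ t₂
    exact cont2.comp (by fun_prop)
  · intro t ht
    rw [g0, g13]
    simp only [hg]
    rw [thirds_left ht.1 ht.2, l2 _ (by nlinarith [ht.1]) (by nlinarith [ht.2]),
      mul_div_cancel_left₀ _ p1.ne']
  · intro t ht
    rw [g1, g23]
    simp only [hg]
    rw [thirds_right ht.1 ht.2, r2 _ (mul_nonneg q2.le (by linarith [ht.2])) (by nlinarith [ht.1]),
      mul_div_cancel_left₀ _ q2.ne']
  · intro t ht
    rw [mid t ht]
    exact far _ ⟨by nlinarith [ht.1], by nlinarith [ht.2]⟩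
  · rw [g13, g0, e1]
  · rw [g23, g1, e2]

end SlabPath

namespace SlabPath

open Set Filter

variable {V : Set ℂ} {f g : ℝ → ℂ}

/-- The piecewise linear interpolation of `g` at the multiples of `1 / N` in `[0,1]`. -/
noncomputable def interp (N : ℕ) (g : ℝ → ℂ) (t : ℝ) : ℂ :=
  ∑ j ∈ Finset.range (N + 1), ((max 0 (1 - |N * t - j|) : ℝ) : ℂ) * g (j / N)

lemma interp_continuous (N : ℕ) (g : ℝ → ℂ) : Continuous (interp N g) := by
  unfold interp
  fun_prop

lemma exists_cell {a b : ℕ} (hab : a < b) {x : ℝ} (ha : a ≤ x) (hb : x ≤ b) :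
    ∃ i : ℕ, a ≤ i ∧ i < b ∧ (i : ℝ) ≤ x ∧ x ≤ (i + 1 : ℕ) := by
  have hx : 0 ≤ x := (Nat.cast_nonneg a).trans ha
  rcases hb.eq_or_lt with e | e
  · refine ⟨b - 1, by omega, by omega, ?_, ?_⟩
    · rw [e]; exact_mod_cast Nat.sub_le _ _
    · rw [e, Nat.sub_add_cancel (by omega)]
  · exact ⟨⌊x⌋₊, Nat.le_floor ha, (Nat.floor_lt hx).2 e, Nat.floor_le hx,
      by push_cast; exact (Nat.lt_floor_add_one x).le⟩

lemma interp_eq {N i : ℕ} (hi : i < N) (g : ℝ → ℂ) {t : ℝ} (h : (i : ℝ) ≤ N * t)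
    (h' : N * t ≤ (i + 1 : ℕ)) :
    interp N g t = ((1 - (N * t - i) : ℝ) : ℂ) * g (i / N) +
      ((N * t - i : ℝ) : ℂ) * g ((i + 1 : ℕ) / N) := by
  unfold interp
  rw [Finset.sum_eq_add_of_mem i (i + 1) (by simp; omega) (by simp; omega) (by omega)]
  · push_cast at h' ⊢
    rw [abs_of_nonneg (by linarith), abs_of_nonpos (by linarith), max_eq_right (by linarith),
      max_eq_right (by linarith)]
    congr 2
    all_goals push_cast; ring
  · rintro j - ⟨h1, h2⟩
    have : (1:ℝ) ≤ |N * t - j| := by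
      rcases lt_or_gt_of_ne h1 with c | c
      · have c' : (j:ℝ) + 1 ≤ i := by exact_mod_cast c
        exact le_abs.2 (.inl (by linarith))
      · have c' : (i:ℝ) + 2 ≤ j := by
          have : i + 2 ≤ j := by omega
          exact_mod_cast this
        push_cast at h'
        exact le_abs.2 (.inr (by linarith))
    rw [max_eq_left (by linarith)]
    simp

lemma interp_of_affine {N a b : ℕ} (hb : b ≤ N) (hab : a < b) {A B : ℂ}
    (h : ∀ t ∈ Icc (a / N : ℝ) (b / N), g t = A + t * B) {t : ℝ} (ht : t ∈ Icc (a / N : ℝ) (b / N)) :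
    interp N g t = g t := by
  have hN : (0:ℝ) < N := by exact_mod_cast (by omega : 0 < N)
  obtain ⟨i, h1, h2, h3, h4⟩ := exists_cell hab (x := N * t) ((div_le_iff₀' hN).1 ht.1)
    ((le_div_iff₀' hN).1 ht.2)
  rw [interp_eq (by omega) g h3 h4, h t ht, h, h]
  · push_cast
    have : (N:ℂ) ≠ 0 := by exact_mod_cast hN.ne'
    field_simp
    ring
  · exact ⟨by gcongr; omega, by gcongr; omega⟩
  · exact ⟨by gcongr, by gcongr⟩

lemma eventually_interp (hg : Continuous g) {ε : ℝ} (hε : 0 < ε) :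
    ∀ᶠ N : ℕ in atTop, ∀ t ∈ Icc (0:ℝ) 1, ‖interp N g t - g t‖ < ε := by
  have huc := isCompact_Icc.uniformContinuousOn_of_continuous (hg.continuousOn (s := Icc (0:ℝ) 1))
  obtain ⟨δ, hδ, H⟩ := Metric.uniformContinuousOn_iff.1 huc ε hε
  obtain ⟨N₀, hN₀⟩ := exists_nat_gt (1 / δ)
  filter_upwards [eventually_ge_atTop N₀, eventually_gt_atTop 0] with N hN hN0 t ht
  have hN' : (0:ℝ) < N := by exact_mod_cast hN0
  have hNδ : 1 < N * δ := by
    have : 1 / δ < N := hN₀.trans_le (by exact_mod_cast hN)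
    rwa [div_lt_iff₀ hδ] at this
  obtain ⟨i, -, h2, h3, h4⟩ := exists_cell hN0 (x := N * t) (by simpa using mul_nonneg hN'.le ht.1)
    (by nlinarith [ht.2])
  have m1 : (i / N : ℝ) ∈ Icc (0:ℝ) 1 :=
    ⟨by positivity, (div_le_one hN').2 (by exact_mod_cast h2.le)⟩
  have m2 : ((i + 1 : ℕ) / N : ℝ) ∈ Icc (0:ℝ) 1 :=
    ⟨by positivity, (div_le_one hN').2 (by exact_mod_cast h2)⟩
  have d1 : ‖g (i / N) - g t‖ < ε := by
    rw [← dist_eq_norm]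
    refine H _ m1 _ ht ?_
    rw [Real.dist_eq, abs_lt, lt_sub_iff_add_lt, sub_lt_iff_lt_add, lt_div_iff₀ hN', div_lt_iff₀ hN']
    push_cast at h4
    constructor <;> nlinarith
  have d2 : ‖g ((i + 1 : ℕ) / N) - g t‖ < ε := by
    rw [← dist_eq_norm]
    refine H _ m2 _ ht ?_
    rw [Real.dist_eq, abs_lt, lt_sub_iff_add_lt, sub_lt_iff_lt_add, lt_div_iff₀ hN', div_lt_iff₀ hN']
    push_cast at h4 ⊢
    constructor <;> nlinarith
  rw [← mem_ball_iff_norm] at d1 d2 ⊢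
  rw [interp_eq h2 g h3 h4]
  have := (convex_ball (g t) ε) d1 d2 (a := 1 - (N * t - i)) (b := N * t - i)
    (by push_cast at h4; linarith) (by linarith) (by ring)
  simpa only [Complex.real_smul] using this

namespace Straight

variable {ρ : ℝ}

lemma interp_eq_self {M : ℕ} (hM : 0 < M) (hg : Straight V ρ g) {t : ℝ} (ht : t ∈ Icc (0:ℝ) 1)
    (h : t ∉ Icc (1/3 : ℝ) (2/3)) : interp (3 * M) g t = g t := by
  have hM' : (0:ℝ) < M := by exact_mod_cast hM
  have e1 : ((0 : ℕ) / (3 * M : ℕ) : ℝ) = 0 := by simp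
  have e2 : ((M : ℕ) / (3 * M : ℕ) : ℝ) = 1/3 := by push_cast; field_simp
  have e3 : ((2 * M : ℕ) / (3 * M : ℕ) : ℝ) = 2/3 := by push_cast; field_simp
  have e4 : ((3 * M : ℕ) / (3 * M : ℕ) : ℝ) = 1 := by push_cast; field_simp
  by_cases c : t ≤ 1/3
  · refine interp_of_affine (a := 0) (b := M) (A := g 0) (B := 3 * (g (1/3) - g 0)) (by omega) hM
      (fun s hs => ?_) ?_
    · rw [e1, e2] at hs
      rw [hg.left s hs]; push_cast; ring
    · rw [e1, e2]; exact ⟨ht.1, c⟩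
  · have c' : 2/3 ≤ t := by
      by_contra! c'
      exact h ⟨by linarith, c'.le⟩
    refine interp_of_affine (a := 2 * M) (b := 3 * M) (A := g 1 + 3 * (g (2/3) - g 1))
      (B := - 3 * (g (2/3) - g 1)) (by omega) (by omega) (fun s hs => ?_) ?_
    · rw [e3, e4] at hs
      rw [hg.right s hs]; push_cast; ring
    · rw [e3, e4]; exact ⟨c', ht.2⟩

lemma interp_zero {M : ℕ} (hM : 0 < M) (hg : Straight V ρ g) : interp (3 * M) g 0 = g 0 :=
  hg.interp_eq_self hM (by simp) (by norm_num)

lemma interp_one {M : ℕ} (hM : 0 < M) (hg : Straight V ρ g) : interp (3 * M) g 1 = g 1 :=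
  hg.interp_eq_self hM (by simp) (by norm_num)

lemma eventually_sHom (hρ : 0 < ρ) (hV : ∀ u ∈ V, ∀ w ∈ V, u ≠ w → 2 * ρ ≤ ‖u - w‖)
    (hg : Straight V ρ g) : ∀ᶠ M : ℕ in atTop, SHom V g (interp (3 * M) g) := by
  have h3 : Tendsto (fun M : ℕ => 3 * M) atTop atTop :=
    tendsto_atTop_mono (fun M => by omega : ∀ M : ℕ, M ≤ 3 * M) tendsto_id
  filter_upwards [h3.eventually (eventually_interp hg.cont hρ), eventually_gt_atTop 0] with M hM hM0
  refine Hom.linear hg.cont (interp_continuous _ _) (hg.interp_zero hM0).symm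
    (hg.interp_one hM0).symm fun s hs t ht => ?_
  by_cases c : t ∈ Icc (1/3 : ℝ) (2/3)
  · intro hm
    have h1 := hg.far t c _ hm
    have h2 : ((1 - s : ℝ) : ℂ) * g t + (s : ℂ) * interp (3 * M) g t ∈ Metric.ball (g t) ρ := by
      have h2 := (convex_ball (g t) ρ) (Metric.mem_ball_self hρ)
        (mem_ball_iff_norm.2 (hM t ⟨ht.1.le, ht.2.le⟩)) (a := 1 - s) (b := s)
        (by linarith [hs.2]) hs.1 (by ring)
      simpa only [Complex.real_smul] using h2
    rw [mem_ball_iff_norm, norm_sub_rev] at h2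
    linarith
  · rw [hg.interp_eq_self hM0 ⟨ht.1.le, ht.2.le⟩ c, ← add_mul, ← Complex.ofReal_add]
    simpa using hg.not_mem hρ hV ht

lemma eventually_ne (hρ : 0 < ρ) {g' : ℝ → ℂ} (hg : Straight V ρ g) (hg' : Straight V ρ g')
    (h : ∀ t ∈ Ioo (0:ℝ) 1, ∀ t' ∈ Ioo (0:ℝ) 1, g t ≠ g' t') :
    ∀ᶠ M : ℕ in atTop, ∀ t ∈ Icc (1/3 : ℝ) (2/3), ∀ t' ∈ Ioo (0:ℝ) 1,
      interp (3 * M) g t ≠ interp (3 * M) g' t' := by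
  have h3 : Tendsto (fun M : ℕ => 3 * M) atTop atTop :=
    tendsto_atTop_mono (fun M => by omega : ∀ M : ℕ, M ≤ 3 * M) tendsto_id
  have hK : IsCompact (Icc (1/3 : ℝ) (2/3) ×ˢ Icc (0:ℝ) 1) := isCompact_Icc.prod isCompact_Icc
  have hc := hg.cont
  have hc' := hg'.cont
  obtain ⟨p, hp, hmin⟩ := hK.exists_isMinOn ⟨(1/3, 0), by norm_num⟩
    (f := fun p : ℝ × ℝ => ‖g p.1 - g' p.2‖) (by fun_prop)
  have hpos : 0 < ‖g p.1 - g' p.2‖ := by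
    have hend : ∀ z ∈ V, 0 < ‖g p.1 - z‖ := fun z hz => hρ.trans_le (hg.far _ hp.1 z hz)
    rcases hp.2.1.eq_or_lt with e | e
    · rw [← e]; exact hend _ hg'.zero
    rcases hp.2.2.eq_or_lt with e' | e'
    · rw [e']; exact hend _ hg'.one
    · rw [norm_pos_iff, sub_ne_zero]
      exact h _ ⟨by linarith [hp.1.1], by linarith [hp.1.2]⟩ _ ⟨e, e'⟩
  filter_upwards [h3.eventually (eventually_interp hg.cont (half_pos hpos)),
    h3.eventually (eventually_interp hg'.cont (half_pos hpos))] with M hM hM' t ht t' ht' e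
  have h1 := hM t ⟨by linarith [ht.1], by linarith [ht.2]⟩
  have h2 := hM' t' ⟨ht'.1.le, ht'.2.le⟩
  have h4 : ‖g p.1 - g' p.2‖ ≤ ‖g t - g' t'‖ := hmin (a := (t, t')) ⟨ht, ht'.1.le, ht'.2.le⟩
  rw [← e] at h2
  rw [norm_sub_rev] at h1
  have := norm_sub_le_norm_sub_add_norm_sub (g t) (interp (3 * M) g t) (g' t')
  linarith

lemma eventually_ne' (hρ : 0 < ρ) {g' : ℝ → ℂ} (hg : Straight V ρ g) (hg' : Straight V ρ g')
    (h : ∀ t ∈ Ioo (0:ℝ) 1, ∀ t' ∈ Ioo (0:ℝ) 1, g t ≠ g' t') :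
    ∀ᶠ M : ℕ in atTop, ∀ t ∈ Ioo (0:ℝ) 1, ∀ t' ∈ Ioo (0:ℝ) 1,
      interp (3 * M) g t ≠ interp (3 * M) g' t' := by
  filter_upwards [hg.eventually_ne hρ hg' h, hg'.eventually_ne hρ hg fun t ht t' ht' e =>
    h t' ht' t ht e.symm, eventually_gt_atTop 0] with M h1 h2 hM t ht t' ht'
  by_cases c : t ∈ Icc (1/3 : ℝ) (2/3)
  · exact h1 t c t' ht'
  by_cases c' : t' ∈ Icc (1/3 : ℝ) (2/3)
  · exact (h2 t' c' t ht).symm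
  · rw [hg.interp_eq_self hM ⟨ht.1.le, ht.2.le⟩ c, hg'.interp_eq_self hM ⟨ht'.1.le, ht'.2.le⟩ c']
    exact h t ht t' ht'

/-- If `g` is simple, then points of an interpolation which meet are close in time. -/
lemma eventually_close (hρ : 0 < ρ) (hg : Straight V ρ g) (h : InjOn g (Ioo 0 1)) {η : ℝ} (hη : 0 < η) :
    ∀ᶠ M : ℕ in atTop, ∀ t ∈ Icc (1/3 : ℝ) (2/3), ∀ t' ∈ Ioo (0:ℝ) 1,
      interp (3 * M) g t = interp (3 * M) g t' → |t - t'| < η := by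
  have h3 : Tendsto (fun M : ℕ => 3 * M) atTop atTop :=
    tendsto_atTop_mono (fun M => by omega : ∀ M : ℕ, M ≤ 3 * M) tendsto_id
  have hK : IsCompact ((Icc (1/3 : ℝ) (2/3) ×ˢ Icc (0:ℝ) 1) ∩ {p : ℝ × ℝ | η ≤ |p.1 - p.2|}) :=
    (isCompact_Icc.prod isCompact_Icc).inter_right (isClosed_le (by fun_prop) (by fun_prop))
  have hc := hg.cont
  rcases ((Icc (1/3 : ℝ) (2/3) ×ˢ Icc (0:ℝ) 1) ∩ {p : ℝ × ℝ | η ≤ |p.1 - p.2|}).eq_empty_or_nonempty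
    with c | c
  · refine .of_forall fun M t ht t' ht' _ => ?_
    by_contra! h'
    have : (t, t') ∈ (∅ : Set (ℝ × ℝ)) := c ▸ ⟨⟨ht, ht'.1.le, ht'.2.le⟩, h'⟩
    exact this
  obtain ⟨p, hp, hmin⟩ := hK.exists_isMinOn c
    (f := fun p : ℝ × ℝ => ‖g p.1 - g p.2‖) (by fun_prop)
  have hpos : 0 < ‖g p.1 - g p.2‖ := by
    have hend : ∀ z ∈ V, 0 < ‖g p.1 - z‖ := fun z hz => hρ.trans_le (hg.far _ hp.1.1 z hz)
    rcases hp.1.2.1.eq_or_lt with e | e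
    · rw [← e]; exact hend _ hg.zero
    rcases hp.1.2.2.eq_or_lt with e' | e'
    · rw [e']; exact hend _ hg.one
    · rw [norm_pos_iff, sub_ne_zero]
      intro e4
      have h5 := h ⟨by linarith [hp.1.1.1], by linarith [hp.1.1.2]⟩ ⟨e, e'⟩ e4
      have h6 : η ≤ |p.1 - p.2| := hp.2
      rw [h5] at h6
      simp at h6
      linarith
  filter_upwards [h3.eventually (eventually_interp hg.cont (half_pos hpos))] with M hM t ht t' ht' e
  by_contra! h'
  have h1 := hM t ⟨by linarith [ht.1], by linarith [ht.2]⟩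
  have h2 := hM t' ⟨ht'.1.le, ht'.2.le⟩
  have h4 : ‖g p.1 - g p.2‖ ≤ ‖g t - g t'‖ := hmin (a := (t, t')) ⟨⟨ht, ht'.1.le, ht'.2.le⟩, h'⟩
  rw [← e] at h2
  rw [norm_sub_rev] at h1
  have := norm_sub_le_norm_sub_add_norm_sub (g t) (interp (3 * M) g t) (g t')
  linarith

lemma eventually_locSimple (hρ : 0 < ρ) (hV : ∀ u ∈ V, ∀ w ∈ V, u ≠ w → 2 * ρ ≤ ‖u - w‖)
    (hg : Straight V ρ g) (h : InjOn g (Ioo 0 1)) :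
    ∀ᶠ M : ℕ in atTop, Pts.LocSimple V (interp (3 * M) g) := by
  have h3 : Tendsto (fun M : ℕ => 3 * M) atTop atTop :=
    tendsto_atTop_mono (fun M => by omega : ∀ M : ℕ, M ≤ 3 * M) tendsto_id
  have huc := isCompact_Icc.uniformContinuousOn_of_continuous (hg.cont.continuousOn (s := Icc (0:ℝ) 1))
  obtain ⟨η, hη, H⟩ := Metric.uniformContinuousOn_iff.1 huc (ρ/2) (half_pos hρ)
  filter_upwards [hg.eventually_close hρ h hη,
    h3.eventually (eventually_interp hg.cont (half_pos hρ)), eventually_gt_atTop 0] with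
    M hM hM2 hM0 t ht t' ht' htt e
  have key : ∀ c ∈ Icc (1/3 : ℝ) (2/3), (∀ s ∈ Icc t t', |s - c| < η) →
      ∃ C, Convex ℝ C ∧ Disjoint C V ∧ interp (3 * M) g '' Icc t t' ⊆ C := by
    intro c hc hs
    refine ⟨Metric.ball (g c) ρ, convex_ball _ _, ?_, ?_⟩
    · rw [Set.disjoint_left]
      intro z hz hzV
      rw [mem_ball_iff_norm, norm_sub_rev] at hz
      linarith [hg.far c hc z hzV]
    · rintro _ ⟨s, hst, rfl⟩
      have s01 : s ∈ Icc (0:ℝ) 1 := ⟨ht.1.le.trans hst.1, hst.2.trans ht'.2.le⟩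
      have h1 := H s s01 c ⟨by linarith [hc.1], by linarith [hc.2]⟩ (by
        rw [Real.dist_eq]; exact hs s hst)
      rw [dist_eq_norm] at h1
      have h2 := hM2 s s01
      rw [mem_ball_iff_norm]
      have := norm_sub_le_norm_sub_add_norm_sub (interp (3 * M) g s) (g s) (g c)
      linarith
  by_cases c : t ∈ Icc (1/3 : ℝ) (2/3)
  · have := abs_lt.1 (hM t c t' ht' e)
    exact key t c fun s hs => abs_lt.2 ⟨by linarith [hs.1], by linarith [hs.2]⟩
  by_cases c' : t' ∈ Icc (1/3 : ℝ) (2/3)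
  · have := abs_lt.1 (hM t' c' t ht e.symm)
    exact key t' c' fun s hs => abs_lt.2 ⟨by linarith [hs.1], by linarith [hs.2]⟩
  · have e1 := hg.interp_eq_self hM0 ⟨ht.1.le, ht.2.le⟩ c
    have e2 := hg.interp_eq_self hM0 ⟨ht'.1.le, ht'.2.le⟩ c'
    have htt' : t = t' := h ht ht' (by rw [← e1, e, e2])
    subst htt'
    refine ⟨{g t}, convex_singleton _, ?_, ?_⟩
    · rw [Set.disjoint_singleton_left]
      exact hg.not_mem hρ hV ht
    · simp [e1]

end Straight

end SlabPath

namespace SlabPath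

open Set Filter

variable {V : Set ℂ} {f g : ℝ → ℂ}

/-- The shear `(x, y) ↦ (x + a y, y)`. -/
noncomputable def shear (a : ℝ) : ℂ ≃L[ℝ] ℂ :=
  ContinuousLinearEquiv.equivOfInverse
    (ContinuousLinearMap.id ℝ ℂ + a • Complex.ofRealCLM.comp Complex.imCLM)
    (ContinuousLinearMap.id ℝ ℂ - a • Complex.ofRealCLM.comp Complex.imCLM)
    (fun z => by apply Complex.ext <;> simp) (fun z => by apply Complex.ext <;> simp)

lemma shear_re (a : ℝ) (z : ℂ) : (shear a z).re = z.re + a * z.im := by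
  simp [shear]

lemma exists_shear {S : Set ℂ} (hS : S.Finite) :
    ∃ a, ∀ z ∈ S, ∀ w ∈ S, (shear a z).re = (shear a w).re → z = w := by
  have hfin : ((fun p : ℂ × ℂ => -(p.1.re - p.2.re) / (p.1.im - p.2.im)) '' (S ×ˢ S)).Finite :=
    (hS.prod hS).image _
  obtain ⟨a, ha⟩ := hfin.exists_notMem
  refine ⟨a, fun z hz w hw h => ?_⟩
  rw [shear_re, shear_re] at h
  by_contra hne
  by_cases c : z.im = w.im
  · rw [c] at h
    exact hne (Complex.ext (by linarith) c)
  · refine ha ⟨(z, w), ⟨hz, hw⟩, ?_⟩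
    have : z.im - w.im ≠ 0 := sub_ne_zero.2 c
    simp only
    rw [div_eq_iff this]
    linarith

lemma Pts.exists_eq {W : Set ℂ} (hW : W.Finite) (hre : InjOn Complex.re W) :
    ∃ P : Pts W.ncard, P.V = W := by
  classical
  set s : Finset ℝ := hW.toFinset.image Complex.re with hs
  have hcard : s.card = W.ncard := by
    rw [hs, Finset.card_image_of_injOn (by simpa using hre), Set.ncard_eq_toFinset_card W hW]
  let o := s.orderEmbOfFin hcard
  have ho : ∀ i, ∃ z ∈ W, z.re = o i := fun i => by
    obtain ⟨z, hz, e⟩ := Finset.mem_image.1 (Finset.orderEmbOfFin_mem s hcard i)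
    exact ⟨z, hW.mem_toFinset.1 hz, e⟩
  choose z hzW hz using ho
  refine ⟨⟨fun i => if h : i < W.ncard then z ⟨i, h⟩ else 0, fun i j hij hj => ?_⟩, ?_⟩
  · rw [dif_pos (hij.trans hj), dif_pos hj, hz, hz]
    exact o.strictMono hij
  · ext w
    constructor
    · rintro ⟨i, hi, rfl⟩
      simp only [dif_pos hi]
      exact hzW _
    · intro hw
      have : w.re ∈ Set.range o := by
        rw [Finset.range_orderEmbOfFin]
        simpa [hs] using ⟨w, hw, rfl⟩
      obtain ⟨i, hi⟩ := this
      refine ⟨i, i.2, ?_⟩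
      simp only [dif_pos i.2]
      exact hre hw (hzW i) (by rw [hz, hi])

lemma Hom.map {U : Set ℝ} (Φ : ℂ ≃L[ℝ] ℂ) (h : Hom U V f g) :
    Hom U (Φ '' V) (fun t => Φ (f t)) fun t => Φ (g t) := by
  obtain ⟨H, hc, h0, h1, he, hV⟩ := h
  refine ⟨fun p => Φ (H p), Φ.continuous.comp hc, by simp [h0], by simp [h1],
    fun s hs => ?_, fun s hs t ht => ?_⟩
  · simp only [he s hs]; simp
  · rw [Φ.injective.mem_set_image]
    exact hV s hs t ht

lemma Hom.of_map {U : Set ℝ} (Φ : ℂ ≃L[ℝ] ℂ) (h : Hom U (Φ '' V) (fun t => Φ (f t)) fun t => Φ (g t)) :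
    Hom U V f g := by
  have := h.map Φ.symm
  simpa [← image_comp, Function.comp_def] using this

lemma Pts.LocSimple.map (Φ : ℂ ≃L[ℝ] ℂ) (h : Pts.LocSimple V f) :
    Pts.LocSimple (Φ '' V) fun t => Φ (f t) := by
  intro t ht t' ht' htt e
  obtain ⟨C, h1, h2, h3⟩ := h t ht t' ht' htt (Φ.injective e)
  refine ⟨Φ '' C, h1.linear_image Φ.toLinearEquiv.toLinearMap, (disjoint_image_iff Φ.injective).2 h2, ?_⟩
  rw [← Set.image_image]
  exact image_mono h3

section transverse

variable {N : ℕ} (Φ : ℂ ≃L[ℝ] ℂ)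

lemma re_map_interp {i : ℕ} (hi : i < N) {t : ℝ} (h : (i : ℝ) ≤ N * t)
    (h' : N * t ≤ (i + 1 : ℕ)) :
    (Φ (interp N g t)).re = (1 - (N * t - i)) * (Φ (g (i / N))).re +
      (N * t - i) * (Φ (g ((i + 1 : ℕ) / N))).re := by
  rw [interp_eq hi g h h', map_add, ← Complex.real_smul, ← Complex.real_smul, map_smul, map_smul]
  simp

/-- Away from its breakpoints, a generic piecewise linear curve crosses vertical lines
transversally. -/
lemma interp_cross (hN : 2 ≤ N) {c : ℝ} (hS : ∀ i, 0 < i → i < N → (Φ (g ((i : ℕ) / N))).re ≠ c)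
    {i : ℕ} (hi : i < N) {t : ℝ} (ht : t ∈ Ioo (0:ℝ) 1) (h : (i : ℝ) ≤ N * t)
    (h' : N * t ≤ (i + 1 : ℕ)) (e : (Φ (interp N g t)).re = c) :
    (i : ℝ) < N * t ∧ N * t < (i + 1 : ℕ) ∧ (Φ (g (i / N))).re ≠ (Φ (g ((i + 1 : ℕ) / N))).re := by
  have hN' : (0:ℝ) < N := by exact_mod_cast (by omega : 0 < N)
  rw [re_map_interp Φ hi h h'] at e
  refine ⟨lt_of_le_of_ne h fun c1 => ?_, lt_of_le_of_ne h' fun c1 => ?_, fun c1 => ?_⟩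
  · have : 0 < i := by
      have : (0:ℝ) < i := by rw [c1]; exact mul_pos hN' ht.1
      exact_mod_cast this
    rw [← c1] at e
    exact hS i this hi (by linarith)
  · have : i + 1 < N := by
      have : ((i + 1 : ℕ) : ℝ) < N := by rw [← c1]; nlinarith [ht.2]
      exact_mod_cast this
    rw [c1] at e
    refine hS (i + 1) (by omega) this ?_
    rw [← e]; push_cast; ring
  · rcases Nat.eq_zero_or_pos i with c2 | c2
    · refine hS (i + 1) (by omega) (by omega) ?_
      rw [← c1] at e ⊢
      linarith
    · refine hS i c2 hi ?_
      rw [← c1] at e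
      linarith

lemma transverse_interp {n : ℕ} {P : Pts n} (hP : P.V = Φ '' V) (hN : 2 ≤ N) (h0 : interp N g 0 ∈ V)
    (h1 : interp N g 1 ∈ V) (hV : ∀ t ∈ Ioo (0:ℝ) 1, interp N g t ∉ V)
    (hS : ∀ i, 0 < i → i < N → ∀ u ∈ V, (Φ (g ((i : ℕ) / N))).re ≠ (Φ u).re) :
    P.Transverse fun t => Φ (interp N g t) := by
  have hN' : (0:ℝ) < N := by exact_mod_cast (by omega : 0 < N)
  have hS' : ∀ l < n, ∀ i, 0 < i → i < N → (Φ (g ((i : ℕ) / N))).re ≠ (P.v l).re := by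
    intro l hl i hi hiN
    have : P.v l ∈ Φ '' V := hP ▸ ⟨l, hl, rfl⟩
    obtain ⟨u, hu, e⟩ := this
    rw [← e]
    exact hS i hi hiN u hu
  have cell : ∀ t ∈ Ioo (0:ℝ) 1, ∃ i : ℕ, 0 ≤ i ∧ i < N ∧ (i : ℝ) ≤ N * t ∧ N * t ≤ (i + 1 : ℕ) :=
    fun t ht => exists_cell (by omega) (by simpa using mul_nonneg hN'.le ht.1.le) (by nlinarith [ht.2])
  refine ⟨Φ.continuous.comp (interp_continuous N g), hP ▸ mem_image_of_mem _ h0,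
    hP ▸ mem_image_of_mem _ h1, fun t ht => ?_, ?_, ?_⟩
  · rw [hP, Φ.injective.mem_set_image]
    exact hV t ht
  · have : {t ∈ Ioo (0:ℝ) 1 | ∃ l < n, (Φ (interp N g t)).re = (P.v l).re} ⊆
        ⋃ i ∈ Finset.range N, ⋃ l ∈ Finset.range n, {t | t ∈ Ioo (0:ℝ) 1 ∧ (i : ℝ) ≤ N * t ∧
          N * t ≤ (i + 1 : ℕ) ∧ (Φ (interp N g t)).re = (P.v l).re} := by
      rintro t ⟨ht, l, hl, e⟩
      obtain ⟨i, -, hi, h2, h3⟩ := cell t ht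
      simp only [mem_iUnion, Finset.mem_range]
      exact ⟨i, hi, l, hl, ht, h2, h3, e⟩
    refine Finite.subset (Finite.biUnion (Finset.finite_toSet _) fun i hi =>
      Finite.biUnion (Finset.finite_toSet _) fun l hl => Subsingleton.finite ?_) this
    simp only [Finset.coe_range, mem_Iio] at hi hl
    rintro t ⟨ht, h2, h3, e⟩ t' ⟨ht', h2', h3', e'⟩
    obtain ⟨-, -, hne⟩ := interp_cross Φ hN (hS' l hl) hi ht h2 h3 e
    rw [← e', re_map_interp Φ hi h2 h3, re_map_interp Φ hi h2' h3'] at e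
    have : (N * (t - t')) * ((Φ (g ((i + 1 : ℕ) / N))).re - (Φ (g (i / N))).re) = 0 := by
      linear_combination e
    have h4 := (mul_eq_zero.1 this).resolve_right (sub_ne_zero.2 hne.symm)
    exact sub_eq_zero.1 ((mul_eq_zero.1 h4).resolve_left hN'.ne')
  · intro t ht l hl e
    obtain ⟨i, -, hi, h2, h3⟩ := cell t ht
    obtain ⟨h4, h5, hne⟩ := interp_cross Φ hN (hS' l hl) hi ht h2 h3 e
    have hval : ∀ s, (i : ℝ) ≤ N * s → N * s ≤ (i + 1 : ℕ) → (Φ (interp N g s)).re - (P.v l).re =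
        N * (s - t) * ((Φ (g ((i + 1 : ℕ) / N))).re - (Φ (g (i / N))).re) := by
      intro s hs hs'
      rw [← e, re_map_interp Φ hi h2 h3, re_map_interp Φ hi hs hs']
      ring
    refine ⟨min (t - i / N) ((i + 1 : ℕ) / N - t), lt_min ?_ ?_, fun t₁ ht₁ t₂ ht₂ => ?_⟩
    · rw [sub_pos, div_lt_iff₀' hN']; exact h4
    · rw [sub_pos, lt_div_iff₀' hN']; exact h5
    · have a1 : (i / N : ℝ) < t₁ := by
        linarith [ht₁.1, min_le_left (t - i / N : ℝ) ((i + 1 : ℕ) / N - t)]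
      have a2 : t₂ < ((i + 1 : ℕ) / N : ℝ) := by
        linarith [ht₂.2, min_le_right (t - i / N : ℝ) ((i + 1 : ℕ) / N - t)]
      rw [div_lt_iff₀' hN'] at a1
      rw [lt_div_iff₀' hN'] at a2
      rw [hval t₁ a1.le (by nlinarith [ht₁.2]), hval t₂ (by nlinarith [ht₂.1]) a2.le]
      have d2 : 0 < ((Φ (g ((i + 1 : ℕ) / N))).re - (Φ (g (i / N))).re) ^ 2 :=
        sq_pos_of_ne_zero (sub_ne_zero.2 hne.symm)
      have d1 : 0 < (t - t₁) * (t₂ - t) := mul_pos (by linarith [ht₁.2]) (by linarith [ht₂.1])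
      have := mul_pos (mul_pos (mul_pos hN' hN') d1) d2
      linarith
end transverse

lemma exists_separation (hV : V.Finite) : ∃ r > 0, ∀ u ∈ V, ∀ w ∈ V, u ≠ w → 2 * r ≤ ‖u - w‖ := by
  by_cases h : V.Nontrivial
  · have hpos : 0 < V.infsep := Set.infsep_pos.2 ⟨hV.einfsep_pos, h.einfsep_lt_top⟩
    refine ⟨V.infsep / 2, half_pos hpos, fun u hu w hw hne => ?_⟩
    rw [mul_div_cancel₀ _ two_ne_zero, ← dist_eq_norm]
    exact Set.infsep_le_dist_of_mem hu hw hne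
  · exact ⟨1, one_pos, fun u hu w hw hne => absurd (Set.not_nontrivial_iff.1 h hu hw) hne⟩

/-- A family of pairwise non-homotopic curves without trivial loops. -/
structure CurveFamily (V : Set ℂ) {E : Type} (f : E → ℝ → ℂ) : Prop where
  cont : ∀ e, Continuous (f e)
  zero : ∀ e, f e 0 ∈ V
  one : ∀ e, f e 1 ∈ V
  not_mem : ∀ e, ∀ t ∈ Ioo (0:ℝ) 1, f e t ∉ V
  nontriv : ∀ e, ¬ TrivHom V (f e)
  not_hom : ∀ e e', e ≠ e' → ¬ SHom V (f e) (f e')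
  not_hom' : ∀ e e', e ≠ e' → ¬ SHom V (f e) fun t => f e' (1 - t)

namespace CurveFamily

variable {E : Type} {f : E → ℝ → ℂ}

lemma congr {g : E → ℝ → ℂ} (hf : CurveFamily V f) (hg : ∀ e, Continuous (g e))
    (h : ∀ e, SHom V (f e) (g e)) : CurveFamily V g where
  cont := hg
  zero e := (h e).left.1 ▸ hf.zero e
  one e := (h e).left.2 ▸ hf.one e
  not_mem e := (h e).not_mem_right
  nontriv e ht := hf.nontriv e ((h e).trivHom ht)
  not_hom e e' hne hh := hf.not_hom e e' hne (((h e).trans' hh).trans' (h e').symm)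
  not_hom' e e' hne hh := hf.not_hom' e e' hne (((h e).trans' hh).trans' (h e').reverse.symm)

/-- A family of disjoint curves can be replaced by piecewise linear curves. -/
lemma exists_interp [Finite E] (hfin : V.Finite) (hf : CurveFamily V f)
    (hd : ∀ e e', e ≠ e' → ∀ t ∈ Ioo (0:ℝ) 1, ∀ t' ∈ Ioo (0:ℝ) 1, f e t ≠ f e' t') :
    ∃ N ≥ 2, ∃ g : E → ℝ → ℂ, CurveFamily V (fun e => interp N (g e)) ∧
      (∀ e, ∀ i, 0 < i → i < N → g e ((i : ℕ) / N) ∉ V) ∧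
      (∀ e e', e ≠ e' → ∀ t ∈ Ioo (0:ℝ) 1, ∀ t' ∈ Ioo (0:ℝ) 1,
        interp N (g e) t ≠ interp N (g e') t') ∧
      ∀ e, InjOn (f e) (Ioo 0 1) → Pts.LocSimple V (interp N (g e)) := by
  obtain ⟨r, hr, hV⟩ := exists_separation hfin
  choose ρ₀ hρ₀ H using fun e => exists_straight hfin hr hV (hf.cont e) (hf.zero e) (hf.one e)
    (hf.not_mem e)
  obtain ⟨ρ, hρ, hρr, hρE⟩ : ∃ ρ > 0, ρ ≤ r ∧ ∀ e, ρ ≤ ρ₀ e := by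
    rcases isEmpty_or_nonempty E with _ | _
    · exact ⟨r, hr, le_rfl, fun e => isEmptyElim e⟩
    · obtain ⟨e, he⟩ := Finite.exists_min ρ₀
      exact ⟨min r (ρ₀ e), lt_min hr (hρ₀ e), min_le_left _ _, fun e' => (min_le_right _ _).trans (he e')⟩
  have hV' : ∀ u ∈ V, ∀ w ∈ V, u ≠ w → 2 * ρ ≤ ‖u - w‖ := fun u hu w hw hne =>
    (by linarith : 2 * ρ ≤ 2 * r).trans (hV u hu w hw hne)
  choose g hg hh t₁ t₂ p1 p2 p3 mid using fun e => H e ρ hρ (hρE e)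
  have mem : ∀ e, ∀ t ∈ Icc (1/3 : ℝ) (2/3), t₁ e + (3 * t - 1) * (t₂ e - t₁ e) ∈ Ioo (0:ℝ) 1 := by
    intro e t ht
    have := p1 e
    have := p2 e
    have := p3 e
    constructor <;> nlinarith [ht.1, ht.2]
  have hgd : ∀ e e', e ≠ e' → ∀ t ∈ Ioo (0:ℝ) 1, ∀ t' ∈ Ioo (0:ℝ) 1, g e t ≠ g e' t' := by
    intro e e' hne t ht t' ht' h
    have := ((hg e).collision hρ hV' (hg e') ht ht' h).2
    rw [mid e _ (toMid_mem t), mid e' _ (toMid_mem t')] at this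
    exact hd e e' hne _ (mem e _ (toMid_mem t)) _ (mem e' _ (toMid_mem t')) this
  have hgi : ∀ e, InjOn (f e) (Ioo 0 1) → InjOn (g e) (Ioo 0 1) := by
    intro e hi t ht t' ht' h
    obtain ⟨h1, h2⟩ := (hg e).collision hρ hV' (hg e) ht ht' h
    rw [mid e _ (toMid_mem t), mid e _ (toMid_mem t')] at h2
    have h3 := hi (mem e _ (toMid_mem t)) (mem e _ (toMid_mem t')) h2
    refine eq_of_toMid_eq ?_ h1
    have h4 : (3 * toMid t - 1) = (3 * toMid t' - 1) :=
      mul_right_cancel₀ (sub_ne_zero.2 (p2 e).ne') (add_left_cancel h3)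
    linarith
  obtain ⟨M, h1, h2, h3, h4⟩ := ((eventually_all.2 fun e => (hg e).eventually_sHom hρ hV').and
    ((eventually_all.2 fun e => eventually_all.2 fun e' => eventually_all.2 fun hne : e ≠ e' =>
      (hg e).eventually_ne' hρ (hg e') (hgd e e' hne)).and
    ((eventually_all.2 fun e => eventually_all.2 fun hi : InjOn (f e) (Ioo 0 1) =>
      (hg e).eventually_locSimple hρ hV' (hgi e hi)).and (eventually_gt_atTop 0)))).exists
  refine ⟨3 * M, by omega, g, hf.congr (fun e => interp_continuous _ _) fun e => (hh e).trans' (h1 e),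
    fun e i hi hiN => (hh e).not_mem_right _ ?_, h2, h3⟩
  have hN : (0:ℝ) < (3 * M : ℕ) := by exact_mod_cast (by omega : 0 < 3 * M)
  exact ⟨div_pos (by exact_mod_cast hi) hN, (div_lt_one hN).2 (by exact_mod_cast hiN)⟩

/-- Curves of a non-homotopic family with disjoint interiors. -/
theorem card_le [Fintype E] (hfin : V.Finite) (hf : CurveFamily V f)
    (hd : ∀ e e', e ≠ e' → ∀ t ∈ Ioo (0:ℝ) 1, ∀ t' ∈ Ioo (0:ℝ) 1, f e t ≠ f e' t') :
    Fintype.card E ≤ 11 * V.ncard ∧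
      ((∀ e, InjOn (f e) (Ioo 0 1)) → Fintype.card E ≤ 3 * V.ncard) := by
  obtain ⟨N, hN, g, hg, hgV, hgd, hl⟩ := hf.exists_interp hfin hd
  have hSfin : (V ∪ ⋃ e, ⋃ i ∈ Finset.range N, {g e ((i : ℕ) / N)}).Finite :=
    hfin.union (finite_iUnion fun e => Finite.biUnion (Finset.finite_toSet _) fun _ _ =>
      finite_singleton _)
  obtain ⟨a, ha⟩ := exists_shear hSfin
  set Φ := shear a
  have hre : InjOn Complex.re (Φ '' V) := by
    rintro _ ⟨z, hz, rfl⟩ _ ⟨w, hw, rfl⟩ e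
    rw [ha z (.inl hz) w (.inl hw) e]
  obtain ⟨P, hP⟩ := Pts.exists_eq (hfin.image Φ) hre
  rw [← ncard_image_of_injective V Φ.injective]
  have htr : ∀ e, P.Transverse fun t => Φ (interp N (g e) t) := by
    intro e
    refine transverse_interp Φ hP hN (hg.zero e) (hg.one e) (hg.not_mem e) fun i hi hiN u hu h => ?_
    have := ha _ (.inr (mem_iUnion.2 ⟨e, mem_iUnion₂.2 ⟨i, by simpa using hiN, rfl⟩⟩)) u (.inl hu) h
    exact hgV e i hi hiN (this ▸ hu)
  let F : P.Family E :=
    { φ := fun e t => Φ (interp N (g e) t)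
      track := fun e => (htr e).exists_track.some
      cont := fun e => (htr e).cont
      nontriv := fun e h => hg.nontriv e (Hom.of_map Φ (hP ▸ h))
      not_hom := fun e e' hne h => hg.not_hom e e' hne (Hom.of_map Φ (hP ▸ h))
      not_hom' := fun e e' hne h => hg.not_hom' e e' hne
        (Hom.of_map (g := fun t => interp N (g e') (1 - t)) Φ (hP ▸ h)) }
  have hd' : ∀ e e', e ≠ e' → ∀ t ∈ Ioo (0:ℝ) 1, ∀ t' ∈ Ioo (0:ℝ) 1, F.φ e t ≠ F.φ e' t' :=
    fun e e' hne t ht t' ht' h => hgd e e' hne t ht t' ht' (Φ.injective h)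
  refine ⟨F.card_le_eleven_mul hd', fun hi => F.card_le_three_mul hd' fun e => ?_⟩
  rw [hP]
  exact (hl e (hi e)).map Φ

end CurveFamily

end SlabPath

namespace SlabPath

section turan

open Finset

variable {α : Type*} [DecidableEq α] (R : α → α → Prop)

open scoped Classical in
/-- The ordered pairs of related distinct elements. -/
noncomputable def edgePairs (S : Finset α) : Finset (α × α) :=
  S.offDiag.filter fun p => R p.1 p.2

variable {R}

/-- A weak form of Turán's theorem. -/
theorem two_mul_card_le_card_edgePairs (hR : ∀ x y, R x y → R y x) {a : ℕ} (r : ℕ) :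
    ∀ S : Finset α, (∀ A ⊆ S, (∀ x ∈ A, ∀ y ∈ A, x ≠ y → ¬ R x y) → #A ≤ a) →
      2 * r * #S ≤ #(edgePairs R S) + a * (r * (r + 1)) := by
  classical
  induction r with
  | zero => simp
  | succ r ih =>
    intro S hS
    obtain ⟨Ind, hI⟩ : ∃ Ind : Finset α → Prop, ∀ A, Ind A ↔ ∀ x ∈ A, ∀ y ∈ A, x ≠ y → ¬ R x y :=
      ⟨_, fun _ => Iff.rfl⟩
    obtain ⟨A, hA, hmax⟩ := (S.powerset.filter Ind).exists_max_image card ⟨∅, by simp [hI]⟩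
    rw [mem_filter, mem_powerset, hI] at hA
    obtain ⟨hAS, hind⟩ := hA
    have hnb : ∀ x ∈ S \ A, ∃ y ∈ A, R x y := by
      intro x hx
      rw [mem_sdiff] at hx
      by_contra! h
      have := hmax (insert x A) (by
        rw [mem_filter, mem_powerset, hI]
        refine ⟨insert_subset hx.1 hAS, fun u hu w hw hne => ?_⟩
        rw [mem_insert] at hu hw
        rcases hu with rfl | hu <;> rcases hw with rfl | hw
        · exact absurd rfl hne
        · exact h w hw
        · exact fun h' => h u hu (hR _ _ h')
        · exact hind u hu w hw hne)
      rw [card_insert_of_notMem hx.2] at this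
      omega
    choose! nb hnbA hnbR using hnb
    have ihB := ih (S \ A) fun B hB => hS B (hB.trans sdiff_subset)
    have hac := hS A hAS hind
    have hcard : #(S \ A) + #A = #S := card_sdiff_add_card_eq_card hAS
    have hsub : edgePairs R (S \ A) ∪ ((S \ A).image (fun x => (x, nb x)) ∪
        (S \ A).image fun x => (nb x, x)) ⊆ edgePairs R S := by
      intro p hp
      simp only [edgePairs, mem_union, mem_filter, mem_offDiag, mem_image] at hp ⊢
      rcases hp with ⟨⟨h1, h2, h3⟩, h4⟩ | ⟨x, hx, rfl⟩ | ⟨x, hx, rfl⟩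
      · exact ⟨⟨sdiff_subset h1, sdiff_subset h2, h3⟩, h4⟩
      · have h1 := hnbA x hx
        refine ⟨⟨sdiff_subset hx, hAS h1, ?_⟩, hnbR x hx⟩
        intro e
        simp only at e
        rw [← e] at h1
        exact (mem_sdiff.1 hx).2 h1
      · have h1 := hnbA x hx
        refine ⟨⟨hAS h1, sdiff_subset hx, ?_⟩, hR _ _ (hnbR x hx)⟩
        intro e
        simp only at e
        rw [e] at h1
        exact (mem_sdiff.1 hx).2 h1
    have hc := card_le_card hsub
    rw [card_union_of_disjoint, card_union_of_disjoint, card_image_of_injective,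
      card_image_of_injective] at hc
    · have : 2 * (r + 1) * #S = 2 * r * #(S \ A) + 2 * #(S \ A) + 2 * (r + 1) * #A := by
        rw [← hcard]; ring
      have h2 : 2 * (r + 1) * #A ≤ 2 * (r + 1) * a := Nat.mul_le_mul_left _ hac
      have h3 : a * ((r + 1) * (r + 1 + 1)) = a * (r * (r + 1)) + 2 * (r + 1) * a := by ring
      omega
    · exact fun x y h => (Prod.ext_iff.1 h).2
    · exact fun x y h => (Prod.ext_iff.1 h).1
    · rw [disjoint_left]
      simp only [mem_image]
      rintro _ ⟨x, hx, rfl⟩ ⟨y, hy, e⟩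
      have := (Prod.ext_iff.1 e).1
      simp only at this
      exact (mem_sdiff.1 hx).2 (this ▸ hnbA y hy)
    · rw [disjoint_left]
      simp only [edgePairs, mem_union, mem_filter, mem_offDiag, mem_image]
      rintro _ ⟨⟨h1, h2, -⟩, -⟩ (⟨x, hx, rfl⟩ | ⟨x, hx, rfl⟩)
      · exact (mem_sdiff.1 h2).2 (hnbA x hx)
      · exact (mem_sdiff.1 h1).2 (hnbA x hx)

end turan

lemma sq_le_of_many {n m s c : ℕ} (hn : 0 < n) (hs : m ≤ 2 * s)
    (h : ∀ r, 2 * r * m ≤ c + 11 * n * (r * (r + 1))) : m ^ 2 ≤ 12 * n * (c + 2 * s) := by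
  set r := m / (12 * n) with hr
  have h1 : 12 * n * r ≤ m := Nat.mul_div_le _ _
  have h2 : m < 12 * n * (r + 1) := by
    rw [mul_add, mul_one]
    exact Nat.lt_mul_div_succ m (by omega)
  have h3 := h r
  zify at *
  have h4 : 0 ≤ ((m:ℤ) - 12 * n * r) * (12 * n * (r + 1) - m) := mul_nonneg (by linarith) (by linarith)
  have h5 : (0:ℤ) ≤ n := by linarith
  have h6 : 0 ≤ (n:ℤ) ^ 2 * (r * (r + 1)) := by positivity
  nlinarith [mul_le_mul_of_nonneg_left h3 h5, mul_le_mul_of_nonneg_left hs h5]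

lemma sq_le_of_few {n m s p c : ℕ} (hn : 0 < n) (hm : 4 * n < m) (hp : p + s = m) (hs : 2 * s ≤ m)
    (h : ∀ r, 2 * r * p ≤ c + 3 * n * (r * (r + 1))) : m ^ 2 ≤ 12 * n * (c + 2 * s) := by
  obtain ⟨r, hr1, hr2⟩ : ∃ r : ℕ, 6 * n * (r + 2) ≤ m + 8 * n ∧ m ≤ 6 * n * (r + 2) + 8 * n := by
    rcases lt_or_ge m (12 * n) with c | c
    · exact ⟨0, by omega, by omega⟩
    · have h1 : 6 * n * (m / (6 * n)) ≤ m := Nat.mul_div_le _ _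
      have h2 : m < 6 * n * (m / (6 * n) + 1) := by
        rw [mul_add, mul_one]
        exact Nat.lt_mul_div_succ m (by omega)
      have h3 : 2 ≤ m / (6 * n) := (Nat.le_div_iff_mul_le (by omega)).2 (by omega)
      obtain ⟨q, hq⟩ := Nat.exists_eq_add_of_le h3
      refine ⟨q, ?_, ?_⟩
      · rw [hq, Nat.add_comm 2 q] at h1; omega
      · rw [hq] at h2
        have : 6 * n * (2 + q + 1) = 6 * n * (q + 2) + 6 * n := by ring
        omega
  have h3 := h (r + 1)
  zify at *
  have h5 : (0:ℤ) ≤ n := hn.le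
  have h4 : 0 ≤ ((m:ℤ) + 8 * n - 6 * n * (r + 2)) * (6 * n * (r + 2) + 8 * n - m) :=
    mul_nonneg (by linarith) (by linarith)
  have h6 : 0 ≤ (r:ℤ) * (n * (m - 2 * s)) := by
    have : (0:ℤ) ≤ m - 2 * s := by linarith
    positivity
  have h7 : 0 ≤ (n:ℤ) ^ 2 * r := by positivity
  have h8 : (p:ℤ) = m - s := by linarith
  rw [h8] at h3
  nlinarith [mul_le_mul_of_nonneg_left h3 h5]

end SlabPath

namespace PlaneDrawing

open Set SlabPath

variable {n m : ℕ} (D : PlaneDrawing n m)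

/-- The edge `e`, extended to a curve on the real line. -/
noncomputable def curve (e : Fin m) (t : ℝ) : ℂ := D.f e (projIcc 0 1 zero_le_one t)

lemma curve_coe (e : Fin m) (t : unitInterval) : D.curve e t = D.f e t := by
  simp [curve]

lemma curve_symm (e : Fin m) (t : unitInterval) : D.curve e (1 - t) = D.f e (unitInterval.symm t) := by
  rw [← curve_coe]; rfl

lemma exists_of_mem_Ioo {t : ℝ} (ht : t ∈ Ioo (0:ℝ) 1) : ∃ s : unitInterval, s ≠ 0 ∧ s ≠ 1 ∧ (s : ℝ) = t :=
  ⟨⟨t, ht.1.le, ht.2.le⟩, fun h => ht.1.ne' (congrArg Subtype.val h),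
    fun h => ht.2.ne (congrArg Subtype.val h), rfl⟩

lemma homotopicIn_of_hom {U : Set ℝ} {V : Set ℂ} {f g : ℝ → ℂ} (hU : Ioo 0 1 ⊆ U) (h : Hom U V f g) :
    HomotopicIn V (fun t => f t) fun t => g t := by
  obtain ⟨H, h1, h2, h3, h4, h5, h6⟩ := h.homotopicIn hU
  exact ⟨H, h1, h2, h3, by simpa using h4, by simpa using h5, h6⟩

lemma curveFamily (hD : D.NonHomotopic) (A : Finset (Fin m)) :
    CurveFamily D.V fun e : A => D.curve e where
  cont e := (D.cont e).comp continuous_projIcc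
  zero e := by simpa [curve] using D.source_mem e
  one e := by simpa [curve] using D.target_mem e
  not_mem e t ht := by
    obtain ⟨s, h0, h1, rfl⟩ := exists_of_mem_Ioo ht
    rw [curve_coe]
    exact D.interior_not_mem e s h0 h1
  nontriv e h := by
    have := homotopicIn_of_hom Ioo_subset_Ico_self h
    refine hD.2 e (.inl ?_)
    simpa [curve] using this
  not_hom e e' hne h := by
    have := homotopicIn_of_hom Ioo_subset_Icc_self h
    simp only [curve_coe] at this
    exact hD.1 e e' (fun h => hne (Subtype.ext h)) (.inl this)
  not_hom' e e' hne h := by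
    have h' := h.reverse
    simp only [_root_.sub_sub_cancel] at h'
    have := homotopicIn_of_hom Ioo_subset_Icc_self h'
    simp only [curve_coe, curve_symm] at this
    exact hD.1 e e' (fun h => hne (Subtype.ext h)) (.inr this)

/-- Two edges cross. -/
def Cross (e e' : Fin m) : Prop :=
  ∃ t t' : unitInterval, (t ≠ 0 ∧ t ≠ 1 ∧ t' ≠ 0 ∧ t' ≠ 1) ∧ D.f e t = D.f e' t'

lemma Cross.symm {e e' : Fin m} (h : D.Cross e e') : D.Cross e' e := by
  obtain ⟨t, t', ⟨a, b, c, d⟩, h⟩ := h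
  exact ⟨t', t, ⟨c, d, a, b⟩, h.symm⟩

/-- An edge crosses itself. -/
def SelfCross (e : Fin m) : Prop :=
  ∃ t t' : unitInterval, (t ≠ 0 ∧ t ≠ 1 ∧ t' ≠ 0 ∧ t' ≠ 1) ∧ t ≠ t' ∧ D.f e t = D.f e t'

lemma card_le_of_not_cross (hD : D.NonHomotopic) (A : Finset (Fin m))
    (hA : ∀ e ∈ A, ∀ e' ∈ A, e ≠ e' → ¬ D.Cross e e') :
    A.card ≤ 11 * n ∧ ((∀ e ∈ A, ¬ D.SelfCross e) → A.card ≤ 3 * n) := by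
  have := (D.curveFamily hD A).card_le D.finV fun e e' hne t ht t' ht' h => by
    obtain ⟨s, h0, h1, rfl⟩ := exists_of_mem_Ioo ht
    obtain ⟨s', h0', h1', rfl⟩ := exists_of_mem_Ioo ht'
    rw [curve_coe, curve_coe] at h
    exact hA e e.2 e' e'.2 (fun h => hne (Subtype.ext h)) ⟨s, s', ⟨h0, h1, h0', h1'⟩, h⟩
  rw [D.cardV, Fintype.card_coe] at this
  refine ⟨this.1, fun hs => this.2 fun e t ht t' ht' h => ?_⟩
  obtain ⟨s, h0, h1, rfl⟩ := exists_of_mem_Ioo ht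
  obtain ⟨s', h0', h1', rfl⟩ := exists_of_mem_Ioo ht'
  simp only [curve_coe] at h
  by_contra hne
  exact hs e e.2 ⟨s, s', ⟨h0, h1, h0', h1'⟩, fun h => hne (congrArg Subtype.val h), h⟩

lemma card_le_encard (S : Finset (Fin m)) (hS : ∀ e ∈ S, D.SelfCross e) :
    (((edgePairs D.Cross Finset.univ).card + 2 * S.card : ℕ) : ℕ∞) ≤
      {p : (Fin m × unitInterval) × (Fin m × unitInterval) |
        p.1 ≠ p.2 ∧ p.1.2 ≠ 0 ∧ p.1.2 ≠ 1 ∧ p.2.2 ≠ 0 ∧ p.2.2 ≠ 1 ∧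
        D.f p.1.1 p.1.2 = D.f p.2.1 p.2.2}.encard := by
  classical
  have hC : ∀ p : edgePairs D.Cross Finset.univ, p.1.1 ≠ p.1.2 ∧ D.Cross p.1.1 p.1.2 := by
    rintro ⟨p, hp⟩
    simpa [edgePairs] using hp
  choose c c' hc hcf using fun p => (hC p).2
  choose d d' hd hne hdf using fun e : S => hS e e.2
  let F : (edgePairs D.Cross Finset.univ) ⊕ (S ⊕ S) →
      (Fin m × unitInterval) × (Fin m × unitInterval) :=
    Sum.elim (fun p => ((p.1.1, c p), (p.1.2, c' p)))
      (Sum.elim (fun e => ((e.1, d e), (e.1, d' e))) fun e => ((e.1, d' e), (e.1, d e)))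
  have hF : Function.Injective F := by
    rintro (p | e | e) (q | x | x) h <;>
      simp only [F, Sum.elim_inl, Sum.elim_inr, Prod.mk.injEq] at h
    · congr 1
      exact Subtype.ext (Prod.ext h.1.1 h.2.1)
    · exact absurd (h.1.1.trans h.2.1.symm) (hC p).1
    · exact absurd (h.1.1.trans h.2.1.symm) (hC p).1
    · exact absurd (h.1.1.symm.trans h.2.1) (hC q).1
    · rw [Subtype.ext h.1.1]
    · obtain rfl := Subtype.ext h.1.1
      exact absurd h.1.2 (hne e)
    · exact absurd (h.1.1.symm.trans h.2.1) (hC q).1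
    · obtain rfl := Subtype.ext h.1.1
      exact absurd h.1.2.symm (hne e)
    · rw [Subtype.ext h.1.1]
  have hsub : Set.range F ⊆ {p : (Fin m × unitInterval) × (Fin m × unitInterval) |
        p.1 ≠ p.2 ∧ p.1.2 ≠ 0 ∧ p.1.2 ≠ 1 ∧ p.2.2 ≠ 0 ∧ p.2.2 ≠ 1 ∧
        D.f p.1.1 p.1.2 = D.f p.2.1 p.2.2} := by
    rintro _ ⟨p | e | e, rfl⟩
    · obtain ⟨h1, h2, h3, h4⟩ := hc p
      exact ⟨fun h => (hC p).1 (congrArg Prod.fst h), h1, h2, h3, h4, hcf p⟩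
    · obtain ⟨h1, h2, h3, h4⟩ := hd e
      exact ⟨fun h => hne e (congrArg Prod.snd h), h1, h2, h3, h4, hdf e⟩
    · obtain ⟨h1, h2, h3, h4⟩ := hd e
      exact ⟨fun h => hne e (congrArg Prod.snd h).symm, h3, h4, h1, h2, (hdf e).symm⟩
  refine le_trans (le_of_eq ?_) (Set.encard_le_encard hsub)
  rw [← Set.image_univ, hF.encard_image, Set.encard_univ, ENat.card_eq_coe_fintype_card]
  simp only [Fintype.card_sum, Fintype.card_coe]
  congr 1
  ring

lemma sq_le (hn : 0 < n) (hm : 4 * n < m) (hD : D.NonHomotopic) :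
    ∃ S : Finset (Fin m), (∀ e ∈ S, D.SelfCross e) ∧
      m ^ 2 ≤ 12 * n * ((edgePairs D.Cross Finset.univ).card + 2 * S.card) := by
  classical
  refine ⟨Finset.univ.filter D.SelfCross, by simp, ?_⟩
  set S := Finset.univ.filter D.SelfCross with hS
  rcases le_total m (2 * S.card) with c | c
  · refine sq_le_of_many hn c fun r => ?_
    have := two_mul_card_le_card_edgePairs (R := D.Cross) (a := 11 * n) (fun _ _ => Cross.symm D) r
      Finset.univ fun A _ hA => (D.card_le_of_not_cross hD A hA).1
    simpa using this
  · have hp : (Finset.univ \ S).card + S.card = m := by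
      rw [Finset.card_sdiff_add_card_eq_card (Finset.subset_univ _), Finset.card_univ, Fintype.card_fin]
    refine sq_le_of_few hn hm hp c fun r => ?_
    have := two_mul_card_le_card_edgePairs (R := D.Cross) (a := 3 * n) (fun _ _ => Cross.symm D) r
      (Finset.univ \ S) fun A hAS hA => (D.card_le_of_not_cross hD A hA).2 fun e he hs => by
        have := hAS he
        simp [hS, hs] at this
    refine this.trans (Nat.add_le_add_right (Finset.card_le_card ?_) _)
    exact Finset.filter_subset_filter _ (Finset.offDiag_mono (Finset.subset_univ _))

end PlaneDrawing

/-- Every non-homotopic drawing in the plane with `n > 1` vertices and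
`m > 4n` edges has crossing number at least `m² / (24n)`. -/
theorem crossing_number_lower_bound (n m : ℕ) (hn : 1 < n) (hm : 4 * n < m)
    (D : PlaneDrawing n m) (hD : D.NonHomotopic) :
    ((m : ℝ≥0∞) ^ 2) / (24 * (n : ℝ≥0∞)) ≤ D.crossingNumber := by
  obtain ⟨S, hS, hsq⟩ := D.sq_le (by omega) hm hD
  have h1 : (((SlabPath.edgePairs D.Cross Finset.univ).card + 2 * S.card : ℕ) : ℝ≥0∞) / 2 ≤
      D.crossingNumber := by
    refine ENNReal.div_le_div_right ?_ _
    have := D.card_le_encard S hS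
    exact_mod_cast ENat.toENNReal_mono this
  refine le_trans ?_ h1
  have h0 : (24 * (n : ℝ≥0∞)) ≠ 0 := by
    have : (n : ℝ≥0∞) ≠ 0 := by exact_mod_cast (by omega : n ≠ 0)
    exact mul_ne_zero (by norm_num) this
  have ht : (24 * (n : ℝ≥0∞)) ≠ ⊤ := ENNReal.mul_ne_top (by norm_num) (ENNReal.natCast_ne_top n)
  rw [ENNReal.div_le_iff h0 ht]
  set c := (SlabPath.edgePairs D.Cross Finset.univ).card + 2 * S.card
  have h2 : (c : ℝ≥0∞) / 2 * (24 * n) = ((12 * n * c : ℕ) : ℝ≥0∞) := by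
    have h3 : (24 : ℝ≥0∞) = 2 * 12 := by norm_num
    rw [h3, mul_assoc, ← mul_assoc, ENNReal.div_mul_cancel (by norm_num) (by norm_num)]
    push_cast
    ring
  rw [h2]
  exact_mod_cast hsq
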